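/- For every ε > 0 there exists a constant C = C(q, ε) > 0 such that the following holds for every natural number N: if A is a subset of {f ∈ 𝔽_q[t] : deg f ≤ N} such that no difference a − b with a, b ∈ A is of the form P − 1 with P ∈ 𝔽_q[t] irreducible, then |A| ≤ C · q^{(N+1)(11/12 + ε)}. -/

import Mathlib

open Polynomial

section Stepanov

variable {k R ι : Type*} [Field k] [CommRing R] [Algebra k[X] R] [Algebra k R]
  [IsScalarTower k k[X] R] (e : Module.Basis ι k[X] R)

/-- Elements whose coordinates in a `k[X]`-basis have degree at most `j`. -/
noncomputable def coordDegreeLE (j : ℕ) : Submodule k R where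
  carrier := {r | ∀ i, (e.repr r i).natDegree ≤ j}
  add_mem' {a b} ha hb i := by
    rw [map_add, Finsupp.add_apply]
    exact (natDegree_add_le _ _).trans (max_le (ha i) (hb i))
  zero_mem' i := by simp
  smul_mem' c a ha i := by
    have : e.repr (c • a) i = C c * e.repr a i := by
      rw [← algebraMap_smul k[X] c a, map_smul, Finsupp.smul_apply, smul_eq_mul]; rfl
    rw [this]
    exact (natDegree_C_mul_le _ _).trans (ha i)

theorem coordDegreeLE_mono {i j : ℕ} (h : i ≤ j) : coordDegreeLE e i ≤ coordDegreeLE e j :=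
  fun _ hr l => (hr l).trans h

/-- Coordinates identify `coordDegreeLE e j` with tuples of polynomials of degree `≤ j`. -/
noncomputable def coordDegreeLEEquiv [Fintype ι] (j : ℕ) :
    coordDegreeLE e j ≃ₗ[k] (ι → degreeLT k (j + 1)) where
  toFun r i := ⟨e.repr r.1 i, by
    exact mem_degreeLT.2 (degree_le_natDegree.trans_lt
      (Nat.cast_lt.2 (Nat.lt_succ_of_le (r.2 i))))⟩
  map_add' a b := by ext; simp
  map_smul' c a := by
    ext i : 2
    change e.repr (c • a.1) i = c • e.repr a.1 i
    rw [← algebraMap_smul k[X] c a.1, map_smul, Finsupp.smul_apply, algebraMap_smul]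
  invFun v := ⟨∑ i, (v i).1 • e i, fun i => by
    classical
    have h : (v i).1.natDegree ≤ j := natDegree_le_iff_coeff_eq_zero.2 fun n hn =>
      coeff_eq_zero_of_degree_lt ((mem_degreeLT.1 (v i).2).trans_le (Nat.cast_le.2 hn))
    simpa [Finsupp.single_apply] using h⟩
  left_inv r := by
    ext; exact e.sum_repr r.1
  right_inv v := by
    classical
    ext i : 2
    simp [Finsupp.single_apply]

instance [Fintype ι] (j : ℕ) : FiniteDimensional k (coordDegreeLE e j) :=
  haveI : FiniteDimensional k (degreeLT k (j + 1)) :=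
    LinearEquiv.finiteDimensional (degreeLTEquiv k (j + 1)).symm
  LinearEquiv.finiteDimensional (coordDegreeLEEquiv e j).symm

theorem finrank_coordDegreeLE [Fintype ι] (j : ℕ) :
    Module.finrank k (coordDegreeLE e j) = Fintype.card ι * (j + 1) := by
  have : FiniteDimensional k (degreeLT k (j + 1)) :=
    LinearEquiv.finiteDimensional (degreeLTEquiv k (j + 1)).symm
  rw [(coordDegreeLEEquiv e j).finrank_eq, Module.finrank_pi_fintype]
  simp [(degreeLTEquiv k (j + 1)).finrank_eq]

theorem smul_mem_coordDegreeLE {P : k[X]} {r : R} {j d : ℕ} (hP : P.natDegree ≤ d)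
    (hr : r ∈ coordDegreeLE e j) : P • r ∈ coordDegreeLE e (d + j) := fun i => by
  rw [map_smul, Finsupp.smul_apply, smul_eq_mul]
  exact natDegree_mul_le.trans (add_le_add hP (hr i))

variable [Fintype ι]

theorem exists_mem_coordDegreeLE (r : R) : ∃ c, r ∈ coordDegreeLE e c :=
  ⟨∑ i, (e.repr r i).natDegree, fun i =>
    Finset.single_le_sum (f := fun i => (e.repr r i).natDegree) (fun _ _ => Nat.zero_le _)
      (Finset.mem_univ i)⟩

theorem exists_forall_mem_coordDegreeLE {κ : Type*} [Finite κ] (v : κ → R) :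
    ∃ c, ∀ a, v a ∈ coordDegreeLE e c := by
  cases nonempty_fintype κ
  choose c hc using fun a => exists_mem_coordDegreeLE e (v a)
  exact ⟨∑ a, c a, fun a => coordDegreeLE_mono e
    (Finset.single_le_sum (f := c) (fun _ _ => Nat.zero_le _) (Finset.mem_univ a)) (hc a)⟩

theorem exists_linearMap_mem_coordDegreeLE (τ : R →ₗ[k[X]] R) :
    ∃ c, ∀ j, ∀ r ∈ coordDegreeLE e j, τ r ∈ coordDegreeLE e (j + c) := by
  obtain ⟨c, hc⟩ := exists_forall_mem_coordDegreeLE e (fun i => τ (e i))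
  refine ⟨c, fun j r hr => ?_⟩
  rw [← e.sum_repr r, map_sum]
  refine Submodule.sum_mem _ fun i _ => ?_
  rw [map_smul]
  exact smul_mem_coordDegreeLE e (hr i) (hc i)

theorem exists_mul_mem_coordDegreeLE :
    ∃ c, ∀ i j, ∀ r ∈ coordDegreeLE e i, ∀ s ∈ coordDegreeLE e j,
      r * s ∈ coordDegreeLE e (i + j + c) := by
  obtain ⟨c, hc⟩ := exists_forall_mem_coordDegreeLE e (fun a : ι × ι => e a.1 * e a.2)
  refine ⟨c, fun i j r hr s hs => ?_⟩
  rw [← e.sum_repr r, ← e.sum_repr s, Finset.sum_mul_sum]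
  refine Submodule.sum_mem _ fun a _ => Submodule.sum_mem _ fun b _ => ?_
  rw [smul_mul_smul_comm]
  exact smul_mem_coordDegreeLE e (natDegree_mul_le.trans (add_le_add (hr a) (hs b))) (hc (a, b))

theorem exists_frobenius_mem_coordDegreeLE [Fintype k] :
    ∃ c, ∀ m j, ∀ r ∈ coordDegreeLE e j,
      r ^ (Fintype.card k) ^ m ∈ coordDegreeLE e ((Fintype.card k) ^ m * (j + c)) := by
  obtain ⟨c, hc⟩ := exists_forall_mem_coordDegreeLE e (fun i => e i ^ Fintype.card k)
  have hq : 2 ≤ Fintype.card k := Fintype.one_lt_card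
  have h1 : ∀ j, ∀ r ∈ coordDegreeLE e j,
      r ^ Fintype.card k ∈ coordDegreeLE e (Fintype.card k * j + c) := by
    intro j r hr
    have : r ^ Fintype.card k = ∑ i, (e.repr r i) ^ Fintype.card k • e i ^ Fintype.card k := by
      have := map_sum (FiniteField.frobeniusAlgHom k R) (fun i => e.repr r i • e i) Finset.univ
      rw [e.sum_repr] at this
      simpa [FiniteField.coe_frobeniusAlgHom, _root_.smul_pow] using this
    rw [this]
    refine Submodule.sum_mem _ fun i _ => smul_mem_coordDegreeLE e ?_ (hc i)
    exact natDegree_pow_le.trans (Nat.mul_le_mul_left _ (hr i))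
  have h2 : ∀ m j, ∀ r ∈ coordDegreeLE e j, r ^ (Fintype.card k) ^ m ∈
      coordDegreeLE e ((Fintype.card k) ^ m * j + c * ((Fintype.card k) ^ m - 1)) := by
    intro m
    induction m with
    | zero => intro j r hr; simpa using hr
    | succ m ih =>
      intro j r hr
      have := h1 _ _ (ih j r hr)
      rw [← pow_mul, ← pow_succ] at this
      refine coordDegreeLE_mono e ?_ this
      have hQ : 1 ≤ Fintype.card k ^ m := Nat.one_le_pow _ _ (by omega)
      obtain ⟨Q, hQ'⟩ := Nat.exists_eq_add_of_le hQ
      obtain ⟨p, hp⟩ := Nat.exists_eq_add_of_le hq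
      rw [pow_succ, hQ', hp]
      have : (1 + Q) * (2 + p) - 1 = 1 + 2 * Q + p + Q * p := by
        rw [show (1 + Q) * (2 + p) = 2 + 2 * Q + p + Q * p by ring]; omega
      rw [this, Nat.add_sub_cancel_left]
      nlinarith [Nat.zero_le (c * p)]
  refine ⟨c, fun m j r hr => coordDegreeLE_mono e ?_ (h2 m j r hr)⟩
  rw [mul_add, mul_comm c]
  gcongr
  omega

theorem natDegree_det_le_card_mul [DecidableEq ι] (M : Matrix ι ι k[X]) {d : ℕ}
    (h : ∀ i j, (M i j).natDegree ≤ d) : M.det.natDegree ≤ Fintype.card ι * d := by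
  rw [Matrix.det_apply]
  refine natDegree_sum_le_of_forall_le _ _ fun σ _ => ?_
  refine (natDegree_smul_le _ _).trans ((natDegree_prod_le _ _).trans ?_)
  refine (Finset.sum_le_card_nsmul _ _ d fun i _ => h _ _).trans ?_
  simp

omit [Fintype ι] in
theorem natDegree_le_of_smul_mem {P : k[X]} {r : R} {j : ℕ} (h0 : P • r ≠ 0)
    (h : P • r ∈ coordDegreeLE e j) : P.natDegree ≤ j := by
  obtain ⟨i, hi⟩ : ∃ i, e.repr (P • r) i ≠ 0 := by
    by_contra! H
    exact h0 (e.ext_elem fun i => by rw [H, map_zero, Finsupp.zero_apply])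
  refine le_trans ?_ (h i)
  rw [map_smul, Finsupp.smul_apply, smul_eq_mul] at hi ⊢
  rw [natDegree_mul (left_ne_zero_of_mul hi) (right_ne_zero_of_mul hi)]
  omega

theorem order_le_of_mem_coordDegreeLE (φ : R →ₐ[k[X]] PowerSeries k)
    (hφ : Function.Injective φ) :
    ∃ c, ∀ j, ∀ r ∈ coordDegreeLE e j, r ≠ 0 →
      (φ r).order.toNat ≤ Fintype.card ι * (j + c) := by
  classical
  have : IsDomain R := hφ.isDomain φ.toRingHom
  obtain ⟨c₁, h1⟩ := exists_mul_mem_coordDegreeLE e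
  obtain ⟨c₂, h2⟩ := exists_forall_mem_coordDegreeLE e e
  refine ⟨c₁ + c₂, fun j r hr h0 => ?_⟩
  set M := Algebra.leftMulMatrix e r with hM
  have hdet : M.det ≠ 0 := by
    intro h
    obtain ⟨v, hv, hv0⟩ := Matrix.exists_mulVec_eq_zero_iff.2 h
    have := Algebra.leftMulMatrix_mulVec_repr e r (∑ i, v i • e i)
    have hrep : (e.repr (∑ i, v i • e i) : ι → k[X]) = v := by
      ext1 i; simp [Finsupp.single_apply]
    rw [hrep, ← hM, hv0] at this
    have h3 : r * (∑ i, v i • e i) = 0 := e.ext_elem fun i => by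
      rw [← congrFun this i]; simp
    rcases mul_eq_zero.1 h3 with h4 | h4
    · exact h0 h4
    · apply hv; rw [← hrep, h4]; simp
  have hdvd : r ∣ algebraMap k[X] R M.det := by
    refine ⟨∑ i, (M.adjugate.mulVec (e.repr 1)) i • e i, e.ext_elem fun i => ?_⟩
    rw [← Algebra.leftMulMatrix_mulVec_repr e r]
    have hrep : (e.repr (∑ i, (M.adjugate.mulVec (e.repr 1)) i • e i) : ι → k[X])
        = M.adjugate.mulVec (e.repr 1) := by
      ext1 i; simp [Finsupp.single_apply]
    rw [hrep, Matrix.mulVec_mulVec, ← hM, Matrix.mul_adjugate, Matrix.smul_mulVec,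
      Matrix.one_mulVec, Algebra.algebraMap_eq_smul_one, map_smul]
    rfl
  have hdeg : M.det.natDegree ≤ Fintype.card ι * (j + (c₁ + c₂)) := by
    refine natDegree_det_le_card_mul M fun a b => ?_
    rw [hM, Algebra.leftMulMatrix_eq_repr_mul]
    exact (h1 _ _ _ hr _ (h2 b) a).trans (by omega)
  refine le_trans ?_ hdeg
  obtain ⟨s, hs⟩ := hdvd
  have h5 := congrArg φ hs
  rw [map_mul, AlgHom.commutes] at h5
  have h6 : (φ r).order ≤ (M.det.natDegree : ℕ) := by
    calc (φ r).order ≤ (φ r).order + (φ s).order := le_self_add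
      _ = (algebraMap k[X] (PowerSeries k) M.det).order := by rw [h5, PowerSeries.order_mul]
      _ ≤ _ := PowerSeries.order_le _ (by
        rw [PowerSeries.algebraMap_apply']
        simpa using hdet)
  exact ENat.toNat_le_of_le_natCast h6

end Stepanov

section StepanovMain

variable {k R ι : Type*} [Field k] [CommRing R] [Algebra k[X] R] [Algebra k R]
  [IsScalarTower k k[X] R]

theorem exists_finset_orders {V : Type*} [AddCommGroup V] [Module k V] [FiniteDimensional k V]
    (φ : V →ₗ[k] PowerSeries k) {b : ℕ}
    (hb : ∀ r : V, r ≠ 0 → φ r ≠ 0 ∧ (φ r).order.toNat ≤ b) :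
    ∃ S : Finset ℕ, Module.finrank k V ≤ S.card ∧
      ∀ v : S, ∃ f : V, f ≠ 0 ∧ (φ f).order.toNat = v := by
  classical
  refine ⟨(Finset.range (b + 1)).filter fun v => ∃ f : V, f ≠ 0 ∧ (φ f).order.toNat = v, ?_,
    fun v => (Finset.mem_filter.1 v.2).2⟩
  set S := (Finset.range (b + 1)).filter fun v => ∃ f : V, f ≠ 0 ∧ (φ f).order.toNat = v
  let L : V →ₗ[k] (S → k) := LinearMap.pi fun v => (PowerSeries.coeff (v : ℕ)) ∘ₗ φ
  have hL : Function.Injective L := by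
    rw [← LinearMap.ker_eq_bot, LinearMap.ker_eq_bot']
    intro f hf
    by_contra h0
    have hv : (φ f).order.toNat ∈ S := Finset.mem_filter.2
      ⟨Finset.mem_range.2 (Nat.lt_succ_of_le (hb f h0).2), f, h0, rfl⟩
    exact PowerSeries.coeff_order (hb f h0).1 (congrFun hf ⟨_, hv⟩)
  have := LinearMap.finrank_le_finrank_of_injective hL
  simpa using this

theorem sum_mul_pow_ne_zero {S : Finset ℕ} {Q : ℕ} (g f : S → PowerSeries k)
    (hf : ∀ v, f v ≠ 0 ∧ (f v).order.toNat = v) (hg : ∀ v, g v ≠ 0 → (g v).order.toNat < Q)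
    (h0 : g ≠ 0) : ∑ v, g v * f v ^ Q ≠ 0 := by
  classical
  obtain ⟨w, hw⟩ : ∃ w, g w ≠ 0 := by
    by_contra! H; exact h0 (funext H)
  have hne : (Finset.univ.filter fun v => g v ≠ 0).Nonempty := ⟨w, by simpa using hw⟩
  set v₀ := (Finset.univ.filter fun v => g v ≠ 0).min' hne with hv₀
  have hv₀g : g v₀ ≠ 0 := by
    exact (Finset.mem_filter.1 (Finset.min'_mem _ hne)).2
  have hmin : ∀ v, g v ≠ 0 → v₀ ≤ v := fun v hv => Finset.min'_le _ _ (by simpa using hv)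
  have hord : ∀ v, g v ≠ 0 → (g v * f v ^ Q).order = ((g v).order.toNat + Q * v : ℕ) := by
    intro v hv
    rw [PowerSeries.order_mul, PowerSeries.order_pow, ← PowerSeries.coe_toNat_order hv,
      ← PowerSeries.coe_toNat_order (hf v).1, (hf v).2]
    push_cast
    simp
  intro hsum
  have hc := congrArg (PowerSeries.coeff ((g v₀).order.toNat + Q * v₀)) hsum
  rw [map_sum, map_zero, Finset.sum_eq_single v₀] at hc
  · have h1 : g v₀ * f v₀ ^ Q ≠ 0 := mul_ne_zero hv₀g (pow_ne_zero _ (hf _).1)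
    have h2 := PowerSeries.coeff_order h1
    rw [hord _ hv₀g] at h2
    exact h2 hc
  · intro v _ hv
    by_cases hgv : g v = 0
    · simp [hgv]
    refine PowerSeries.coeff_of_lt_order _ ?_
    rw [hord v hgv, Nat.cast_lt]
    have h1 : (v₀ : ℕ) < v := lt_of_le_of_ne (hmin v hgv) fun h => hv (Subtype.ext h.symm)
    have h2 := hg v₀ hv₀g
    have h3 : Q * (v₀ + 1 : ℕ) ≤ Q * v := Nat.mul_le_mul_left _ h1
    rw [mul_add] at h3
    omega
  · simp

variable [Fintype ι] [Fintype k]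

/-- Stepanov's auxiliary polynomial construction: if the `Q²`-power map agrees modulo `P` with a
linear map, `Q = |k|^m`, then `P` has degree at most `Q² / rank + O(Q)`. -/
theorem stepanov_natDegree_le [Nontrivial R] (e : Module.Basis ι k[X] R)
    (φ : R →ₐ[k[X]] PowerSeries k)
    (hφ : Function.Injective φ) (τ : R →ₗ[k[X]] R) :
    ∃ C : ℕ, ∀ (m : ℕ) (P : k[X]), P.natDegree ≤ (Fintype.card k ^ m) ^ 2 →
      (∀ r : R, (∃ s, r ^ (Fintype.card k ^ m) = P • s) → ∃ s, r = P • s) →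
      (∀ r : R, ∃ s, r ^ (Fintype.card k ^ m) ^ 2 - τ r = P • s) →
      Fintype.card ι * P.natDegree ≤
        (Fintype.card k ^ m) ^ 2 + C * Fintype.card k ^ m := by
  classical
  obtain ⟨c₁, h1⟩ := exists_mul_mem_coordDegreeLE e
  obtain ⟨c₂, h2⟩ := exists_linearMap_mem_coordDegreeLE e τ
  obtain ⟨c₃, h3⟩ := exists_frobenius_mem_coordDegreeLE e
  obtain ⟨c₄, h4⟩ := order_le_of_mem_coordDegreeLE e φ hφ
  obtain ⟨c, hc⟩ : ∃ c, c₁ ≤ c ∧ c₂ ≤ c ∧ c₃ ≤ c ∧ c₄ ≤ c :=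
    ⟨c₁ + c₂ + c₃ + c₄, by omega⟩
  have hD : 0 < Fintype.card ι := Fintype.card_pos_iff.2 e.index_nonempty
  set D := Fintype.card ι with hDdef
  set Q₀ := D * (c + 1) * c + 3 * c + 3 + D * c + D with hQ₀
  refine ⟨D * Q₀ + D * (2 * c + 3), fun m P hP hred hcong => ?_⟩
  set Q := Fintype.card k ^ m with hQ
  have hQ1 : 1 ≤ Q := Nat.one_le_pow _ _ Fintype.card_pos
  by_cases hQs : Q < Q₀
  · calc D * P.natDegree ≤ D * (Q * Q) := by rw [← sq]; gcongr
      _ ≤ D * (Q₀ * Q) := by gcongr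
      _ ≤ _ := by nlinarith [Nat.zero_le (D * (2 * c + 3) * Q), Nat.zero_le (Q ^ 2)]
  push Not at hQs
  obtain ⟨B, hB⟩ : ∃ B, (Q - 1) / D = B + c := by
    refine ⟨(Q - 1) / D - c, ?_⟩
    have : c ≤ (Q - 1) / D := by
      rw [Nat.le_div_iff_mul_le hD, mul_comm]
      omega
    omega
  have hB1 : D * (B + c) < Q := by
    have := Nat.mul_div_le (Q - 1) D
    rw [hB] at this; omega
  have hB2 : Q ≤ D * (B + c + 1) := by
    have := Nat.lt_mul_div_succ (Q - 1) hD
    rw [hB] at this; omega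
  obtain ⟨a, ha1, ha2⟩ : ∃ a, D * a ≤ Q + D * (c + 1) ∧ Q + D * (c + 1) < D * (a + 1) := by
    refine ⟨(Q + D * (c + 1)) / D, Nat.mul_div_le _ _, Nat.lt_mul_div_succ _ hD⟩
  set T := Q * (B + c) + a + 2 * c with hT
  have hdim : T + 1 < D * (a + 1) * (B + 1) := by
    have e1 : a ≤ Q + c + 1 := by
      by_contra! h
      have : D * (Q + c + 2) ≤ D * a := Nat.mul_le_mul_left _ h
      nlinarith
    have e2 : (Q + D * (c + 1) + 1) * (B + 1) ≤ D * (a + 1) * (B + 1) :=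
      Nat.mul_le_mul_right _ ha2
    have e3 : Q * (c + 1) ≤ D * (B + c + 1) * (c + 1) := Nat.mul_le_mul_right _ hB2
    have e4 : D * (c + 1) * c + 3 * c + 3 ≤ Q := by omega
    rw [hT]
    nlinarith
  obtain ⟨S, hS, hf⟩ := exists_finset_orders (V := coordDegreeLE e a)
    ((φ.toLinearMap.restrictScalars k).comp (coordDegreeLE e a).subtype) (b := D * (a + c₄))
    (fun r hr => ⟨by
      have hr' : (r : R) ≠ 0 := fun h => hr (Subtype.ext h)
      exact fun h => hr' (hφ (h.trans (map_zero φ).symm)), 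
      h4 a r r.2 fun h => hr (Subtype.ext h)⟩)
  choose f hf0 hfv using hf
  rw [finrank_coordDegreeLE] at hS
  let F : R →ₗ[k] R := ((FiniteField.frobeniusAlgHom k R) ^ m).toLinearMap
  have hF : ∀ r, F r = r ^ Q := fun r => by
    simp [F, AlgHom.coe_pow, FiniteField.coe_frobeniusAlgHom, pow_iterate, hQ]
  let L₀ : (S → coordDegreeLE e B) →ₗ[k] R := ∑ v : S,
    (LinearMap.mulRight k (τ (f v))).comp
      (F.comp ((coordDegreeLE e B).subtype.comp (LinearMap.proj v)))
  have hL₀ : ∀ g, L₀ g = ∑ v, (g v : R) ^ Q * τ (f v) := fun g => by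
    simp [L₀, hF]
  let L : (S → coordDegreeLE e B) →ₗ[k] coordDegreeLE e T := L₀.codRestrict _ fun g => by
    rw [hL₀]
    refine Submodule.sum_mem _ fun v _ => ?_
    refine coordDegreeLE_mono e ?_ (h1 _ _ _ (h3 m _ _ (g v).2) _ (h2 _ _ (f v).2))
    have : Q * (B + c₃) ≤ Q * (B + c) := Nat.mul_le_mul_left _ (by omega)
    rw [← hQ, hT]; omega
  have hker : L.ker ≠ ⊥ := by
    apply LinearMap.ker_ne_bot_of_finrank_lt
    rw [finrank_coordDegreeLE, Module.finrank_pi_fintype]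
    simp only [finrank_coordDegreeLE, Finset.sum_const, Finset.card_univ, Fintype.card_coe,
      smul_eq_mul]
    calc D * (T + 1) < D * (D * (a + 1) * (B + 1)) := Nat.mul_lt_mul_of_pos_left hdim hD
      _ = D * (a + 1) * (D * (B + 1)) := by ring
      _ ≤ _ := Nat.mul_le_mul_right _ hS
  obtain ⟨g, hg, hg0⟩ := Submodule.exists_mem_ne_zero_of_ne_bot hker
  have hg1 : ∑ v, (g v : R) ^ Q * τ (f v) = 0 := by
    rw [← hL₀]
    exact congrArg Subtype.val (LinearMap.mem_ker.1 hg)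
  set H := ∑ v, (g v : R) * (f v : R) ^ Q with hH
  have hH0 : H ≠ 0 := by
    intro h
    have h5 := congrArg φ h
    rw [hH, map_sum, map_zero] at h5
    simp only [map_mul, map_pow] at h5
    refine sum_mul_pow_ne_zero (k := k) (fun v => φ (g v)) (fun v => φ (f v)) ?_ ?_ ?_ h5
    · intro v
      refine ⟨fun h => hf0 v (Subtype.ext (hφ (h.trans (map_zero φ).symm))), hfv v⟩
    · intro v hv
      refine lt_of_le_of_lt (h4 B _ (g v).2 fun h => hv (by rw [h, map_zero])) ?_
      refine lt_of_le_of_lt (Nat.mul_le_mul_left _ ?_) hB1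
      omega
    · intro h
      refine hg0 (funext fun v => Subtype.ext (hφ ?_))
      exact (congrFun h v).trans (map_zero φ).symm
  have hHQ : ∃ s, H ^ Q = P • s := by
    choose s hs using hcong
    refine ⟨∑ v, (g v : R) ^ Q * s (f v), ?_⟩
    rw [← hF, hH, map_sum, Finset.smul_sum, ← sub_zero (∑ v, F _), ← hg1,
      ← Finset.sum_sub_distrib]
    refine Finset.sum_congr rfl fun v _ => ?_
    rw [hF, mul_pow, ← pow_mul, ← sq, ← mul_sub, hs, mul_smul_comm]
  obtain ⟨s, hs⟩ := hred H hHQ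
  have hHmem : H ∈ coordDegreeLE e (B + Q * (a + c) + c) := by
    refine Submodule.sum_mem _ fun v _ => ?_
    refine coordDegreeLE_mono e ?_ (h1 _ _ _ (g v).2 _ (h3 m _ _ (f v).2))
    have : Q * (a + c₃) ≤ Q * (a + c) := Nat.mul_le_mul_left _ (by omega)
    rw [← hQ]; omega
  rw [hs] at hHmem hH0
  have := natDegree_le_of_smul_mem e hH0 hHmem
  calc D * P.natDegree ≤ D * (B + Q * (a + c) + c) := Nat.mul_le_mul_left _ this
    _ = D * (B + c) + Q * (D * a) + D * Q * c := by ring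
    _ ≤ D * (B + c) + Q * (Q + D * (c + 1)) + D * Q * c := by gcongr
    _ ≤ Q + Q * (Q + D * (c + 1)) + D * Q * c := by gcongr
    _ ≤ _ := by nlinarith [Nat.zero_le (D * Q₀ * Q)]

end StepanovMain

section Coeffwise

variable {k A : Type*} [Field k] [CommRing A] [Algebra k A]

/-- Apply a linear functional to every coefficient of a power series. -/
noncomputable def coeffwise (μ : Module.Dual k A) : PowerSeries A →ₗ[k] PowerSeries k where
  toFun F := PowerSeries.mk fun n => μ (PowerSeries.coeff n F)
  map_add' F G := by ext n; simp
  map_smul' c F := by ext n; simp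

theorem coeff_coeffwise (μ : Module.Dual k A) (F : PowerSeries A) (n : ℕ) :
    PowerSeries.coeff n (coeffwise μ F) = μ (PowerSeries.coeff n F) := by
  simp [coeffwise]

theorem coeffwise_expand (μ : Module.Dual k A) (p : ℕ) (hp : p ≠ 0) (F : PowerSeries A) :
    coeffwise μ (PowerSeries.expand p hp F) = PowerSeries.expand p hp (coeffwise μ F) := by
  ext n
  simp only [coeff_coeffwise, PowerSeries.coeff_expand]
  split_ifs <;> simp

theorem coeffwise_monomial_mul (μ : Module.Dual k A) (j : ℕ) (a : A) (F : PowerSeries A) :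
    coeffwise μ (PowerSeries.monomial j a * F) =
      (X ^ j : k[X]) • coeffwise (μ ∘ₗ LinearMap.mulLeft k a) F := by
  ext n
  rw [Algebra.smul_def, PowerSeries.algebraMap_apply', coeff_coeffwise,
    PowerSeries.monomial_eq_C_mul_X_pow, mul_assoc]
  simp only [Algebra.algebraMap_self, PowerSeries.map_id, Polynomial.coe_pow,
    Polynomial.coe_X]
  simp [PowerSeries.coeff_X_pow_mul', PowerSeries.coeff_C_mul, coeff_coeffwise]
  split_ifs <;> simp

theorem coeffwise_coe_mul (μ : Module.Dual k A) (P : A[X]) (F : PowerSeries A) :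
    coeffwise μ ((P : PowerSeries A) * F) =
      ∑ j ∈ P.support, (X ^ j : k[X]) • coeffwise (μ ∘ₗ LinearMap.mulLeft k (P.coeff j)) F := by
  conv_lhs => rw [← P.sum_monomial_eq, Polynomial.sum]
  rw [← Polynomial.coeToPowerSeries.ringHom_apply, map_sum, Finset.sum_mul, map_sum]
  refine Finset.sum_congr rfl fun j _ => ?_
  rw [Polynomial.coeToPowerSeries.ringHom_apply, Polynomial.coe_monomial, coeffwise_monomial_mul]

theorem coeffwise_map_mul (μ : Module.Dual k A) (P : k[X]) (F : PowerSeries A) :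
    coeffwise μ ((P.map (algebraMap k A) : A[X]) * F : PowerSeries A) = P • coeffwise μ F := by
  induction P using Polynomial.induction_on' with
  | add p q hp hq =>
    rw [Polynomial.map_add, Polynomial.coe_add, add_mul, map_add, hp, hq, add_smul]
  | monomial j c =>
    rw [Polynomial.map_monomial, Polynomial.coe_monomial, coeffwise_monomial_mul,
      ← C_mul_X_pow_eq_monomial, mul_comm, mul_smul]
    congr 1
    ext n
    rw [Algebra.smul_def, PowerSeries.algebraMap_apply']
    simp [coeff_coeffwise, ← Algebra.smul_def]

theorem PowerSeries.expand_card [Fintype k] (f : PowerSeries k) :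
    PowerSeries.expand (Fintype.card k) Fintype.card_ne_zero f = f ^ Fintype.card k := by
  obtain ⟨p, hp⟩ := CharP.exists k
  rcases FiniteField.card k p with ⟨⟨n, npos⟩, ⟨hp, hn⟩⟩
  have : Fact p.Prime := ⟨hp⟩
  dsimp at hn
  have := MvPowerSeries.map_iterateFrobenius_expand p hp.ne_zero (R := k) f n
  simp_rw [hn]
  rw [← this, iterateFrobenius_eq_pow, FiniteField.frobenius_pow hn, RingHom.one_def,
    MvPowerSeries.map_id]
  rfl

/-- A power series solution of the functional equation `Y(X^q) = ℓ Y`. -/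
theorem exists_expand_eq_mul (q : ℕ) (hq : 2 ≤ q) (l : A[X]) (hl : l.coeff 0 = 1) :
    ∃ Y : PowerSeries A, PowerSeries.coeff 0 Y = 1 ∧
      PowerSeries.expand q (by omega) Y = (l : PowerSeries A) * Y := by
  classical
  have hq0 : q ≠ 0 := by omega
  obtain ⟨z, hz⟩ : ∃ z : ℕ → A, ∀ n, z n = if n = 0 then 1 else
      PowerSeries.coeff n ((l : PowerSeries A) * PowerSeries.expand q hq0
        (PowerSeries.mk fun j => if j < n then z j else 0)) := by
    let z : ℕ → A := fun n => Nat.strongRec (motive := fun _ => A) (fun n ih => if n = 0 then 1 else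
      PowerSeries.coeff n ((l : PowerSeries A) * PowerSeries.expand q hq0
        (PowerSeries.mk fun j => if h : j < n then ih j h else 0))) n
    refine ⟨z, fun n => ?_⟩
    simp only [z]
    rw [Nat.strongRec_eq]
    simp only [dite_eq_ite]
  set Z := PowerSeries.mk z with hZ
  have hZ0 : PowerSeries.coeff 0 Z = 1 := by rw [hZ, PowerSeries.coeff_mk, hz]; simp
  have hZe : Z = (l : PowerSeries A) * PowerSeries.expand q hq0 Z := by
    ext n
    by_cases hn : n = 0
    · subst hn
      rw [PowerSeries.coeff_mul]
      simp [PowerSeries.coeff_expand, hl, hZ0]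
    · rw [hZ, PowerSeries.coeff_mk, hz, if_neg hn, PowerSeries.coeff_mul, PowerSeries.coeff_mul]
      refine Finset.sum_congr rfl fun ij hij => ?_
      congr 1
      rw [PowerSeries.coeff_expand, PowerSeries.coeff_expand]
      split_ifs with h
      · have h1 : ij.2 ≤ n := by have := Finset.HasAntidiagonal.mem_antidiagonal.1 hij; omega
        have h2 : ij.2 / q < n := by
          rcases Nat.eq_zero_or_pos ij.2 with h0 | h0
          · rw [h0]; simp; omega
          · exact (Nat.div_lt_self h0 (by omega)).trans_le h1
        simp [h2]
      · rfl
  have hu : PowerSeries.constantCoeff Z = ((1 : Aˣ) : A) := by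
    rw [← PowerSeries.coeff_zero_eq_constantCoeff_apply, hZ0]; rfl
  have hinv : Z * PowerSeries.invOfUnit Z 1 = 1 := PowerSeries.mul_invOfUnit Z 1 hu
  refine ⟨PowerSeries.invOfUnit Z 1, by simp, ?_⟩
  have h1 :
      PowerSeries.expand q hq0 Z * PowerSeries.expand q hq0 (PowerSeries.invOfUnit Z 1) = 1 := by
    rw [← map_mul, hinv, map_one]
  set W := PowerSeries.invOfUnit Z 1
  set EW := PowerSeries.expand q hq0 W
  calc EW = EW * (Z * W) := by rw [hinv, mul_one]
    _ = EW * (((l : PowerSeries A) * PowerSeries.expand q hq0 Z) * W) := by rw [← hZe]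
    _ = (PowerSeries.expand q hq0 Z * EW) * ((l : PowerSeries A) * W) := by ring
    _ = _ := by rw [h1, one_mul]

theorem expand_pow_eq_prod_mul {q : ℕ} (hq : q ≠ 0) {l : A[X]} {Y : PowerSeries A}
    (hY : PowerSeries.expand q hq Y = (l : PowerSeries A) * Y) (n : ℕ) :
    PowerSeries.expand (q ^ n) (pow_ne_zero n hq) Y =
      ((∏ j ∈ Finset.range n, Polynomial.expand A (q ^ j) l : A[X]) : PowerSeries A) * Y := by
  have hcoe : ∀ (p : ℕ) (hp : p ≠ 0) (P : A[X]), PowerSeries.expand p hp (P : PowerSeries A)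
      = (Polynomial.expand A p P : A[X]) := by
    intro p hp P
    ext n
    rw [PowerSeries.coeff_expand, Polynomial.coeff_coe, Polynomial.coeff_coe,
      Polynomial.coeff_expand (Nat.pos_of_ne_zero hp)]
  induction n with
  | zero => simp
  | succ n ih =>
    have : PowerSeries.expand (q ^ (n + 1)) (pow_ne_zero _ hq) Y =
        PowerSeries.expand (q ^ n * q) (mul_ne_zero (pow_ne_zero n hq) hq) Y := by
      congr 1
    rw [this, PowerSeries.expand_mul _ (pow_ne_zero n hq) _ hq, hY, map_mul, ih, hcoe,
      Finset.prod_range_succ]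
    push_cast
    ring

end Coeffwise

section CoeffRing

variable {k A : Type*} [Field k] [CommRing A] [Algebra k A] (Y : PowerSeries A)

/-- The `k[X]`-algebra generated by the coordinates of the power series `Y`. -/
noncomputable def coeffRing : Subalgebra k[X] (PowerSeries k) :=
  (MvPolynomial.aeval (R := k[X]) fun μ : Module.Dual k A => coeffwise μ Y).range

namespace coeffRing

/-- The coordinate of `Y` along a linear functional. -/
noncomputable def coord (μ : Module.Dual k A) : coeffRing (k := k) Y :=
  ⟨coeffwise μ Y, MvPolynomial.X μ, by simp⟩

/-- The coordinate of `P * Y` along a linear functional. -/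
noncomputable def coordMul (μ : Module.Dual k A) (P : A[X]) : coeffRing (k := k) Y :=
  ∑ j ∈ P.support, (X ^ j : k[X]) • coord Y (μ ∘ₗ LinearMap.mulLeft k (P.coeff j))

theorem coe_coordMul (μ : Module.Dual k A) (P : A[X]) :
    (coordMul Y μ P : PowerSeries k) = coeffwise μ ((P : PowerSeries A) * Y) := by
  rw [coeffwise_coe_mul, coordMul]
  simp [coord]

/-- Evaluation of formal polynomials in the coordinates at the coordinates of `b * Y`. -/
noncomputable def ev (b : A) :
    MvPolynomial (Module.Dual k A) k[X] →ₐ[k[X]] coeffRing (k := k) Y :=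
  MvPolynomial.aeval fun μ => coord Y (μ ∘ₗ LinearMap.mulLeft k b)

theorem ev_X (b : A) (μ : Module.Dual k A) :
    ev Y b (MvPolynomial.X μ) = coord Y (μ ∘ₗ LinearMap.mulLeft k b) := by simp [ev]

theorem ev_one_X (μ : Module.Dual k A) : ev Y 1 (MvPolynomial.X μ) = coord Y μ := by
  simp [ev]

theorem ev_one_surjective : Function.Surjective (ev (k := k) Y 1) := by
  rintro ⟨_, f, rfl⟩
  refine ⟨f, Subtype.ext ?_⟩
  change (coeffRing (k := k) Y).val (ev (k := k) Y 1 f) = _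
  rw [← AlgHom.comp_apply]
  change _ = MvPolynomial.aeval (R := k[X]) (fun μ : Module.Dual k A => coeffwise μ Y) f
  congr 1
  refine MvPolynomial.algHom_ext fun μ => ?_
  rw [AlgHom.comp_apply, ev_one_X, MvPolynomial.aeval_X]
  rfl

/-- Substitution `Y ↦ b * Y` on formal polynomials in the coordinates. -/
noncomputable def twist (b : A) :
    MvPolynomial (Module.Dual k A) k[X] →ₐ[k[X]] MvPolynomial (Module.Dual k A) k[X] :=
  MvPolynomial.aeval fun μ => MvPolynomial.X (μ ∘ₗ LinearMap.mulLeft k b)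

theorem ev_twist (a b : A) (f : MvPolynomial (Module.Dual k A) k[X]) :
    ev Y a (twist b f) = ev Y (b * a) f := by
  rw [← AlgHom.comp_apply]
  congr 1
  refine MvPolynomial.algHom_ext fun μ => ?_
  rw [AlgHom.comp_apply, twist, MvPolynomial.aeval_X, ev_X, ev_X, LinearMap.comp_assoc,
    ← LinearMap.mulLeft_mul]

theorem coord_pow {l : A[X]} [Fintype k]
    (hY : PowerSeries.expand (Fintype.card k) Fintype.card_ne_zero Y = (l : PowerSeries A) * Y)
    (μ : Module.Dual k A) : coord Y μ ^ Fintype.card k = coordMul Y μ l := by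
  refine Subtype.ext ?_
  rw [coe_coordMul, ← hY, coeffwise_expand, PowerSeries.expand_card]
  rfl

theorem coord_pow_pow {l : A[X]} [Fintype k]
    (hY : PowerSeries.expand (Fintype.card k) Fintype.card_ne_zero Y = (l : PowerSeries A) * Y)
    (μ : Module.Dual k A) (n : ℕ) : coord Y μ ^ Fintype.card k ^ n =
      coordMul Y μ (∏ j ∈ Finset.range n, Polynomial.expand A (Fintype.card k ^ j) l) := by
  refine Subtype.ext ?_
  rw [coe_coordMul, ← expand_pow_eq_prod_mul _ hY, coeffwise_expand]
  have : ∀ f : PowerSeries k, PowerSeries.expand (Fintype.card k ^ n)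
      (pow_ne_zero n Fintype.card_ne_zero) f = f ^ Fintype.card k ^ n := by
    intro f
    induction n with
    | zero => simp
    | succ n ih =>
      have h : f ^ Fintype.card k ^ (n + 1) = PowerSeries.expand (Fintype.card k * Fintype.card k ^ n)
          (mul_ne_zero Fintype.card_ne_zero (pow_ne_zero n Fintype.card_ne_zero)) f := by
        rw [PowerSeries.expand_mul _ Fintype.card_ne_zero _ (pow_ne_zero n Fintype.card_ne_zero),
          ih, PowerSeries.expand_card, ← pow_mul, pow_succ]
      rw [h]
      simp only [pow_succ, mul_comm]
  rw [this]
  rfl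

theorem finite [Fintype k] [Module.Finite k A] {l : A[X]}
    (hY : PowerSeries.expand (Fintype.card k) Fintype.card_ne_zero Y = (l : PowerSeries A) * Y) :
    Module.Finite k[X] (coeffRing (k := k) Y) := by
  classical
  have : Finite (Module.Dual k A) := Module.finite_of_finite k
  cases nonempty_fintype (Module.Dual k A)
  set q := Fintype.card k with hq
  have hq2 : 2 ≤ q := Fintype.one_lt_card
  let M : Submodule k[X] (coeffRing (k := k) Y) := Submodule.span k[X]
    (Set.range fun s : Module.Dual k A → Fin q => ∏ μ, coord Y μ ^ (s μ : ℕ))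
  have hM : ∀ n, ∀ s : Module.Dual k A → ℕ, ∑ μ, s μ = n → ∏ μ, coord Y μ ^ s μ ∈ M := by
    intro n
    induction n using Nat.strong_induction_on with
    | _ n ih =>
      intro s hs
      by_cases hsq : ∀ μ, s μ < q
      · exact Submodule.subset_span ⟨fun μ => ⟨s μ, hsq μ⟩, rfl⟩
      push Not at hsq
      obtain ⟨μ, hμ⟩ := hsq
      have hsingle : ∀ (ν : Module.Dual k A) (c : ℕ),
          ∏ ρ, coord Y ρ ^ (Pi.single ν c : Module.Dual k A → ℕ) ρ = coord Y ν ^ c := by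
        intro ν c
        rw [Finset.prod_eq_single ν] <;> simp +contextual
      obtain ⟨s', rfl⟩ : ∃ s' : Module.Dual k A → ℕ, s = s' + (Pi.single μ q : _ → ℕ) := by
        refine ⟨s - (Pi.single μ q : _ → ℕ), (tsub_add_cancel_of_le fun ρ => ?_).symm⟩
        by_cases h : ρ = μ
        · subst h; simpa using hμ
        · simp [h]
      have hsum : ∑ ρ, s' ρ + q = n := by
        rw [← hs]; simp [Finset.sum_add_distrib, Finset.sum_pi_single']
      have : ∏ ρ, coord Y ρ ^ (s' + (Pi.single μ q : _ → ℕ)) ρ = ∑ j ∈ l.support, (X ^ j : k[X]) •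
          ∏ ρ, coord Y ρ ^ (s' + (Pi.single (μ ∘ₗ LinearMap.mulLeft k (l.coeff j)) 1 : _ → ℕ)) ρ := by
        simp only [Pi.add_apply, pow_add, Finset.prod_mul_distrib, hsingle]
        rw [coord_pow Y hY, coordMul, Finset.mul_sum]
        refine Finset.sum_congr rfl fun j _ => ?_
        rw [mul_smul_comm, pow_one]
      rw [this]
      refine Submodule.sum_mem _ fun j _ => Submodule.smul_mem _ _ (ih _ ?_ _ rfl)
      simp only [Pi.add_apply, Finset.sum_add_distrib, Finset.sum_pi_single', Finset.mem_univ,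
        if_true]
      omega
  have hMtop : M = ⊤ := by
    rw [eq_top_iff]
    rintro r -
    obtain ⟨f, rfl⟩ := ev_one_surjective Y r
    induction f using MvPolynomial.induction_on' with
    | monomial s c =>
      rw [MvPolynomial.monomial_eq, map_mul, ← MvPolynomial.algebraMap_eq, AlgHom.commutes,
        ← Algebra.smul_def, Finsupp.prod_fintype _ _ (by simp), map_prod]
      refine Submodule.smul_mem _ _ ?_
      simp only [map_pow, ev_one_X]
      exact hM _ _ rfl
    | add f g hf hg => rw [map_add]; exact add_mem hf hg
  exact ⟨hMtop ▸ Submodule.fg_span (Set.finite_range _)⟩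

theorem coordMul_C_add (μ : Module.Dual k A) (b : A) (P : k[X]) (E : A[X]) :
    coordMul Y μ (C b + P.map (algebraMap k A) * E) =
      coord Y (μ ∘ₗ LinearMap.mulLeft k b) + P • coordMul Y μ E := by
  refine Subtype.ext ?_
  rw [coe_coordMul, Subalgebra.coe_add, Subalgebra.coe_smul, coe_coordMul, Polynomial.coe_add,
    Polynomial.coe_mul, add_mul, map_add, mul_assoc, coeffwise_map_mul, Polynomial.coe_C,
    ← PowerSeries.monomial_zero_eq_C_apply, coeffwise_monomial_mul, pow_zero, one_smul]
  rfl

theorem dvd_pow_sub [Fintype k] {l : A[X]}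
    (hY : PowerSeries.expand (Fintype.card k) Fintype.card_ne_zero Y = (l : PowerSeries A) * Y)
    {n : ℕ} {b : A} {P : k[X]} (hP : P ∣ X ^ Fintype.card k ^ n - X)
    (hl : ∃ E : A[X], ∏ j ∈ Finset.range n, Polynomial.expand A (Fintype.card k ^ j) l =
      C b + P.map (algebraMap k A) * E) (f : MvPolynomial (Module.Dual k A) k[X]) :
    algebraMap k[X] (coeffRing (k := k) Y) P ∣ (ev Y 1 f) ^ Fintype.card k ^ n - ev Y b f := by
  set R := coeffRing (k := k) Y
  let F : R →ₐ[k] R := (FiniteField.frobeniusAlgHom k R) ^ n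
  have hF : ∀ r, F r = r ^ Fintype.card k ^ n := fun r => by
    simp [F, AlgHom.coe_pow, FiniteField.coe_frobeniusAlgHom, pow_iterate]
  let I : Ideal R := Ideal.span {algebraMap k[X] R P}
  have key : ((Ideal.Quotient.mk I).comp F.toRingHom).comp (ev Y 1).toRingHom =
      (Ideal.Quotient.mk I).comp (ev Y b).toRingHom := by
    refine MvPolynomial.ringHom_ext' (Polynomial.ringHom_ext (fun a => ?_) ?_) fun μ => ?_
    · simp only [RingHom.comp_apply, AlgHom.toRingHom_eq_coe, RingHom.coe_coe,
        ← MvPolynomial.algebraMap_eq, AlgHom.commutes]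
      rw [hF, ← map_pow, ← C_pow, FiniteField.pow_card_pow]
    · simp only [RingHom.comp_apply, AlgHom.toRingHom_eq_coe, RingHom.coe_coe,
        ← MvPolynomial.algebraMap_eq, AlgHom.commutes]
      rw [hF, Ideal.Quotient.eq, Ideal.mem_span_singleton, ← map_pow, ← map_sub]
      exact map_dvd _ hP
    · simp only [RingHom.comp_apply, AlgHom.toRingHom_eq_coe, RingHom.coe_coe]
      obtain ⟨E, hE⟩ := hl
      rw [hF, Ideal.Quotient.eq, Ideal.mem_span_singleton, ev_one_X, ev_X, coord_pow_pow Y hY, hE,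
        coordMul_C_add, add_sub_cancel_left, Algebra.smul_def]
      exact dvd_mul_right _ _
  have := congrArg (fun g => g f) key
  simp only [RingHom.comp_apply, AlgHom.toRingHom_eq_coe, RingHom.coe_coe] at this
  rwa [hF, Ideal.Quotient.eq, Ideal.mem_span_singleton] at this

theorem dvd_pow_pow_sub [Fintype k] {l : A[X]}
    (hY : PowerSeries.expand (Fintype.card k) Fintype.card_ne_zero Y = (l : PowerSeries A) * Y)
    {n : ℕ} {b : A} {P : k[X]} (hP : P ∣ X ^ Fintype.card k ^ n - X)
    (hl : ∃ E : A[X], ∏ j ∈ Finset.range n, Polynomial.expand A (Fintype.card k ^ j) l =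
      C b + P.map (algebraMap k A) * E) (i : ℕ) (f : MvPolynomial (Module.Dual k A) k[X]) :
    algebraMap k[X] (coeffRing (k := k) Y) P ∣
      (ev Y 1 f) ^ Fintype.card k ^ (n * i) - ev Y (b ^ i) f := by
  induction i generalizing f with
  | zero =>
    rw [pow_zero, mul_zero, pow_zero, pow_one, sub_self]
    exact dvd_zero _
  | succ i ih =>
    have h1 := dvd_pow_sub Y hY hP hl f
    have h2 := ih (twist b f)
    rw [ev_twist, ev_twist, mul_one, ← pow_succ'] at h2
    have h3 := h1.trans (sub_dvd_pow_sub_pow _ _ (Fintype.card k ^ (n * i)))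
    rw [← pow_mul, ← pow_add, show n + n * i = n * (i + 1) by ring] at h3
    have h4 := dvd_add h3 h2
    rwa [sub_add_sub_cancel] at h4

/-- Units `b` for which `Y ↦ b * Y` preserves all algebraic relations between coordinates. -/
def invariantUnits [Finite Aˣ] : Subgroup Aˣ :=
  let S : Submonoid Aˣ :=
    { carrier := {b | ∀ f, ev (k := k) Y 1 f = 0 → ev (k := k) Y b f = 0}
      one_mem' := fun f hf => by simpa using hf
      mul_mem' := fun {a b} ha hb f hf => by
        rw [Units.val_mul, ← ev_twist]
        refine hb _ ?_
        rw [ev_twist, mul_one]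
        exact ha f hf }
  { S with
    inv_mem' := fun {a} ha => by
      have h : a⁻¹ = a ^ (Nat.card Aˣ - 1) := by
        rw [inv_eq_iff_mul_eq_one, ← pow_succ', Nat.sub_add_cancel Nat.card_pos, pow_card_eq_one']
      change a⁻¹ ∈ S
      rw [h]
      exact pow_mem (show a ∈ S from ha) _ }

theorem mem_invariantUnits [Finite Aˣ] {b : Aˣ} : b ∈ invariantUnits (k := k) Y ↔
    ∀ f, ev (k := k) Y 1 f = 0 → ev (k := k) Y b f = 0 := Iff.rfl

theorem card_invariantUnits_le [Finite Aˣ] (hY0 : PowerSeries.coeff 0 Y = 1)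
    [Module.Free k[X] (coeffRing (k := k) Y)] [Module.Finite k[X] (coeffRing (k := k) Y)] :
    Nat.card (invariantUnits (k := k) Y) ≤ Module.finrank k[X] (coeffRing (k := k) Y) := by
  have hs := ev_one_surjective (k := k) Y
  have h1 : ∀ b : invariantUnits (k := k) Y, ∃ σ : coeffRing (k := k) Y →ₐ[k[X]] PowerSeries k,
      ∀ f, σ (ev Y 1 f) = ev (k := k) Y (b : Aˣ) f := by
    intro b
    have hker : RingHom.ker (ev (k := k) Y 1) ≤
        RingHom.ker ((coeffRing (k := k) Y).val.comp (ev (k := k) Y (b : Aˣ))) := by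
      intro f hf
      rw [RingHom.mem_ker] at hf ⊢
      rw [AlgHom.comp_apply, b.2 f hf, map_zero]
    refine ⟨(Ideal.Quotient.liftₐ _ _ hker).comp
      (Ideal.quotientKerAlgEquivOfSurjective hs).symm.toAlgHom, fun f => ?_⟩
    have : (Ideal.quotientKerAlgEquivOfSurjective hs).symm (ev Y 1 f) =
        Ideal.Quotient.mk _ f := by
      rw [AlgEquiv.symm_apply_eq]
      rfl
    rw [AlgHom.comp_apply]
    change Ideal.Quotient.liftₐ _ _ hker
      ((Ideal.quotientKerAlgEquivOfSurjective hs).symm (ev Y 1 f)) = _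
    rw [this]
    rfl
  choose σ hσ using h1
  have hinj : Function.Injective σ := by
    intro b c hbc
    refine Subtype.ext (Units.ext ?_)
    rw [← sub_eq_zero, ← Module.forall_dual_apply_eq_zero_iff k]
    intro μ
    have h : σ b (ev Y 1 (MvPolynomial.X μ)) = σ c (ev Y 1 (MvPolynomial.X μ)) := by rw [hbc]
    rw [hσ, hσ, ev_X, ev_X] at h
    replace h : PowerSeries.coeff 0 (coeffwise (μ ∘ₗ LinearMap.mulLeft k ((b : Aˣ) : A)) Y) =
      PowerSeries.coeff 0 (coeffwise (μ ∘ₗ LinearMap.mulLeft k ((c : Aˣ) : A)) Y) :=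
      congrArg (PowerSeries.coeff 0) h
    rw [coeff_coeffwise, coeff_coeffwise, hY0] at h
    rw [map_sub, sub_eq_zero]
    simpa using h
  exact (Nat.card_le_card_of_injective σ hinj).trans (card_algHom_le_finrank _ _ _)

end coeffRing

/-- Stepanov-type bound for the degree of a product of primes with prescribed Frobenius class. -/
theorem exists_subgroup_natDegree_le (k A : Type*) [Field k] [Fintype k] [CommRing A] [Algebra k A]
    [Module.Finite k A] (l : A[X]) (hl : l.coeff 0 = 1) :
    ∃ (H : Subgroup Aˣ) (C₀ : ℕ), ∀ n, 1 ≤ n → ∀ (b : Aˣ) (P : k[X]),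
      P ∣ X ^ Fintype.card k ^ n - X →
      (∃ E : A[X], ∏ j ∈ Finset.range n, Polynomial.expand A (Fintype.card k ^ j) l =
        C (b : A) + P.map (algebraMap k A) * E) →
      (b ∉ H → P.natDegree ≤ C₀) ∧
      (∀ m, n = 2 * m → b ∈ H →
        Nat.card H * P.natDegree ≤ Fintype.card k ^ n + C₀ * Fintype.card k ^ m) := by
  classical
  have : Finite A := Module.finite_of_finite k
  have hq2 : 2 ≤ Fintype.card k := Fintype.one_lt_card
  obtain ⟨Y, hY0, hY⟩ := exists_expand_eq_mul (Fintype.card k) hq2 l hl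
  have := coeffRing.finite (k := k) Y hY
  set R := coeffRing (k := k) Y
  have : Module.IsTorsionFree k[X] (PowerSeries k) := by
    refine Module.isTorsionFree_iff_algebraMap_injective.2 fun P Q h => ?_
    rw [PowerSeries.algebraMap_apply', PowerSeries.algebraMap_apply', Algebra.algebraMap_self,
      PowerSeries.map_id] at h
    exact Polynomial.coe_injective k h
  have : Module.IsTorsionFree k[X] R := inferInstanceAs
    (Module.IsTorsionFree k[X] (coeffRing (k := k) Y))
  have : Module.Free k[X] R := Module.free_of_finite_type_torsion_free'
  let e := Module.finBasis k[X] R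
  have hs := coeffRing.ev_one_surjective (k := k) Y
  choose lift hlift using hs
  let τ : Aˣ → R →ₗ[k[X]] R := fun b => e.constr k[X] fun i => coeffRing.ev Y (b : A) (lift (e i))
  have hτ : ∀ (b : Aˣ) (r : R), ∃ f, coeffRing.ev Y 1 f = r ∧ coeffRing.ev Y (b : A) f = τ b r := by
    intro b r
    refine ⟨∑ i, e.repr r i • lift (e i), ?_, ?_⟩
    · simp only [map_sum, map_smul, hlift]
      exact e.sum_repr r
    · simp only [map_sum, map_smul]
      rw [Module.Basis.constr_apply_fintype]
      rfl
  have hst := fun b : Aˣ => stepanov_natDegree_le e R.val Subtype.val_injective (τ b)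
  choose C₁ hC₁ using hst
  have hnot : ∀ b : Aˣ, ∃ c, b ∉ coeffRing.invariantUnits (k := k) Y →
      ∃ h : R, h ≠ 0 ∧ h ∈ coordDegreeLE e c ∧
        ∃ f, coeffRing.ev (k := k) Y 1 f = 0 ∧ coeffRing.ev Y (b : A) f = h := by
    intro b
    by_cases hb : b ∈ coeffRing.invariantUnits (k := k) Y
    · exact ⟨0, fun h => absurd hb h⟩
    rw [coeffRing.mem_invariantUnits] at hb
    push Not at hb
    obtain ⟨f, hf, hf'⟩ := hb
    obtain ⟨c, hc⟩ := exists_mem_coordDegreeLE e (coeffRing.ev Y (b : A) f)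
    exact ⟨c, fun _ => ⟨_, hf', hc, f, hf, rfl⟩⟩
  choose C₂ hC₂ using hnot
  cases nonempty_fintype Aˣ
  refine ⟨coeffRing.invariantUnits (k := k) Y, ∑ b, (C₁ b + C₂ b), fun n hn b P hP hrel => ?_⟩
  have hCb : C₁ b + C₂ b ≤ ∑ b, (C₁ b + C₂ b) :=
    Finset.single_le_sum (f := fun b => C₁ b + C₂ b) (fun _ _ => Nat.zero_le _) (Finset.mem_univ b)
  have hcong := coeffRing.dvd_pow_sub Y hY hP hrel
  constructor
  · intro hb
    obtain ⟨h, h0, hc, f, hf, rfl⟩ := hC₂ b hb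
    obtain ⟨s, hs⟩ := hcong f
    rw [hf, zero_pow (by positivity), zero_sub, neg_eq_iff_eq_neg, ← mul_neg,
      ← Algebra.smul_def] at hs
    rw [hs] at hc h0
    have := natDegree_le_of_smul_mem e h0 hc
    omega
  · intro m hm hb
    have hpow : Fintype.card k ^ n = (Fintype.card k ^ m) ^ 2 := by rw [hm, ← pow_mul]; congr 1; ring
    have hXne : (X ^ Fintype.card k ^ n - X : k[X]) ≠ 0 :=
      FiniteField.X_pow_card_pow_sub_X_ne_zero _ (by omega) hq2
    have hdeg : P.natDegree ≤ Fintype.card k ^ n := by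
      refine (natDegree_le_of_dvd hP hXne).trans ?_
      rw [FiniteField.X_pow_card_pow_sub_X_natDegree_eq _ (by omega) hq2]
    have hred : ∀ r : R, (∃ s, r ^ (Fintype.card k ^ m) = P • s) → ∃ s, r = P • s := by
      rintro r ⟨s, hs⟩
      obtain ⟨f, rfl⟩ := coeffRing.ev_one_surjective Y r
      have h1 := coeffRing.dvd_pow_pow_sub Y hY hP hrel (Fintype.card Aˣ) f
      have h2 : ((b : A)) ^ Fintype.card Aˣ = 1 := by
        rw [← Units.val_pow_eq_pow_val, pow_card_eq_one, Units.val_one]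
      rw [h2] at h1
      have h3 :
          algebraMap k[X] R P ∣ (coeffRing.ev Y 1 f) ^ Fintype.card k ^ (n * Fintype.card Aˣ) := by
        refine dvd_trans ⟨s, ?_⟩ (pow_dvd_pow _ (Nat.pow_le_pow_right (by omega) ?_) :
          (coeffRing.ev Y 1 f) ^ Fintype.card k ^ m ∣ _)
        · rw [hs, Algebra.smul_def]
        · have : 1 ≤ Fintype.card Aˣ := Fintype.card_pos
          nlinarith
      obtain ⟨t, ht⟩ := (dvd_sub_right h3).1 h1
      exact ⟨t, by rw [ht, Algebra.smul_def]⟩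
    have hmain := hC₁ b m P (hpow ▸ hdeg) hred (by
      intro r
      obtain ⟨f, hf1, hf2⟩ := hτ b r
      obtain ⟨s, hs⟩ := hcong f
      exact ⟨s, by rw [← hpow, ← hf2, ← hf1, hs, Algebra.smul_def]⟩)
    rw [← hpow] at hmain
    refine le_trans (Nat.mul_le_mul_right _ (coeffRing.card_invariantUnits_le Y hY0)) ?_
    rw [← Module.finrank_eq_card_basis e] at hmain
    refine hmain.trans (by gcongr; omega)

end CoeffRing

section BaseChange

open scoped TensorProduct

variable {k A : Type*} [Field k] [Fintype k] [CommRing A] [Algebra k A]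

lemma FiniteField.expand_card_pow (f : k[X]) (j : ℕ) :
    Polynomial.expand k (Fintype.card k ^ j) f = f ^ Fintype.card k ^ j := by
  induction j with
  | zero => simp
  | succ j ih => rw [pow_succ, ← Polynomial.expand_expand, FiniteField.expand_card, map_pow, ih,
      ← pow_mul]

lemma prod_range_mul_expand (l : A[X]) (q e i : ℕ) :
    ∏ j ∈ Finset.range (e * i), Polynomial.expand A (q ^ j) l =
      ∏ j ∈ Finset.range i, Polynomial.expand A (q ^ (e * j))
        (∏ r ∈ Finset.range e, Polynomial.expand A (q ^ r) l) := by
  induction i with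
  | zero => simp
  | succ i ih =>
    rw [Finset.prod_range_succ, ← ih, mul_add, mul_one, Finset.prod_range_add, map_prod]
    simp only [Polynomial.expand_expand, pow_add]

lemma map_dvd_prod_expand_sub_pow (l : A[X]) (P : k[X]) (c : A) (e : ℕ)
    (h : P.map (algebraMap k A) ∣
      ∏ j ∈ Finset.range e, Polynomial.expand A (Fintype.card k ^ j) l - C c) (i : ℕ) :
    P.map (algebraMap k A) ∣
      ∏ j ∈ Finset.range (e * i), Polynomial.expand A (Fintype.card k ^ j) l - C (c ^ i) := by
  rw [prod_range_mul_expand]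
  induction i with
  | zero => simp
  | succ i ih =>
    rw [Finset.prod_range_succ, pow_succ, C_mul]
    refine dvd_mul_sub_mul ih ?_
    have h1 := map_dvd (Polynomial.expand A (Fintype.card k ^ (e * i))) h
    rw [map_sub, expand_C, ← map_expand, FiniteField.expand_card_pow, Polynomial.map_pow] at h1
    exact (dvd_pow_self _ (pow_pos Fintype.card_pos _).ne').trans h1

omit [Fintype k] in
lemma map_prod_dvd_of_forall_map_dvd (S : Finset k[X])
    (hS : ∀ P ∈ S, P.Monic ∧ Irreducible P) (f : A[X])
    (h : ∀ P ∈ S, P.map (algebraMap k A) ∣ f) :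
    (∏ P ∈ S, P).map (algebraMap k A) ∣ f := by
  rw [Polynomial.map_prod]
  refine Finset.prod_dvd_of_coprime (fun P hP Q hQ hPQ => ?_) h
  refine IsCoprime.map (R := k[X]) (S := A[X]) ?_ (mapRingHom (algebraMap k A))
  refine ((hS P hP).2.isCoprime_or_dvd Q).resolve_right fun hd => hPQ ?_
  exact eq_of_monic_of_associated (hS P hP).1 (hS Q hQ).1
    ((hS P hP).2.associated_of_dvd (hS Q hQ).2 hd)

lemma exists_subgroup_sum_natDegree_le_of_field [Module.Finite k A] (l : A[X]) (cls : k[X] → A)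
    (hrel : ∀ P : k[X], P.Monic → Irreducible P → P.map (algebraMap k A) ∣
      ∏ j ∈ Finset.range P.natDegree, Polynomial.expand A (Fintype.card k ^ j) l - C (cls P))
    (κ : Type*) [Field κ] [Fintype κ] [Algebra k κ] (c : κ) (m : ℕ) (hm0 : 1 ≤ m)
    (hm : Fintype.card κ = Fintype.card k ^ m) (u : Aˣ)
    (hu : (∏ j ∈ Finset.range m, Polynomial.expand A (Fintype.card k ^ j) l).eval₂
      (Algebra.TensorProduct.includeRight : A →ₐ[k] κ ⊗[k] A).toRingHom
      (algebraMap κ (κ ⊗[k] A) c) =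
      (Algebra.TensorProduct.includeRight : A →ₐ[k] κ ⊗[k] A) u) :
    ∃ (N₁ : ℕ) (H : Subgroup Aˣ) (C : ℕ), 1 ≤ N₁ ∧ ∀ M, 1 ≤ M → ∀ (b : Aˣ)
      (S : Finset k[X]), (∀ P ∈ S, P.Monic ∧ Irreducible P ∧ P.natDegree ∣ 2 * N₁ * M ∧
        cls P ^ (2 * N₁ * M / P.natDegree) = b) →
      (b ∉ H → ∑ P ∈ S, P.natDegree ≤ C) ∧
      (b ∈ H → Nat.card H * ∑ P ∈ S, P.natDegree ≤
        Fintype.card k ^ (2 * N₁ * M) + C * Fintype.card k ^ (N₁ * M)) := by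
  classical
  have : Finite A := Module.finite_of_finite k
  have : Finite (κ ⊗[k] A) := Module.finite_of_finite κ
  have : Finite (κ ⊗[k] A)ˣ := inferInstance
  set ι : A →ₐ[k] κ ⊗[k] A := Algebra.TensorProduct.includeRight with hι
  set q := Fintype.card k with hq
  set q' := Fintype.card κ with hq'
  let φ : A[X] →+* (κ ⊗[k] A)[X] :=
    (compRingHom (X + C (algebraMap κ (κ ⊗[k] A) c))).comp (mapRingHom ι.toRingHom)
  have hφC : ∀ a, φ (C a) = C (ι a) := fun a => by simp [φ]
  have hφX : φ X = X + C (algebraMap κ (κ ⊗[k] A) c) := by simp [φ]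
  have hadd : ∀ (j : ℕ) (x y : (κ ⊗[k] A)[X]), (x + y) ^ q' ^ j = x ^ q' ^ j + y ^ q' ^ j := by
    intro j x y
    have := map_add ((FiniteField.frobeniusAlgHom κ (κ ⊗[k] A)[X]) ^ j) x y
    simpa only [AlgHom.coe_pow, FiniteField.coe_frobeniusAlgHom, pow_iterate] using this
  have hexp : ∀ (j : ℕ) (f : A[X]), Polynomial.expand (κ ⊗[k] A) (q' ^ j) (φ f) =
      φ (Polynomial.expand A (q' ^ j) f) := by
    intro j
    have : ((Polynomial.expand (κ ⊗[k] A) (q' ^ j)).toRingHom).comp φ =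
        φ.comp ((Polynomial.expand A (q' ^ j)).toRingHom) := by
      refine Polynomial.ringHom_ext (fun a => ?_) ?_
      · simp [hφC]
      · simp only [AlgHom.toRingHom_eq_coe, RingHom.coe_comp, RingHom.coe_coe, Function.comp_apply,
          hφX, map_add, expand_X, expand_C, map_pow, hadd]
        rw [← C_pow, ← map_pow, FiniteField.pow_card_pow]
    exact fun f => DFunLike.congr_fun this f
  set B : A[X] := ∏ j ∈ Finset.range m, Polynomial.expand A (q ^ j) l with hB
  have hB0 : (φ B).coeff 0 = ι u := by
    rw [coeff_zero_eq_eval_zero, ← hu]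
    simp [φ, eval_comp, eval_map]
  set v : (κ ⊗[k] A)ˣ := Units.map (ι : A →* κ ⊗[k] A) u with hv
  obtain ⟨H', C₀, hmain⟩ := exists_subgroup_natDegree_le κ (κ ⊗[k] A)
    (C ((v⁻¹ : (κ ⊗[k] A)ˣ) : κ ⊗[k] A) * φ B) (by
      rw [coeff_C_mul, hB0]
      exact v.inv_mul)
  refine ⟨m * Nat.card Aˣ, H'.comap (Units.map (ι : A →* κ ⊗[k] A)), C₀,
    Nat.mul_pos hm0 Nat.card_pos, ?_⟩
  intro M hM b S hS
  obtain ⟨n, hn⟩ : ∃ n, n = 2 * (Nat.card Aˣ * M) := ⟨_, rfl⟩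
  have hN : 2 * (m * Nat.card Aˣ) * M = m * n := by rw [hn]; ring
  rw [hN] at hS ⊢
  have hn0 : 1 ≤ n := by
    have := Nat.mul_pos (Nat.card_pos (α := Aˣ)) hM
    omega
  have hvn : v ^ n = 1 := by
    rw [hv, ← map_pow, hn, mul_comm 2, mul_assoc, pow_mul, pow_card_eq_one', one_pow, map_one]
  set R : k[X] := ∏ P ∈ S, P with hR
  have hRmonic : R.Monic := monic_prod_of_monic _ _ fun P hP => (hS P hP).1
  have hR1 : R.map (algebraMap k A) ∣
      ∏ j ∈ Finset.range (m * n), Polynomial.expand A (q ^ j) l - C (b : A) := by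
    refine map_prod_dvd_of_forall_map_dvd S (fun P hP => ⟨(hS P hP).1, (hS P hP).2.1⟩) _ ?_
    intro P hP
    obtain ⟨h1, h2, h3, h4⟩ := hS P hP
    rw [← h4]
    have := map_dvd_prod_expand_sub_pow l P (cls P) P.natDegree (hrel P h1 h2)
      (m * n / P.natDegree)
    rwa [Nat.mul_div_cancel' h3] at this
  have hR2 : R ∣ X ^ q ^ (m * n) - X := by
    have := map_prod_dvd_of_forall_map_dvd (A := k) S
      (fun P hP => ⟨(hS P hP).1, (hS P hP).2.1⟩) (X ^ q ^ (m * n) - X) (by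
        intro P hP
        obtain ⟨h1, h2, h3, h4⟩ := hS P hP
        rw [Algebra.algebraMap_self, Polynomial.map_id, hq, ← Nat.card_eq_fintype_card]
        exact (h2.natDegree_dvd_iff_dvd_X_pow_card_pow_sub_X).1 h3)
    rwa [Algebra.algebraMap_self, Polynomial.map_id] at this
  set P : κ[X] := (R.map (algebraMap k κ)).comp (X + C c) with hP
  have hPdeg : P.natDegree = ∑ P ∈ S, P.natDegree := by
    rw [hP, natDegree_comp, natDegree_X_add_C, mul_one, natDegree_map, hR,
      natDegree_prod_of_monic _ _ fun P hP => (hS P hP).1]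
  have hqq : q' ^ n = q ^ (m * n) := by rw [hm, pow_mul]
  have hP1 : P ∣ X ^ q' ^ n - X := by
    have h1 := map_dvd ((compRingHom (X + C c)).comp (mapRingHom (algebraMap k κ))) hR2
    have h2 : (X + C c) ^ q' ^ n = X ^ q' ^ n + C c := by
      have := map_add ((FiniteField.frobeniusAlgHom κ κ[X]) ^ n) X (C c)
      simp only [AlgHom.coe_pow, FiniteField.coe_frobeniusAlgHom, pow_iterate] at this
      rw [this, ← C_pow, FiniteField.pow_card_pow]
    have h3 : ((compRingHom (X + C c)).comp (mapRingHom (algebraMap k κ)))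
        (X ^ q ^ (m * n) - X) = X ^ q' ^ n - X := by
      rw [← hqq]
      simp [h2]
    rw [h3] at h1
    exact h1
  have hPmap : P.map (algebraMap κ (κ ⊗[k] A)) = φ (R.map (algebraMap k A)) := by
    have h1 : (mapRingHom (algebraMap κ (κ ⊗[k] A))).comp
        ((compRingHom (X + C c)).comp (mapRingHom (algebraMap k κ))) =
        φ.comp (mapRingHom (algebraMap k A)) := by
      refine Polynomial.ringHom_ext (fun a => ?_) ?_
      · simp only [RingHom.coe_comp, Function.comp_apply, coe_mapRingHom, map_C,
          coe_compRingHom_apply, C_comp, hφC, AlgHom.commutes]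
        rw [← IsScalarTower.algebraMap_apply]
      · simp [hφX]
    exact DFunLike.congr_fun h1 R
  have hPrel : ∃ E, ∏ j ∈ Finset.range n, Polynomial.expand (κ ⊗[k] A) (q' ^ j)
      (C ((v⁻¹ : (κ ⊗[k] A)ˣ) : κ ⊗[k] A) * φ B) =
      C ((Units.map (ι : A →* κ ⊗[k] A) b : (κ ⊗[k] A)ˣ) : κ ⊗[k] A) +
        P.map (algebraMap κ (κ ⊗[k] A)) * E := by
    obtain ⟨E, hE⟩ := map_dvd φ hR1
    refine ⟨E, ?_⟩
    have h1 : ∀ j, Polynomial.expand (κ ⊗[k] A) (q' ^ j)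
        (C ((v⁻¹ : (κ ⊗[k] A)ˣ) : κ ⊗[k] A) * φ B) =
        C ((v⁻¹ : (κ ⊗[k] A)ˣ) : κ ⊗[k] A) * φ (Polynomial.expand A (q ^ (m * j)) B) := by
      intro j
      rw [map_mul, expand_C, hexp, hm, pow_mul]
    rw [hPmap, ← hE, map_sub, hφC, prod_range_mul_expand, ← hB,
      Finset.prod_congr rfl fun j _ => h1 j,
      Finset.prod_mul_distrib, Finset.prod_const, Finset.card_range, ← C_pow,
      ← Units.val_pow_eq_pow_val, inv_pow, hvn, map_prod φ]
    simp
  have := hmain n hn0 (Units.map (ι : A →* κ ⊗[k] A) b) P hP1 hPrel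
  rw [hPdeg, hqq] at this
  refine ⟨this.1, fun hb => ?_⟩
  have := this.2 (Nat.card Aˣ * M) hn hb
  rw [← hq', hm, ← pow_mul, ← mul_assoc] at this
  refine (Nat.mul_le_mul_right _ ?_).trans this
  have hι' : Function.Injective (Units.map (ι : A →* κ ⊗[k] A)) :=
    Units.map_injective (Algebra.TensorProduct.includeRight_injective (algebraMap k κ).injective)
  exact Nat.card_le_card_of_injective
    (fun x : H'.comap (Units.map (ι : A →* κ ⊗[k] A)) =>
      (⟨Units.map (ι : A →* κ ⊗[k] A) x.1, x.2⟩ : H'))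
    fun x y hxy => Subtype.ext (hι' (congrArg Subtype.val hxy))

end BaseChange

section HomogClass

variable {k A : Type*} [Field k] [CommRing A] [Algebra k A]

/-- The value at `(α, β)` of the homogenization of a polynomial, as a multiplicative function. -/
noncomputable def homogEval (α β : A) : k[X] →* A where
  toFun f := MvPolynomial.aeval ![α, β] (f.homogenize f.natDegree)
  map_one' := by simp
  map_mul' f g := by
    rcases eq_or_ne f 0 with rfl | hf
    · simp
    rcases eq_or_ne g 0 with rfl | hg
    · simp
    rw [natDegree_mul hf hg, homogenize_mul _ _ le_rfl le_rfl, map_mul]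

lemma homogEval_apply (α β : A) (f : k[X]) :
    homogEval α β f = ∑ i ∈ Finset.range (f.natDegree + 1),
      algebraMap k A (f.coeff i) * α ^ i * β ^ (f.natDegree - i) := by
  simp only [homogEval, MonoidHom.coe_mk, OneHom.coe_mk, homogenize, map_sum,
    Finset.Nat.sum_antidiagonal_eq_sum_range_succ_mk, MvPolynomial.aeval_monomial]
  refine Finset.sum_congr rfl fun i _ => ?_
  rw [Finsupp.prod_fintype _ _ (by simp), Fin.prod_univ_two, mul_assoc]
  simp

lemma eval₂_homogenize_of_eq_prod {L R : Type*} [CommRing L] [CommRing R] (ψ : L →+* R) (α β : R)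
    (f : L[X]) (d : ℕ) (a : ℕ → L) (hf : f = ∏ j ∈ Finset.range d, (X - C (a j))) :
    MvPolynomial.eval₂ ψ ![α, β] (f.homogenize d) = ∏ j ∈ Finset.range d, (α - β * ψ (a j)) := by
  have h := homogenize_finsetProd (s := Finset.range d) (p := fun j => X - C (a j))
    (n := fun _ => 1) fun i _ => natDegree_X_sub_C_le _
  rw [← hf] at h
  simp only [Finset.sum_const, Finset.card_range, smul_eq_mul, mul_one] at h
  rw [h, ← MvPolynomial.coe_eval₂Hom, map_prod]
  refine Finset.prod_congr rfl fun j _ => ?_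
  simp [homogenize_X, mul_comm β]

variable [Fintype k]

lemma AdjoinRoot.map_eq_prod_X_sub_C (P : k[X]) (hP : P.Monic) [hi : Fact (Irreducible P)] :
    P.map (AdjoinRoot.of P) = ∏ j ∈ Finset.range P.natDegree,
      (X - C (AdjoinRoot.root P ^ Fintype.card k ^ j)) := by
  classical
  set x := AdjoinRoot.root P with hx
  have hmf := hP.finite_adjoinRoot
  have hfin : Finite (AdjoinRoot P) := Module.finite_of_finite k
  have hinj : Set.InjOn (fun j => x ^ Fintype.card k ^ j) (Finset.range P.natDegree) := by
    have key :
        ∀ i j, i < j → j < P.natDegree → x ^ Fintype.card k ^ i ≠ x ^ Fintype.card k ^ j := by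
      intro i j hij hj he
      have h1 : x ^ Fintype.card k ^ (j - i) = x := by
        have hinj := ((FiniteField.frobeniusAlgHom k (AdjoinRoot P)) ^ i).toRingHom.injective
        apply hinj
        simp only [AlgHom.toRingHom_eq_coe, RingHom.coe_coe, AlgHom.coe_pow,
          FiniteField.coe_frobeniusAlgHom, pow_iterate]
        rw [← pow_mul, ← pow_add, Nat.sub_add_cancel hij.le, he]
      have h2 : P ∣ X ^ Nat.card k ^ (j - i) - X := by
        rw [← AdjoinRoot.mk_eq_zero, map_sub, map_pow, AdjoinRoot.mk_X, Nat.card_eq_fintype_card,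
          ← hx, h1, sub_self]
      have h3 := Nat.le_of_dvd (by omega) (hi.out.natDegree_dvd_of_dvd_X_pow_card_pow_sub_X h2)
      omega
    intro i hi' j hj' he
    simp only [Finset.coe_range, Set.mem_Iio] at hi' hj'
    rcases lt_trichotomy i j with h | h | h
    · exact absurd he (key i j h hj')
    · exact h
    · exact absurd he.symm (key j i h hi')
  refine (eq_of_monic_of_dvd_of_natDegree_le (monic_prod_X_sub_C (fun j => x ^ Fintype.card k ^ j) _)
    (hP.map _) ?_ ?_)
  · refine Finset.prod_dvd_of_coprime (fun i hi' j hj' hij => ?_) fun j _ => ?_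
    · exact isCoprime_X_sub_C_of_isUnit_sub (sub_ne_zero.2 fun h => hij (hinj hi' hj' h)).isUnit
    · rw [dvd_iff_isRoot, IsRoot, eval_map]
      have h2 : aeval x P = 0 := AdjoinRoot.eval₂_root P
      have h3 := aeval_algHom_apply ((FiniteField.frobeniusAlgHom k (AdjoinRoot P)) ^ j) x P
      rw [h2, map_zero] at h3
      simp only [AlgHom.coe_pow, FiniteField.coe_frobeniusAlgHom, pow_iterate] at h3
      exact h3
  · rw [natDegree_prod_of_monic _ _ fun j _ => monic_X_sub_C _]
    simp only [natDegree_X_sub_C]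
    simp

lemma map_dvd_prod_expand_sub_homogEval (α β : A) (P : k[X]) (hP : P.Monic) (hi : Irreducible P) :
    P.map (algebraMap k A) ∣ ∏ j ∈ Finset.range P.natDegree,
      Polynomial.expand A (Fintype.card k ^ j) (C α - C β * X) - C (homogEval α β P) := by
  have : Fact (Irreducible P) := ⟨hi⟩
  set Q := P.map (algebraMap k A) with hQ
  let ψ : AdjoinRoot P →+* AdjoinRoot Q := AdjoinRoot.lift ((AdjoinRoot.of Q).comp (algebraMap k A))
    (AdjoinRoot.root Q) (by
      rw [← eval₂_map]
      exact AdjoinRoot.eval₂_root Q)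
  have hψ : ψ.comp (AdjoinRoot.of P) = (AdjoinRoot.of Q).comp (algebraMap k A) := by
    ext a; simp [ψ]
  have hψx : ψ (AdjoinRoot.root P) = AdjoinRoot.root Q := by simp [ψ]
  rw [← AdjoinRoot.mk_eq_zero, map_sub, sub_eq_zero, map_prod, AdjoinRoot.mk_C]
  have h1 := eval₂_homogenize_of_eq_prod ψ (AdjoinRoot.of Q α) (AdjoinRoot.of Q β) _ _ _
    (AdjoinRoot.map_eq_prod_X_sub_C P hP)
  rw [homogenize_map, MvPolynomial.eval₂_map, hψ] at h1
  have h2 : AdjoinRoot.of Q (homogEval α β P) = MvPolynomial.eval₂ ((AdjoinRoot.of Q).comp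
      (algebraMap k A)) ![AdjoinRoot.of Q α, AdjoinRoot.of Q β] (P.homogenize P.natDegree) := by
    simp only [homogEval, MonoidHom.coe_mk, OneHom.coe_mk, MvPolynomial.aeval_def]
    rw [MvPolynomial.eval₂_comp_left]
    congr 1
    funext i
    fin_cases i <;> simp
  rw [h2]
  rw [h1]
  refine Finset.prod_congr rfl fun j _ => ?_
  simp [hψx]

end HomogClass

section Counting

variable (k : Type*) [Field k] [Fintype k]

lemma finite_setOf_degree_lt (n : ℕ) : {f : k[X] | f.degree < n}.Finite := by
  have : Finite (degreeLT k n) := Finite.of_equiv _ (degreeLTEquiv k n).toEquiv.symm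
  refine (Set.toFinite ((degreeLT k n : Submodule k k[X]) : Set k[X])).subset fun f hf => ?_
  exact mem_degreeLT.2 hf

/-- The polynomials of degree less than `n`. -/
noncomputable def polyLT (n : ℕ) : Finset k[X] := (finite_setOf_degree_lt k n).toFinset

variable {k}

lemma mem_polyLT {n : ℕ} {f : k[X]} : f ∈ polyLT k n ↔ f.degree < n := by
  simp [polyLT]

variable (k) in
lemma card_polyLT (n : ℕ) : (polyLT k n).card = Fintype.card k ^ n := by
  have h : (polyLT k n : Set k[X]) = ((degreeLT k n : Submodule k k[X]) : Set k[X]) := by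
    ext f; simp [mem_polyLT, mem_degreeLT]
  rw [← Set.ncard_coe_finset, h]
  change Nat.card (degreeLT k n) = _
  rw [Nat.card_congr (degreeLTEquiv k n).toEquiv, Nat.card_eq_fintype_card]
  simp

variable (k) in
open Classical in
/-- The monic polynomials of degree `n`. -/
noncomputable def monicDeg (n : ℕ) : Finset k[X] :=
  (polyLT k (n + 1)).filter fun f => f.Monic ∧ f.natDegree = n

lemma mem_monicDeg {n : ℕ} {f : k[X]} : f ∈ monicDeg k n ↔ f.Monic ∧ f.natDegree = n := by
  classical
  rw [monicDeg, Finset.mem_filter, mem_polyLT, and_iff_right_iff_imp]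
  rintro ⟨-, h⟩
  refine degree_le_natDegree.trans_lt ?_
  rw [h]; exact_mod_cast Nat.lt_succ_self n

variable (k) in
lemma card_monicDeg (n : ℕ) : (monicDeg k n).card = Fintype.card k ^ n := by
  rw [← card_polyLT k n]
  refine (Finset.card_bij (fun f _ => X ^ n + f) (fun f hf => ?_) (fun f _ g _ h => ?_)
    fun f hf => ?_).symm
  · rw [mem_polyLT] at hf
    have h1 : (X ^ n + f).Monic := monic_X_pow_add hf
    refine mem_monicDeg.2 ⟨h1, ?_⟩
    rw [natDegree_add_eq_left_of_degree_lt (by rwa [degree_X_pow]), natDegree_X_pow]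
  · exact add_left_cancel h
  · obtain ⟨h1, h2⟩ := mem_monicDeg.1 hf
    refine ⟨f - X ^ n, mem_polyLT.2 ?_, by ring⟩
    have h3 : f.degree = n := by rw [degree_eq_natDegree h1.ne_zero, h2]
    rw [← h3]
    exact degree_sub_lt_left (by rw [h3, degree_X_pow]) h1.ne_zero (by
      rw [h1.leadingCoeff, (monic_X_pow n).leadingCoeff])

variable (k) in
open Classical in
/-- The monic irreducible polynomials whose degree divides `n`. -/
noncomputable def irrDvd (n : ℕ) : Finset k[X] :=
  (polyLT k (n + 1)).filter fun f => f.Monic ∧ Irreducible f ∧ f.natDegree ∣ n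

lemma mem_irrDvd {n : ℕ} (hn : 1 ≤ n) {f : k[X]} :
    f ∈ irrDvd k n ↔ f.Monic ∧ Irreducible f ∧ f.natDegree ∣ n := by
  classical
  rw [irrDvd, Finset.mem_filter, mem_polyLT, and_iff_right_iff_imp]
  rintro ⟨-, -, h⟩
  refine degree_le_natDegree.trans_lt ?_
  exact_mod_cast Nat.lt_succ_of_le (Nat.le_of_dvd hn h)

omit [Fintype k] in
lemma natDegree_eq_sum_count [DecidableEq k] {f : k[X]} (hf : f.Monic) :
    f.natDegree = ∑ P ∈ (UniqueFactorizationMonoid.normalizedFactors f).toFinset,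
      (UniqueFactorizationMonoid.normalizedFactors f).count P * P.natDegree := by
  have h1 := UniqueFactorizationMonoid.prod_normalizedFactors_eq hf.ne_zero
  rw [hf.normalize_eq_self] at h1
  conv_lhs => rw [← h1]
  rw [natDegree_multiset_prod, Finset.sum_multiset_map_count]
  · simp
  · exact fun h => UniqueFactorizationMonoid.zero_notMem_normalizedFactors _ h

lemma natDegree_eq_sum_sum {f : k[X]} (hf : f.Monic) [DecidablePred (· ∣ f)] :
    f.natDegree = ∑ j ∈ Finset.Icc 1 f.natDegree, ∑ P ∈ irrDvd k j,
      if P ^ (j / P.natDegree) ∣ f then P.natDegree else 0 := by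
  classical
  have hcount : ∀ P : k[X], Irreducible P → P.Monic → ∀ i,
      (P ^ i ∣ f ↔ i ≤ (UniqueFactorizationMonoid.normalizedFactors f).count P) := by
    intro P h1 h2 i
    rw [pow_dvd_iff_le_emultiplicity, UniqueFactorizationMonoid.emultiplicity_eq_count_normalizedFactors
      h1 hf.ne_zero, h2.normalize_eq_self]
    exact_mod_cast Iff.rfl
  have hmem : ∀ P, P ∈ UniqueFactorizationMonoid.normalizedFactors f → Irreducible P ∧ P.Monic := by
    intro P hP
    refine ⟨UniqueFactorizationMonoid.irreducible_of_normalized_factor P hP, ?_⟩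
    have h1 := UniqueFactorizationMonoid.normalize_normalized_factor P hP
    rw [← h1]
    exact monic_normalize (UniqueFactorizationMonoid.irreducible_of_normalized_factor P hP).ne_zero
  conv_lhs => rw [natDegree_eq_sum_count hf]
  have h1 : ∀ P ∈ (UniqueFactorizationMonoid.normalizedFactors f).toFinset,
      (UniqueFactorizationMonoid.normalizedFactors f).count P * P.natDegree =
      ∑ i ∈ Finset.Icc 1 ((UniqueFactorizationMonoid.normalizedFactors f).count P),
        P.natDegree := by
    intro P _
    simp
  rw [Finset.sum_congr rfl h1, Finset.sum_sigma']
  simp only [← Finset.sum_filter]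
  rw [Finset.sum_sigma' (Finset.Icc 1 f.natDegree)]
  have hd : ∀ P : k[X], Irreducible P → 1 ≤ P.natDegree := fun P hP => hP.natDegree_pos
  refine Finset.sum_bij' (fun x _ => ⟨x.1.natDegree * x.2, x.1⟩)
    (fun y _ => ⟨y.2, y.1 / y.2.natDegree⟩) ?_ ?_ ?_ ?_ ?_
  · rintro ⟨P, i⟩ hx
    simp only [Finset.mem_sigma, Multiset.mem_toFinset, Finset.mem_Icc, Finset.mem_filter] at hx ⊢
    obtain ⟨h2, h3, h4⟩ := hx
    obtain ⟨hi, hm⟩ := hmem P h2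
    have hdvd : P ^ i ∣ f := (hcount P hi hm i).2 h4
    have h5 := hd P hi
    have h6 : 1 ≤ P.natDegree * i := Nat.mul_pos h5 h3
    refine ⟨⟨h6, ?_⟩, (mem_irrDvd h6).2 ⟨hm, hi, dvd_mul_right _ _⟩, ?_⟩
    · have := natDegree_le_of_dvd hdvd hf.ne_zero
      rwa [natDegree_pow, mul_comm] at this
    · rwa [Nat.mul_div_cancel_left _ h5]
  · rintro ⟨j, P⟩ hy
    simp only [Finset.mem_sigma, Multiset.mem_toFinset, Finset.mem_Icc, Finset.mem_filter] at hy ⊢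
    obtain ⟨⟨h2, h3⟩, h4, h5⟩ := hy
    obtain ⟨hm, hi, hdv⟩ := (mem_irrDvd h2).1 h4
    have h6 := (hcount P hi hm _).1 h5
    have h7 : 1 ≤ j / P.natDegree := Nat.div_pos (Nat.le_of_dvd h2 hdv) (hd P hi)
    exact ⟨Multiset.count_pos.1 (by omega), h7, h6⟩
  · rintro ⟨P, i⟩ hx
    simp only [Finset.mem_sigma, Multiset.mem_toFinset] at hx
    simp [Nat.mul_div_cancel_left _ (hd P (hmem P hx.1).1)]
  · rintro ⟨j, P⟩ hy
    simp only [Finset.mem_sigma, Finset.mem_Icc, Finset.mem_filter] at hy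
    simp [Nat.mul_div_cancel' ((mem_irrDvd hy.1.1).1 hy.2.1).2.2]
  · rintro ⟨P, i⟩ hx
    rfl

theorem natCast_mul_sum_monicDeg (χ : k[X] →* ℂ) (n : ℕ) :
    (n : ℂ) * ∑ f ∈ monicDeg k n, χ f = ∑ j ∈ Finset.Icc 1 n,
      (∑ P ∈ irrDvd k j, (P.natDegree : ℂ) * χ P ^ (j / P.natDegree)) *
        ∑ g ∈ monicDeg k (n - j), χ g := by
  classical
  have h1 : ∀ f ∈ monicDeg k n, (n : ℂ) * χ f = ∑ j ∈ Finset.Icc 1 n, ∑ P ∈ irrDvd k j,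
      if P ^ (j / P.natDegree) ∣ f then (P.natDegree : ℂ) * χ f else 0 := by
    intro f hf
    obtain ⟨hf1, hf2⟩ := mem_monicDeg.1 hf
    have := natDegree_eq_sum_sum hf1
    rw [hf2] at this
    conv_lhs => rw [this]
    push_cast
    simp only [Finset.sum_mul, ite_mul, zero_mul]
  rw [Finset.mul_sum, Finset.sum_congr rfl h1, Finset.sum_comm]
  refine Finset.sum_congr rfl fun j hj => ?_
  rw [Finset.mem_Icc] at hj
  rw [Finset.sum_comm, Finset.sum_mul]
  refine Finset.sum_congr rfl fun P hP => ?_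
  obtain ⟨hm, hi, hdv⟩ := (mem_irrDvd hj.1).1 hP
  set i := j / P.natDegree with hi'
  have hPi : (P ^ i).Monic := hm.pow i
  have hPd : (P ^ i).natDegree = j := by rw [natDegree_pow, hi', Nat.div_mul_cancel hdv]
  rw [← Finset.sum_filter, ← Finset.mul_sum, mul_assoc]
  congr 1
  rw [Finset.mul_sum]
  symm
  refine Finset.sum_bij (fun g _ => P ^ i * g) (fun g hg => ?_) (fun g _ g' _ h => ?_)
    (fun f hf => ?_) fun g _ => ?_
  · obtain ⟨h2, h3⟩ := mem_monicDeg.1 hg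
    refine Finset.mem_filter.2 ⟨mem_monicDeg.2 ⟨hPi.mul h2, ?_⟩, dvd_mul_right _ _⟩
    rw [hPi.natDegree_mul h2, hPd, h3]
    omega
  · exact mul_left_cancel₀ hPi.ne_zero h
  · obtain ⟨hf1, g, rfl⟩ := Finset.mem_filter.1 hf
    obtain ⟨h2, h3⟩ := mem_monicDeg.1 hf1
    have h4 := hPi.of_mul_monic_left h2
    rw [hPi.natDegree_mul h4, hPd] at h3
    exact ⟨g, mem_monicDeg.2 ⟨h4, by omega⟩, rfl⟩
  · rw [map_mul, map_pow]

end Counting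

section LogDeriv

lemma Multiset.natCast_mul_esymm_eq_sum (s : Multiset ℂ) (n : ℕ) :
    (n : ℂ) * s.esymm n = (-1) ^ (n + 1) *
      ∑ a ∈ Finset.HasAntidiagonal.antidiagonal n with a.1 < n,
        (-1) ^ a.1 * s.esymm a.1 * (s.map (· ^ a.2)).sum := by
  obtain ⟨d, f, rfl⟩ : ∃ (d : ℕ) (f : Fin d → ℂ), Finset.univ.val.map f = s := by
    refine ⟨s.toList.length, s.toList.get, ?_⟩
    rw [Fin.univ_val_map, List.ofFn_get, Multiset.coe_toList]
  have h := congrArg (MvPolynomial.aeval f) (MvPolynomial.mul_esymm_eq_sum (Fin d) ℂ n)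
  simp only [map_mul, map_sum, map_pow, map_neg, map_one, map_natCast,
    MvPolynomial.aeval_esymm_eq_multiset_esymm] at h
  rw [h]
  congr 1
  refine Finset.sum_congr rfl fun a _ => ?_
  congr 1
  rw [MvPolynomial.psum, map_sum, Multiset.map_map]
  simp only [map_pow, MvPolynomial.aeval_X]
  rfl

lemma exists_multiset_esymm (D : ℕ) (a : ℕ → ℂ) (ha0 : a 0 = 1) (haD : ∀ n, D < n → a n = 0) :
    ∃ s : Multiset ℂ, Multiset.card s = D ∧ ∀ n, a n = (-1) ^ n * s.esymm n := by
  set F : ℂ[X] := ∑ i ∈ Finset.range (D + 1), C (a (D - i)) * X ^ i with hF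
  have hcoeff : ∀ i, i ≤ D → F.coeff i = a (D - i) := by
    intro i hi
    rw [hF, finsetSum_coeff]
    simp only [coeff_C_mul_X_pow]
    rw [Finset.sum_ite_eq, if_pos (Finset.mem_range.2 (by omega))]
  have hle : F.natDegree ≤ D := by
    refine natDegree_sum_le_of_forall_le _ _ fun i hi => ?_
    exact (natDegree_C_mul_X_pow_le _ _).trans (Nat.lt_succ_iff.1 (Finset.mem_range.1 hi))
  have hD : F.coeff D = 1 := by rw [hcoeff D le_rfl, Nat.sub_self, ha0]
  have hdeg : F.natDegree = D := le_antisymm hle (le_natDegree_of_ne_zero (by rw [hD]; simp))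
  have hlead : F.leadingCoeff = 1 := by rw [leadingCoeff, hdeg, hD]
  have hcard : Multiset.card F.roots = F.natDegree :=
    (IsAlgClosed.splits F).natDegree_eq_card_roots.symm
  refine ⟨F.roots, hcard.trans hdeg, fun n => ?_⟩
  rcases le_or_gt n D with hn | hn
  · have := coeff_eq_esymm_roots_of_card hcard (k := D - n) (by omega)
    rw [hcoeff _ (by omega), hlead, hdeg, one_mul] at this
    rwa [show D - (D - n) = n by omega] at this
  · rw [haD n hn, Multiset.esymm, Multiset.powersetCard_eq_empty _ (by omega)]
    simp

/-- If a sequence satisfies `a₀ = 1`, vanishes from `D` on, and is related to `c` by logarithmic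
differentiation of the generating series, then `-c` is a sequence of power sums. -/
lemma exists_powerSums (D : ℕ) (a c : ℕ → ℂ) (ha0 : a 0 = 1) (haD : ∀ n, D < n → a n = 0)
    (hrec : ∀ n : ℕ, (n : ℂ) * a n = ∑ j ∈ Finset.Icc 1 n, c j * a (n - j)) :
    ∃ s : Multiset ℂ, Multiset.card s = D ∧ ∀ n, 1 ≤ n → c n = -(s.map (· ^ n)).sum := by
  obtain ⟨s, hs, ha⟩ := exists_multiset_esymm D a ha0 haD
  refine ⟨s, hs, ?_⟩
  have hrec' : ∀ n : ℕ, (n : ℂ) * a n =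
      ∑ j ∈ Finset.Icc 1 n, (-(s.map (· ^ j)).sum) * a (n - j) := by
    intro n
    have h1 := Multiset.natCast_mul_esymm_eq_sum s n
    calc (n : ℂ) * a n = (-1) ^ n * ((n : ℂ) * s.esymm n) := by rw [ha]; ring
      _ = -∑ x ∈ Finset.HasAntidiagonal.antidiagonal n with x.1 < n,
          (-1) ^ x.1 * s.esymm x.1 * (s.map (· ^ x.2)).sum := by
        rw [h1, ← mul_assoc, ← pow_add, show n + (n + 1) = 2 * n + 1 by ring, pow_succ, pow_mul]
        simp
      _ = _ := by
        rw [← Finset.sum_neg_distrib]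
        refine Finset.sum_bij' (fun x _ => x.2) (fun j _ => (n - j, j)) ?_ ?_ ?_ ?_ ?_
        · rintro ⟨i, j⟩ hx
          simp only [Finset.mem_filter, Finset.HasAntidiagonal.mem_antidiagonal] at hx
          exact Finset.mem_Icc.2 (by dsimp only; omega)
        · intro j hj
          rw [Finset.mem_Icc] at hj
          simp only [Finset.mem_filter, Finset.HasAntidiagonal.mem_antidiagonal]
          omega
        · rintro ⟨i, j⟩ hx
          simp only [Finset.mem_filter, Finset.HasAntidiagonal.mem_antidiagonal] at hx
          exact Prod.ext (by dsimp only; omega) rfl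
        · intro j hj
          rfl
        · rintro ⟨i, j⟩ hx
          simp only [Finset.mem_filter, Finset.HasAntidiagonal.mem_antidiagonal] at hx
          dsimp only
          rw [show n - j = i by omega, ha]
          ring
  intro n
  induction n using Nat.strong_induction_on with
  | _ n ih =>
    intro hn
    obtain ⟨m, rfl⟩ : ∃ m, n = m + 1 := ⟨n - 1, by omega⟩
    have h := (hrec (m + 1)).symm.trans (hrec' (m + 1))
    rw [Finset.sum_Icc_succ_top (by omega), Finset.sum_Icc_succ_top (by omega), Nat.sub_self, ha0,
      mul_one, mul_one] at h
    rw [Finset.sum_congr rfl (fun j hj => by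
      rw [ih j (by rw [Finset.mem_Icc] at hj; omega) (Finset.mem_Icc.1 hj).1])] at h
    exact add_left_cancel h

/-- Simultaneous recurrence: the powers of finitely many unit complex numbers simultaneously return
close to `1`. -/
lemma exists_pow_re_ge {ι : Type*} [Fintype ι] (u : ι → ℂ) (hu : ∀ i, ‖u i‖ = 1) (K : ℕ) :
    ∃ n, K ≤ n ∧ ∀ i, (1 / 2 : ℝ) ≤ ((u i) ^ n).re := by
  have hb : ∀ n : ℕ, (fun i => u i ^ n) ∈ Metric.closedBall (0 : ι → ℂ) 1 := by
    intro n
    rw [mem_closedBall_zero_iff, pi_norm_le_iff_of_nonneg zero_le_one]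
    intro i
    rw [norm_pow, hu, one_pow]
  obtain ⟨x, -, φ, hφ, hx⟩ := (isCompact_closedBall (0 : ι → ℂ) 1).tendsto_subseq hb
  have hc := hx.cauchySeq
  rw [Metric.cauchySeq_iff] at hc
  obtain ⟨N, hN⟩ := hc (1 / 2) (by norm_num)
  refine ⟨φ (N + φ N + K) - φ N, ?_, fun i => ?_⟩
  · have := hφ.id_le (N + φ N + K)
    simp only [id] at this
    omega
  · have hlt : φ N ≤ φ (N + φ N + K) := hφ.monotone (by omega)
    have h1 := hN (N + φ N + K) (by omega) N le_rfl
    have h2 : ‖u i ^ φ (N + φ N + K) - u i ^ φ N‖ < 1 / 2 := by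
      rw [← dist_eq_norm]
      exact (dist_le_pi_dist _ _ i).trans_lt h1
    have h3 : u i ^ φ (N + φ N + K) - u i ^ φ N =
        u i ^ φ N * (u i ^ (φ (N + φ N + K) - φ N) - 1) := by
      rw [mul_sub, ← pow_add, Nat.add_sub_cancel' hlt, mul_one]
    rw [h3, norm_mul, norm_pow, hu, one_pow, one_mul] at h2
    have h4 := (Complex.abs_re_le_norm _).trans_lt h2
    rw [Complex.sub_re, Complex.one_re, abs_lt] at h4
    linarith [h4.1]

/-- If the power sums with nonnegative weights of finitely many complex numbers are `O(r ^ n)`,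
then all the numbers with positive weight have norm at most `r`. -/
lemma norm_le_of_powerSum_le {ι : Type*} [Fintype ι] (w : ι → ℝ) (hw : ∀ i, 0 ≤ w i) (β : ι → ℂ)
    (r K : ℝ) (hr : 0 < r) (h : ∀ n : ℕ, 1 ≤ n → ‖∑ i, (w i : ℂ) * β i ^ n‖ ≤ K * r ^ n) (i : ι)
    (hi : 0 < w i) : ‖β i‖ ≤ r := by
  by_contra! hlt
  have hβi : 0 < ‖β i‖ := hr.trans hlt
  set u : ι → ℂ := fun j => if β j = 0 then 1 else β j / ‖β j‖ with hu
  have hu1 : ∀ j, ‖u j‖ = 1 := by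
    intro j
    by_cases hj : β j = 0
    · simp [hu, hj]
    · simp [hu, hj]
  have hu2 : ∀ j, β j = ‖β j‖ * u j := by
    intro j
    by_cases hj : β j = 0
    · simp [hj]
    · simp only [hu, hj, if_false]
      rw [mul_div_cancel₀]
      simpa using hj
  have hrat : 1 < ‖β i‖ / r := (one_lt_div hr).2 hlt
  obtain ⟨N, hN⟩ := pow_unbounded_of_one_lt (2 * K / w i) hrat
  obtain ⟨n, hn, hre⟩ := exists_pow_re_ge u hu1 (N + 1)
  have h1 : w i * (1 / 2) * ‖β i‖ ^ n ≤ ‖∑ j, (w j : ℂ) * β j ^ n‖ := by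
    refine le_trans ?_ (Complex.re_le_norm _)
    rw [Complex.re_sum]
    have h2 : ∀ j, ((w j : ℂ) * β j ^ n).re = w j * (‖β j‖ ^ n * (u j ^ n).re) := by
      intro j
      conv_lhs => rw [hu2 j, mul_pow, ← Complex.ofReal_pow]
      rw [Complex.re_ofReal_mul, Complex.re_ofReal_mul]
    simp only [h2]
    refine le_trans ?_ (Finset.single_le_sum (f := fun j => w j * (‖β j‖ ^ n * (u j ^ n).re))
      (fun j _ => ?_) (Finset.mem_univ i))
    · rw [mul_assoc, mul_comm (1 / 2 : ℝ)]
      have := hre i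
      gcongr
    · have := hre j
      have := hw j
      positivity
  have h2 := h1.trans (h n (by omega))
  have h3 : (‖β i‖ / r) ^ N ≤ (‖β i‖ / r) ^ n := pow_le_pow_right₀ hrat.le (by omega)
  have h4 := hN.trans_le h3
  rw [div_lt_iff₀ hi, div_pow, div_mul_eq_mul_div, lt_div_iff₀ (by positivity)] at h4
  linarith

end LogDeriv

section ClassSums

variable {k A : Type*} [Field k] [Fintype k] [CommRing A] [Finite A]

lemma sum_irrDvd_natDegree (n : ℕ) (hn : 1 ≤ n) :
    ∑ P ∈ irrDvd k n, P.natDegree = Fintype.card k ^ n := by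
  induction n using Nat.strong_induction_on with
  | _ n ih =>
    obtain ⟨m, rfl⟩ : ∃ m, n = m + 1 := ⟨n - 1, by omega⟩
    have h := natCast_mul_sum_monicDeg (k := k) 1 (m + 1)
    simp only [MonoidHom.one_apply, one_pow, mul_one, Finset.sum_const, nsmul_eq_mul,
      card_monicDeg] at h
    rw [Finset.sum_Icc_succ_top (by omega), Finset.sum_congr rfl (g := fun j =>
      ((Fintype.card k ^ (m + 1) : ℕ) : ℂ)) (fun j hj => by
        rw [Finset.mem_Icc] at hj
        have := ih j (by omega) hj.1
        rw [← Nat.cast_sum, this, ← Nat.cast_mul, ← pow_add]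
        congr 2; omega)] at h
    simp only [Finset.sum_const, Nat.card_Icc, Nat.sub_self, pow_zero, nsmul_eq_mul,
      Nat.cast_one, mul_one, Nat.add_sub_cancel] at h
    have h2 : ((Fintype.card k ^ (m + 1) : ℕ) : ℂ) = ∑ P ∈ irrDvd k (m + 1), (P.natDegree : ℂ) := by
      push_cast at h ⊢
      linear_combination h
    exact_mod_cast h2.symm

open Classical in
/-- The total degree of the monic irreducibles `P` with degree dividing `n` whose
`n / deg P`-th power has class `b`. -/
noncomputable def classSum (cls : k[X] →* A) (n : ℕ) (b : Aˣ) : ℕ :=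
  ∑ P ∈ irrDvd k n with cls P ^ (n / P.natDegree) = b, P.natDegree

omit [Finite A] in
open Classical in
lemma sum_irrDvd_eq_sum_classSum (cls : k[X] →* A) (n : ℕ) [Fintype Aˣ] (φ : A → ℂ) :
    ∑ P ∈ irrDvd k n with IsUnit (cls P ^ (n / P.natDegree)),
      (P.natDegree : ℂ) * φ (cls P ^ (n / P.natDegree)) = ∑ b : Aˣ, φ b * classSum cls n b := by
  simp only [classSum, Nat.cast_sum, Finset.mul_sum, Finset.sum_filter, Nat.cast_ite,
    Nat.cast_zero, mul_ite, mul_zero]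
  rw [Finset.sum_comm]
  refine Finset.sum_congr rfl fun P _ => ?_
  split_ifs with h
  · obtain ⟨u, hu⟩ := h
    rw [← hu]
    simp only [Units.val_inj]
    rw [Finset.sum_ite_eq, if_pos (Finset.mem_univ _), mul_comm]
  · refine (Finset.sum_eq_zero fun b _ => if_neg fun hb => h ?_).symm
    rw [hb]; exact b.isUnit

omit [Finite A] in
lemma charSum_eq_sum_classSum (cls : k[X] →* A) (n : ℕ) [Fintype Aˣ]
    (χ : MulChar A ℂ) :
    ∑ P ∈ irrDvd k n, (P.natDegree : ℂ) * χ (cls P) ^ (n / P.natDegree) =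
      ∑ b : Aˣ, χ b * classSum cls n b := by
  classical
  rw [← sum_irrDvd_eq_sum_classSum cls n, Finset.sum_filter]
  refine Finset.sum_congr rfl fun P hP => ?_
  split_ifs with h
  · rw [map_pow]
  · rw [← map_pow, MulChar.map_nonunit χ h, mul_zero]

omit [Finite A] in
lemma card_pow_le_sum_classSum (cls : k[X] →* A) (n : ℕ) (hn : 1 ≤ n) [Fintype Aˣ] (D : ℕ)
    (hbad : ∀ S : Finset k[X], (∀ P ∈ S, P.Monic ∧ Irreducible P ∧ ¬ IsUnit (cls P)) →
      ∑ P ∈ S, P.natDegree ≤ D) :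
    Fintype.card k ^ n ≤ ∑ b : Aˣ, classSum cls n b + D := by
  classical
  have h1 := sum_irrDvd_eq_sum_classSum cls n (fun _ => 1)
  simp only [mul_one, one_mul] at h1
  rw [← Nat.cast_sum, ← Nat.cast_sum, Nat.cast_inj] at h1
  rw [← h1, ← sum_irrDvd_natDegree n hn, ← Finset.sum_filter_add_sum_filter_not (irrDvd k n)
    (fun P => IsUnit (cls P ^ (n / P.natDegree)))]
  refine Nat.add_le_add_left (hbad _ fun P hP => ?_) _
  obtain ⟨hP1, hP2⟩ := Finset.mem_filter.1 hP
  obtain ⟨h2, h3, -⟩ := (mem_irrDvd hn).1 hP1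
  exact ⟨h2, h3, fun h => hP2 (h.pow _)⟩

lemma sum_subgroup_char_eq {G : Type*} [Group G] [Fintype G] (f : G →* ℂ) (K : Subgroup G)
    [DecidablePred (· ∈ K)] :
    (∀ b ∈ K, f b = 1) ∧ ∑ b with b ∈ K, f b = Nat.card K ∨
    (∃ b ∈ K, f b ≠ 1) ∧ ∑ b with b ∈ K, f b = 0 := by
  classical
  have h1 : ∑ b with b ∈ K, f b = ∑ b : K, (f.comp K.subtype) b := by
    rw [Finset.sum_subtype (Finset.univ.filter (· ∈ K)) (p := (· ∈ K)) (by simp)]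
    rfl
  rw [h1, sum_hom_units]
  by_cases h : f.comp K.subtype = 1
  · left
    rw [if_pos h, Nat.card_eq_fintype_card]
    exact ⟨fun b hb => DFunLike.congr_fun h ⟨b, hb⟩, rfl⟩
  · right
    rw [if_neg h]
    refine ⟨?_, by simp⟩
    by_contra! hc
    exact h (by ext b; exact hc b b.2)

lemma sum_monicDeg_eq_zero (cls : k[X] →* A) (Γ : Subgroup Aˣ)
    (hΓ : ∀ f : k[X], f.Monic → ∀ b : Aˣ, cls f = b → b ∈ Γ) (n K : ℕ)
    (hK : ∀ b ∈ Γ, {f : k[X] | f ∈ monicDeg k n ∧ cls f = b}.ncard = K) (χ : MulChar A ℂ)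
    (hχ : ∃ b ∈ Γ, χ b ≠ 1) : ∑ f ∈ monicDeg k n, χ (cls f) = 0 := by
  classical
  have := Fintype.ofFinite A
  have h1 : ∀ f ∈ monicDeg k n, χ (cls f) = ∑ b : Aˣ with b ∈ Γ, if cls f = b then χ b else 0 := by
    intro f hf
    by_cases h : IsUnit (cls f)
    · obtain ⟨u, hu⟩ := h
      rw [← hu]
      simp only [Units.val_inj]
      rw [Finset.sum_ite_eq, if_pos]
      simpa using hΓ f (mem_monicDeg.1 hf).1 u hu.symm
    · rw [MulChar.map_nonunit χ h]
      refine (Finset.sum_eq_zero fun b _ => if_neg fun hb => h ?_).symm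
      rw [hb]; exact b.isUnit
  rw [Finset.sum_congr rfl h1, Finset.sum_comm]
  have h2 : ∀ b ∈ Finset.univ.filter (fun b : Aˣ => b ∈ Γ),
      (∑ f ∈ monicDeg k n, if cls f = b then χ b else 0) = (K : ℂ) * χ b := by
    intro b hb
    rw [← hK b (by simpa using hb), ← Finset.sum_filter, Finset.sum_const, nsmul_eq_mul]
    congr 2
    rw [← Set.ncard_coe_finset]
    congr 1
    ext; simp
  rw [Finset.sum_congr rfl h2, ← Finset.mul_sum]
  rcases sum_subgroup_char_eq ((χ : A →* ℂ).comp (Units.coeHom A)) Γ with ⟨h, -⟩ | ⟨-, h⟩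
  · obtain ⟨b, hb, hb'⟩ := hχ
    exact absurd (h b hb) hb'
  · have h3 : ∑ b : Aˣ with b ∈ Γ, χ b = 0 := h
    rw [h3, mul_zero]

end ClassSums

section CharBound

variable {k A : Type*} [Field k] [Fintype k] [CommRing A] [Finite A]

/-- Square-root equidistribution of the class sums along one arithmetic progression. -/
lemma exists_norm_charSum_sub_le (cls : k[X] →* A) (Γ : Subgroup Aˣ)
    (hΓ : ∀ f : k[X], f.Monic → ∀ b : Aˣ, cls f = b → b ∈ Γ) (D : ℕ)
    (hbad : ∀ S : Finset k[X], (∀ P ∈ S, P.Monic ∧ Irreducible P ∧ ¬ IsUnit (cls P)) →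
      ∑ P ∈ S, P.natDegree ≤ D) (N₁ C : ℕ) (hN₁ : 1 ≤ N₁) (H : Subgroup Aˣ)
    (hprime : ∀ M, 1 ≤ M → ∀ b : Aˣ,
      (b ∉ H → classSum cls (2 * N₁ * M) b ≤ C) ∧
      (b ∈ H → Nat.card H * classSum cls (2 * N₁ * M) b ≤
        Fintype.card k ^ (2 * N₁ * M) + C * Fintype.card k ^ (N₁ * M)))
    (χ : MulChar A ℂ) :
    ∃ τ K : ℝ, 0 ≤ τ ∧ ∀ M, 1 ≤ M →
      ‖∑ P ∈ irrDvd k (2 * N₁ * M), (P.natDegree : ℂ) * χ (cls P) ^ (2 * N₁ * M / P.natDegree) -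
        τ * ((Fintype.card k : ℂ) ^ (2 * N₁)) ^ M‖ ≤ K * ((Fintype.card k : ℝ) ^ N₁) ^ M := by
  classical
  have := Fintype.ofFinite A
  set h : ℝ := ((Nat.card H : ℕ) : ℝ) with hh
  have hh1 : 1 ≤ h := by
    have : 0 < Nat.card H := Nat.card_pos
    rw [hh]
    exact_mod_cast this
  set U := Finset.univ.filter (fun b : Aˣ => b ∈ H ⊓ Γ) with hU
  have hUcard : (U.card : ℝ) ≤ h := by
    rw [hh, Nat.card_eq_fintype_card, Fintype.card_subtype]
    exact_mod_cast Finset.card_le_card fun b hb => by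
      simp only [hU, Finset.mem_filter, Subgroup.mem_inf] at hb ⊢
      exact ⟨hb.1, hb.2.1⟩
  obtain ⟨τ, hτ0, hτ⟩ : ∃ τ : ℝ, 0 ≤ τ ∧ ∑ b ∈ U, χ b = τ * h := by
    have h2 : ∀ z : ℂ, (∑ b ∈ U, χ b = z) → (∑ b with b ∈ H ⊓ Γ,
      ((χ : A →* ℂ).comp (Units.coeHom A)) b = z) := fun z hz => hz
    rcases sum_subgroup_char_eq ((χ : A →* ℂ).comp (Units.coeHom A)) (H ⊓ Γ) with ⟨-, h1⟩ | ⟨-, h1⟩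
    · refine ⟨Nat.card (H ⊓ Γ : Subgroup Aˣ) / h, by positivity, ?_⟩
      refine Eq.trans h1 ?_
      push_cast
      rw [div_mul_cancel₀]
      exact_mod_cast (by positivity : h ≠ 0)
    · exact ⟨0, le_rfl, by rw [Complex.ofReal_zero, zero_mul]; exact h1⟩
  set cA : ℝ := ((Fintype.card Aˣ : ℕ) : ℝ) with hcA
  set K₀ : ℝ := C + D + cA * C with hK₀
  refine ⟨τ, cA * C + K₀ + C, hτ0, fun M hM => ?_⟩
  set N := 2 * N₁ * M with hN
  have hN1 : 1 ≤ N := Nat.mul_pos (by omega) hM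
  set E : ℝ := ((Fintype.card k : ℝ) ^ N₁) ^ M with hE
  have hq1 : (1 : ℝ) ≤ Fintype.card k := by exact_mod_cast Fintype.card_pos
  have hE1 : 1 ≤ E := one_le_pow₀ (one_le_pow₀ hq1)
  set m : Aˣ → ℝ := fun b => classSum cls N b with hm
  set Q : ℝ := (Fintype.card k : ℝ) ^ N with hQ
  have hm0 : ∀ b, 0 ≤ m b := fun b => Nat.cast_nonneg _
  have hmH : ∀ b ∈ U, h * m b ≤ Q + C * E := by
    intro b hb
    have := (hprime M hM b).2 ((Finset.mem_filter.1 hb).2.1)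
    rw [hE, ← pow_mul, hh, hQ]
    simp only [hm]
    exact_mod_cast this
  have hmHn : ∀ b, b ∉ U → m b ≤ C := by
    intro b hb
    by_cases hbH : b ∈ H
    · have hbΓ : b ∉ Γ := fun hc => hb (by simp [hU, hbH, hc, Subgroup.mem_inf])
      have : classSum cls N b = 0 := by
        refine Finset.sum_eq_zero fun P hP => ?_
        obtain ⟨hP1, hP2⟩ := Finset.mem_filter.1 hP
        exact absurd (hΓ (P ^ (N / P.natDegree)) (((mem_irrDvd hN1).1 hP1).1.pow _) b
          (by rw [map_pow, hP2])) hbΓ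
      simp [hm, this]
    · have := (hprime M hM b).1 hbH
      simp only [hm]
      exact_mod_cast this
  have htotal : Q ≤ ∑ b, m b + D := by
    have := card_pow_le_sum_classSum cls N hN1 D hbad
    simp only [hm, hQ]
    exact_mod_cast this
  have hsplit : ∑ b, m b = ∑ b ∈ U, m b + ∑ b with b ∉ U, m b := by
    rw [← Finset.sum_filter_add_sum_filter_not Finset.univ (fun b => b ∈ U)]
    simp
  have hrest : ∑ b with b ∉ U, m b ≤ cA * C := by
    refine (Finset.sum_le_card_nsmul _ _ (C : ℝ) fun b hb => hmHn b (Finset.mem_filter.1 hb).2).trans ?_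
    rw [nsmul_eq_mul]
    refine mul_le_mul_of_nonneg_right ?_ (Nat.cast_nonneg _)
    rw [hcA, ← Finset.card_univ]
    exact_mod_cast Finset.card_filter_le _ _
  have hQ0 : 0 ≤ Q := by positivity
  have hC0 : (0 : ℝ) ≤ C := Nat.cast_nonneg _
  have hD0 : (0 : ℝ) ≤ D := Nat.cast_nonneg _
  have hcA0 : (0 : ℝ) ≤ cA := Nat.cast_nonneg _
  have hsumU : ∑ b ∈ U, |h * m b - Q| ≤ h * (K₀ + C) * E := by
    have h1 : ∀ b ∈ U, |h * m b - Q| ≤ (Q + C * E - h * m b) + C * E := by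
      intro b hb
      have := hmH b hb
      have : 0 ≤ C * E := by positivity
      rw [abs_le]
      constructor <;> linarith
    refine (Finset.sum_le_sum h1).trans ?_
    rw [Finset.sum_add_distrib, Finset.sum_sub_distrib, Finset.sum_const, Finset.sum_const,
      nsmul_eq_mul, nsmul_eq_mul, ← Finset.mul_sum]
    have h2 : (U.card : ℝ) * (Q + C * E) ≤ h * (Q + C * E) :=
      mul_le_mul_of_nonneg_right hUcard (by positivity)
    have h3 : (U.card : ℝ) * (C * E) ≤ h * (C * E) :=
      mul_le_mul_of_nonneg_right hUcard (by positivity)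
    have h4 : h * (Q - D - cA * C) ≤ h * ∑ b ∈ U, m b :=
      mul_le_mul_of_nonneg_left (by linarith) (by linarith)
    have h5 : h * (D + cA * C) ≤ h * (D + cA * C) * E :=
      le_mul_of_one_le_right (by positivity) hE1
    rw [hK₀]
    nlinarith
  rw [charSum_eq_sum_classSum]
  have hdecomp : ∑ b : Aˣ, χ b * (classSum cls N b : ℂ) - τ * ((Fintype.card k : ℂ) ^ (2 * N₁)) ^ M =
      ∑ b with b ∉ U, χ b * (m b : ℂ) + (∑ b ∈ U, χ b * ((h * m b - Q : ℝ) : ℂ)) / h := by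
    have hh0 : (h : ℂ) ≠ 0 := by exact_mod_cast (by positivity : h ≠ 0)
    have h1 : ((Fintype.card k : ℂ) ^ (2 * N₁)) ^ M = (Q : ℂ) := by
      rw [← pow_mul, hQ]; push_cast; rfl
    have h2 : (τ : ℂ) * Q = (∑ b ∈ U, χ b * Q) / h := by
      rw [← Finset.sum_mul, hτ]; field_simp
    rw [h1, h2, ← Finset.sum_filter_add_sum_filter_not Finset.univ (fun b => b ∈ U)]
    simp only [Finset.filter_univ_mem, hm, Complex.ofReal_natCast, Complex.ofReal_sub,
      Complex.ofReal_mul, mul_sub, Finset.sum_sub_distrib, sub_div]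
    have h3 : (∑ b ∈ U, χ b * ((h : ℂ) * (classSum cls N b : ℂ))) / h =
        ∑ b ∈ U, χ b * (classSum cls N b : ℂ) := by
      rw [Finset.sum_div]
      refine Finset.sum_congr rfl fun b _ => ?_
      field_simp
    rw [h3]
    ring
  have hχ1 : ∀ b : Aˣ, ‖χ b‖ = 1 := fun b => by
    have h1 : (χ b) ^ Fintype.card Aˣ = 1 := by
      rw [← map_pow, ← Units.val_pow_eq_pow_val, pow_card_eq_one, Units.val_one, map_one]
    exact Complex.norm_eq_one_of_pow_eq_one h1 Fintype.card_ne_zero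
  rw [hdecomp]
  refine (norm_add_le _ _).trans ?_
  have h1 : ‖∑ b with b ∉ U, χ b * (m b : ℂ)‖ ≤ cA * C := by
    refine (norm_sum_le _ _).trans (le_trans (le_of_eq ?_) hrest)
    refine Finset.sum_congr rfl fun b _ => ?_
    rw [norm_mul, hχ1, one_mul, Complex.norm_of_nonneg (hm0 b)]
  have h2 : ‖(∑ b ∈ U, χ b * ((h * m b - Q : ℝ) : ℂ)) / h‖ ≤ (K₀ + C) * E := by
    rw [norm_div, Complex.norm_of_nonneg (by linarith : 0 ≤ h), div_le_iff₀ (by linarith)]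
    refine (norm_sum_le _ _).trans (le_trans (le_of_eq ?_) (hsumU.trans (le_of_eq (by ring))))
    refine Finset.sum_congr rfl fun b _ => ?_
    rw [norm_mul, hχ1, one_mul, Complex.norm_real, Real.norm_eq_abs]
  have h3 : cA * C ≤ cA * C * E := le_mul_of_one_le_right (by positivity) hE1
  nlinarith

/-- The Riemann hypothesis for nontrivial characters. -/
theorem norm_charSum_le (cls : k[X] →* A) (Γ : Subgroup Aˣ)
    (hΓ : ∀ f : k[X], f.Monic → ∀ b : Aˣ, cls f = b → b ∈ Γ) (D : ℕ)
    (hbad : ∀ S : Finset k[X], (∀ P ∈ S, P.Monic ∧ Irreducible P ∧ ¬ IsUnit (cls P)) →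
      ∑ P ∈ S, P.natDegree ≤ D) (N₁ C : ℕ) (hN₁ : 1 ≤ N₁) (H : Subgroup Aˣ)
    (hprime : ∀ M, 1 ≤ M → ∀ b : Aˣ,
      (b ∉ H → classSum cls (2 * N₁ * M) b ≤ C) ∧
      (b ∈ H → Nat.card H * classSum cls (2 * N₁ * M) b ≤
        Fintype.card k ^ (2 * N₁ * M) + C * Fintype.card k ^ (N₁ * M)))
    (hK : ∀ n, D < n → ∃ K, ∀ b ∈ Γ, {f : k[X] | f ∈ monicDeg k n ∧ cls f = b}.ncard = K)
    (χ : MulChar A ℂ) (hχ : ∃ b ∈ Γ, χ b ≠ 1) (n : ℕ) (hn : 1 ≤ n) :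
    ‖∑ P ∈ irrDvd k n, (P.natDegree : ℂ) * χ (cls P) ^ (n / P.natDegree)‖ ≤
      D * √(Fintype.card k : ℝ) ^ n := by
  obtain ⟨s, hs, hsc⟩ := exists_powerSums D (fun n => ∑ f ∈ monicDeg k n, χ (cls f))
    (fun n => ∑ P ∈ irrDvd k n, (P.natDegree : ℂ) * χ (cls P) ^ (n / P.natDegree)) (by
      have : monicDeg k 0 = {1} := by
        ext f
        rw [mem_monicDeg, Finset.mem_singleton]
        exact ⟨fun h => h.1.natDegree_eq_zero.1 h.2, fun h => by simp [h]⟩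
      simp [this])
    (fun n hn => by
      obtain ⟨K, hK⟩ := hK n hn
      exact sum_monicDeg_eq_zero cls Γ hΓ n K hK χ hχ)
    (fun n => natCast_mul_sum_monicDeg ((χ : A →* ℂ).comp cls) n)
  obtain ⟨τ, K, hτ, hbound⟩ := exists_norm_charSum_sub_le cls Γ hΓ D hbad N₁ C hN₁ H hprime χ
  have hq1 : (1 : ℝ) ≤ Fintype.card k := by exact_mod_cast Fintype.card_pos
  obtain ⟨α, rfl⟩ : ∃ α : Fin D → ℂ, Finset.univ.val.map α = s := by
    refine ⟨fun i => s.toList.get (i.cast (by simp [hs])), ?_⟩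
    subst hs
    rw [Fin.univ_val_map]
    conv_rhs => rw [← Multiset.coe_toList s]
    congr 1
    refine List.ext_get (by simp) (by simp)
  have hroot : ∀ i, ‖α i‖ ≤ √(Fintype.card k : ℝ) := by
    intro i
    have h1 := norm_le_of_powerSum_le (ι := Option (Fin D)) (fun o => o.elim τ fun _ => 1)
      (by rintro (_ | i); exacts [hτ, zero_le_one])
      (fun o => o.elim ((Fintype.card k : ℂ) ^ (2 * N₁)) fun i => α i ^ (2 * N₁))
      ((Fintype.card k : ℝ) ^ N₁) K (by positivity) (fun M hM => by
        refine le_trans (le_of_eq ?_) (hbound M hM)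
        rw [hsc _ (Nat.mul_pos (by omega) hM), Fintype.sum_option, Multiset.map_map, ← norm_neg]
        congr 1
        simp only [Option.elim, Complex.ofReal_one, one_mul, pow_mul]
        rw [neg_add_rev, ← sub_eq_add_neg]
        rfl) (some i) zero_lt_one
    simp only [Option.elim, norm_pow] at h1
    rw [pow_mul, pow_le_pow_iff_left₀ (by positivity) (by positivity) (by omega)] at h1
    exact Real.le_sqrt_of_sq_le h1
  rw [hsc n hn, norm_neg, Multiset.map_map]
  refine (norm_sum_le Finset.univ fun i => α i ^ n).trans ?_
  refine (Finset.sum_le_card_nsmul _ _ (√(Fintype.card k : ℝ) ^ n) fun i _ => ?_).trans ?_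
  · rw [norm_pow]
    exact pow_le_pow_left₀ (norm_nonneg _) (hroot i) n
  · simp

end CharBound

section RayClass

open scoped TensorProduct

variable {k : Type} [Field k]

/-- The ring whose units record a residue class modulo `G` together with the `s` leading
coefficients after the first one. -/
abbrev RayRing (G : k[X]) (s : ℕ) : Type := AdjoinRoot G × AdjoinRoot (X ^ (s + 1) : k[X])

/-- The class of a polynomial modulo `G` and of its reverse modulo `X ^ (s + 1)`. -/
noncomputable def rayClass (G : k[X]) (s : ℕ) : k[X] →* RayRing G s :=
  homogEval (AdjoinRoot.root G, 1) (1, AdjoinRoot.root (X ^ (s + 1)))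

lemma rayClass_fst (G : k[X]) (s : ℕ) (f : k[X]) : (rayClass G s f).1 = AdjoinRoot.mk G f := by
  rw [rayClass, homogEval_apply, Prod.fst_sum, ← AdjoinRoot.aeval_eq, aeval_eq_sum_range]
  refine Finset.sum_congr rfl fun i _ => ?_
  simp [Algebra.smul_def]

lemma rayClass_snd (G : k[X]) (s : ℕ) (f : k[X]) :
    (rayClass G s f).2 = AdjoinRoot.mk (X ^ (s + 1)) (f.reflect f.natDegree) := by
  have h : f.reflect f.natDegree =
      ∑ i ∈ Finset.range (f.natDegree + 1), C (f.coeff i) * X ^ (f.natDegree - i) := by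
    have hs : ∀ (S : Finset ℕ) (u : ℕ → k[X]),
        reflect f.natDegree (∑ i ∈ S, u i) = ∑ i ∈ S, reflect f.natDegree (u i) := by
      classical
      intro S u
      induction S using Finset.induction_on with
      | empty => simp
      | insert a S ha ih => rw [Finset.sum_insert ha, Finset.sum_insert ha, reflect_add, ih]
    refine (congrArg (reflect f.natDegree) f.as_sum_range_C_mul_X_pow).trans ((hs _ _).trans ?_)
    refine Finset.sum_congr rfl fun i hi => ?_
    rw [reflect_C_mul_X_pow, revAt_le (Nat.lt_succ_iff.1 (Finset.mem_range.1 hi))]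
  rw [rayClass, homogEval_apply, Prod.snd_sum, h, map_sum]
  refine Finset.sum_congr rfl fun i _ => ?_
  simp [AdjoinRoot.algebraMap_eq]

lemma X_pow_dvd_reflect_iff {n s : ℕ} {r : k[X]} (hr : r.natDegree ≤ n) :
    X ^ (s + 1) ∣ r.reflect n ↔ r.degree < (n - s : ℕ) := by
  rw [X_pow_dvd_iff, degree_lt_iff_coeff_zero]
  constructor
  · intro h m hm
    rcases lt_or_ge n m with hnm | hnm
    · exact coeff_eq_zero_of_natDegree_lt (hr.trans_lt hnm)
    · have := h (n - m) (by omega)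
      rwa [coeff_reflect, revAt_le (by omega), Nat.sub_sub_self hnm] at this
  · intro h d hd
    rw [coeff_reflect]
    rcases lt_or_ge n d with hnd | hnd
    · rw [revAt_eq_self_of_lt hnd]
      exact coeff_eq_zero_of_natDegree_lt (hr.trans_lt hnd)
    · rw [revAt_le hnd]
      exact h _ (by omega)

lemma rayClass_eq_iff (G : k[X]) (s : ℕ) {f g : k[X]} (h : f.natDegree = g.natDegree) :
    rayClass G s f = rayClass G s g ↔
      G ∣ f - g ∧ (f - g).degree < (f.natDegree - s : ℕ) := by
  rw [Prod.ext_iff, rayClass_fst, rayClass_fst, rayClass_snd, rayClass_snd, ← h,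
    AdjoinRoot.mk_eq_mk, AdjoinRoot.mk_eq_mk, ← reflect_sub, X_pow_dvd_reflect_iff]
  exact (natDegree_sub_le _ _).trans (by simp [h])

lemma isUnit_mk_iff_isCoprime {G f : k[X]} : IsUnit (AdjoinRoot.mk G f) ↔ IsCoprime f G := by
  constructor
  · rintro ⟨u, hu⟩
    obtain ⟨v, hv⟩ := AdjoinRoot.mk_surjective (↑u⁻¹ : AdjoinRoot G)
    have h1 : AdjoinRoot.mk G (f * v) = AdjoinRoot.mk G 1 := by
      rw [map_mul, map_one, hv, ← hu, Units.mul_inv]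
    obtain ⟨w, hw⟩ := AdjoinRoot.mk_eq_mk.1 h1
    exact ⟨v, -w, by linear_combination hw⟩
  · rintro ⟨a, b, h⟩
    refine IsUnit.of_mul_eq_one (AdjoinRoot.mk G a) ?_
    rw [← map_mul, ← map_one (AdjoinRoot.mk G), AdjoinRoot.mk_eq_mk]
    exact ⟨-b, by linear_combination h⟩

lemma isUnit_rayClass_iff {G : k[X]} {s : ℕ} {f : k[X]} (hf : f.Monic) :
    IsUnit (rayClass G s f) ↔ IsCoprime f G := by
  rw [Prod.isUnit_iff, rayClass_fst, rayClass_snd, isUnit_mk_iff_isCoprime]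
  refine and_iff_left (isUnit_mk_iff_isCoprime.2 (IsCoprime.pow_right ?_))
  refine ((irreducible_X.isCoprime_or_dvd _).resolve_right fun h => ?_).symm
  rw [X_dvd_iff, coeff_reflect, revAt_le (Nat.zero_le _), Nat.sub_zero, hf.coeff_natDegree] at h
  exact one_ne_zero h

/-- Evaluation of the second component at `0`. -/
noncomputable def rayConst (G : k[X]) (s : ℕ) : RayRing G s →+* k :=
  (AdjoinRoot.lift (RingHom.id k) 0 (by simp)).comp (RingHom.snd _ _)

lemma rayConst_apply (G : k[X]) (s : ℕ) (a : AdjoinRoot G) (f : k[X]) :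
    rayConst G s (a, AdjoinRoot.mk _ f) = f.coeff 0 := by
  simp [rayConst, AdjoinRoot.lift_mk, coeff_zero_eq_eval_zero]

/-- The units whose second component has constant coefficient `1`. -/
noncomputable def rayGroup (G : k[X]) (s : ℕ) : Subgroup (RayRing G s)ˣ :=
  (Units.map (rayConst G s : RayRing G s →* k)).ker

lemma mem_rayGroup {G : k[X]} {s : ℕ} {b : (RayRing G s)ˣ} :
    b ∈ rayGroup G s ↔ rayConst G s b = 1 := by
  rw [rayGroup, MonoidHom.mem_ker, Units.ext_iff]
  rfl

lemma mem_rayGroup_of_monic {G : k[X]} {s : ℕ} (f : k[X]) (hf : f.Monic) (b : (RayRing G s)ˣ)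
    (h : rayClass G s f = b) : b ∈ rayGroup G s := by
  rw [mem_rayGroup, ← h, ← Prod.mk.eta (p := rayClass G s f), rayClass_snd, rayConst_apply,
    coeff_reflect, revAt_le (Nat.zero_le _), Nat.sub_zero, hf.coeff_natDegree]

lemma exists_monic_rayClass_eq {G : k[X]} (hG : G.Monic) {s n : ℕ} (hn : G.natDegree + s ≤ n)
    {b : (RayRing G s)ˣ} (hb : b ∈ rayGroup G s) :
    ∃ f : k[X], f.Monic ∧ f.natDegree = n ∧ rayClass G s f = b := by
  obtain ⟨g, hg⟩ := AdjoinRoot.mk_surjective (b : RayRing G s).1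
  obtain ⟨h₀, hh₀⟩ := AdjoinRoot.mk_surjective (b : RayRing G s).2
  set h := h₀ %ₘ X ^ (s + 1) with hh
  have hXm : (X ^ (s + 1) : k[X]).Monic := monic_X_pow _
  have hmk : AdjoinRoot.mk (X ^ (s + 1)) h = (b : RayRing G s).2 := by
    rw [← hh₀, AdjoinRoot.mk_eq_mk, hh, modByMonic_eq_sub_mul_div]
    exact ⟨-(h₀ /ₘ X ^ (s + 1)), by ring⟩
  have hdeg : h.natDegree ≤ n := by
    have : h.degree < (s + 1 : ℕ) := by
      simpa using degree_modByMonic_lt h₀ hXm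
    rw [degree_lt_iff_coeff_zero] at this
    exact natDegree_le_iff_coeff_eq_zero.2 fun m hm => this m (by omega)
  have hc : h.coeff 0 = 1 := by
    rw [mem_rayGroup, ← Prod.mk.eta (p := (b : RayRing G s)), ← hmk, rayConst_apply] at hb
    exact hb
  set f₀ := h.reflect n with hf₀
  set r := (g - f₀) %ₘ G with hr
  have hrdeg : r.degree < G.natDegree := by
    rw [← degree_eq_natDegree hG.ne_zero]
    exact degree_modByMonic_lt _ hG
  have hf0c : f₀.coeff n = 1 := by rw [hf₀, coeff_reflect, revAt_le le_rfl, Nat.sub_self, hc]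
  have hf0d : f₀.natDegree ≤ n := natDegree_le_iff_coeff_eq_zero.2 fun m hm => by
    rw [hf₀, coeff_reflect, revAt_eq_self_of_lt hm]
    exact coeff_eq_zero_of_natDegree_lt (hdeg.trans_lt hm)
  have hrle : r.natDegree ≤ n := by
    rcases eq_or_ne r 0 with h0 | h0
    · simp [h0]
    · rw [degree_eq_natDegree h0, Nat.cast_lt] at hrdeg
      omega
  have hrc : r.coeff n = 0 :=
    coeff_eq_zero_of_degree_lt (hrdeg.trans_le (Nat.cast_le.2 (by omega)))
  have hle : (f₀ + r).natDegree ≤ n := (natDegree_add_le _ _).trans (max_le hf0d hrle)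
  have hco : (f₀ + r).coeff n = 1 := by rw [coeff_add, hf0c, hrc, add_zero]
  have hnat : (f₀ + r).natDegree = n :=
    le_antisymm hle (le_natDegree_of_ne_zero (by rw [hco]; exact one_ne_zero))
  refine ⟨f₀ + r, monic_of_natDegree_le_of_coeff_eq_one n hle hco, hnat, Prod.ext ?_ ?_⟩
  · rw [rayClass_fst, ← hg, AdjoinRoot.mk_eq_mk, hr, modByMonic_eq_sub_mul_div]
    exact ⟨-((g - f₀) /ₘ G), by ring⟩
  · rw [rayClass_snd, hnat, ← hmk, reflect_add, AdjoinRoot.mk_eq_mk, hf₀, reflect_reflect,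
      add_sub_cancel_left, X_pow_dvd_reflect_iff hrle]
    exact hrdeg.trans_le (Nat.cast_le.2 (by omega))

lemma degree_mul_lt_iff {G h : k[X]} (hG : G ≠ 0) (a : ℕ) :
    (G * h).degree < a ↔ h.degree < (a - G.natDegree : ℕ) := by
  rcases eq_or_ne h 0 with rfl | h0
  · simp
  rw [degree_eq_natDegree h0, degree_eq_natDegree (mul_ne_zero hG h0), natDegree_mul hG h0,
    Nat.cast_lt, Nat.cast_lt]
  omega

variable [Fintype k]

lemma card_filter_rayClass_eq {G : k[X]} (hG : G.Monic) {s n : ℕ} (hn : G.natDegree + s ≤ n)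
    {b : (RayRing G s)ˣ} (hb : b ∈ rayGroup G s) [DecidablePred fun f => rayClass G s f = b] :
    ((monicDeg k n).filter fun f => rayClass G s f = b).card =
      Fintype.card k ^ (n - G.natDegree - s) := by
  classical
  obtain ⟨f₀, hf₀, hf₀n, hf₀b⟩ := exists_monic_rayClass_eq hG hn hb
  rw [← card_polyLT k]
  symm
  refine Finset.card_bij (fun h _ => f₀ + G * h) ?_ ?_ ?_
  · intro h hh
    rw [mem_polyLT] at hh
    have hd : (G * h).degree < (n - s : ℕ) := by
      rw [degree_mul_lt_iff hG.ne_zero]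
      rwa [Nat.sub_right_comm]
    have hd' : (G * h).degree < f₀.degree := by
      rw [degree_eq_natDegree hf₀.ne_zero, hf₀n]
      exact hd.trans_le (Nat.cast_le.2 (by omega))
    have hnd : (f₀ + G * h).natDegree = n := by
      rw [natDegree_add_eq_left_of_degree_lt hd', hf₀n]
    refine Finset.mem_filter.2 ⟨mem_monicDeg.2 ⟨hf₀.add_of_left hd', hnd⟩, ?_⟩
    rw [← hf₀b, rayClass_eq_iff G s (hnd.trans hf₀n.symm), add_sub_cancel_left, hnd]
    exact ⟨dvd_mul_right _ _, hd⟩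
  · intro h₁ _ h₂ _ he
    exact mul_left_cancel₀ hG.ne_zero (add_left_cancel he)
  · intro f hf
    obtain ⟨hf, hfb⟩ := Finset.mem_filter.1 hf
    obtain ⟨hfm, hfn⟩ := mem_monicDeg.1 hf
    obtain ⟨⟨h, hh⟩, hd⟩ := (rayClass_eq_iff G s (hfn.trans hf₀n.symm)).1 (hfb.trans hf₀b.symm)
    rw [hh, degree_mul_lt_iff hG.ne_zero, hfn, Nat.sub_right_comm] at hd
    exact ⟨h, mem_polyLT.2 hd, by rw [← hh]; ring⟩

omit [Fintype k] in
lemma sum_natDegree_le_of_not_isUnit {G : k[X]} (hG : G.Monic) {s : ℕ} (S : Finset k[X])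
    (hS : ∀ P ∈ S, P.Monic ∧ Irreducible P ∧ ¬ IsUnit (rayClass G s P)) :
    ∑ P ∈ S, P.natDegree ≤ G.natDegree := by
  have h1 : ∏ P ∈ S, P ∣ G := by
    refine Finset.prod_dvd_of_coprime ?_ ?_
    · intro P hP P' hP' hne
      refine ((hS P hP).2.1.isCoprime_or_dvd P').resolve_right fun hd => hne ?_
      exact eq_of_monic_of_associated (hS P hP).1 (hS P' hP').1
        ((hS P hP).2.1.associated_of_dvd (hS P' hP').2.1 hd)
    · intro P hP
      refine ((hS P hP).2.1.isCoprime_or_dvd G).resolve_left fun hc => (hS P hP).2.2 ?_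
      exact (isUnit_rayClass_iff (hS P hP).1).2 hc
  rw [← natDegree_prod_of_monic _ _ fun P hP => (hS P hP).1]
  exact natDegree_le_of_dvd h1 hG.ne_zero

lemma exists_subgroup_classSum_le {G : k[X]} (hG : G.Monic) (s : ℕ) :
    ∃ (N₁ : ℕ) (H : Subgroup (RayRing G s)ˣ) (C : ℕ), 1 ≤ N₁ ∧ ∀ M, 1 ≤ M → ∀ b,
      (b ∉ H → classSum (rayClass G s) (2 * N₁ * M) b ≤ C) ∧
      (b ∈ H → Nat.card H * classSum (rayClass G s) (2 * N₁ * M) b ≤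
        Fintype.card k ^ (2 * N₁ * M) + C * Fintype.card k ^ (N₁ * M)) := by
  classical
  have := hG.finite_adjoinRoot
  have := (monic_X_pow (R := k) (s + 1)).finite_adjoinRoot
  have hnu : ¬ IsUnit (1 + X * G) := by
    intro hu
    have h1 := natDegree_eq_zero_of_isUnit hu
    rw [add_comm, ← C_1, natDegree_add_C, natDegree_X_mul hG.ne_zero] at h1
    omega
  obtain ⟨p₀, hp₀, hp₀d⟩ := WfDvdMonoid.exists_irreducible_factor hnu (by
    intro h0
    apply hnu
    have h1 : (1 + X * G).natDegree = G.natDegree + 1 := by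
      rw [add_comm, ← C_1, natDegree_add_C, natDegree_X_mul hG.ne_zero]
    rw [h0, natDegree_zero] at h1
    omega)
  set p := normalize p₀ with hp
  have hpm : p.Monic := monic_normalize hp₀.ne_zero
  have hpi : Irreducible p := (associated_normalize p₀).irreducible hp₀
  have hpd : p ∣ 1 + X * G := (normalize_dvd_iff).2 hp₀d
  obtain ⟨w, hw⟩ := hpd
  have hpu : IsUnit (rayClass G s p) :=
    (isUnit_rayClass_iff hpm).2 ⟨w, -X, by linear_combination -hw⟩
  obtain ⟨u, hu⟩ := hpu
  have hfact : Fact (Irreducible p) := ⟨hpi⟩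
  have := hpm.finite_adjoinRoot
  have : Finite (AdjoinRoot p) := Module.finite_of_finite k
  have := Fintype.ofFinite (AdjoinRoot p)
  obtain ⟨N₁, H, C, hN, h⟩ := exists_subgroup_sum_natDegree_le_of_field
    (C (AdjoinRoot.root G, 1) - C (1, AdjoinRoot.root (X ^ (s + 1))) * X) (rayClass G s)
    (fun P hP hi => map_dvd_prod_expand_sub_homogEval _ _ P hP hi) (AdjoinRoot p)
    (AdjoinRoot.root p) p.natDegree hpi.natDegree_pos (by
      rw [Module.card_eq_pow_finrank (K := k)]
      exact congrArg _ finrank_quotient_span_eq_natDegree) u (by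
      obtain ⟨v, hv⟩ := map_dvd_prod_expand_sub_homogEval
        ((AdjoinRoot.root G, 1) : RayRing G s) (1, AdjoinRoot.root (X ^ (s + 1))) p hpm hpi
      set R := AdjoinRoot p ⊗[k] RayRing G s
      set i := (Algebra.TensorProduct.includeRight : RayRing G s →ₐ[k] R)
      set x := algebraMap (AdjoinRoot p) R (AdjoinRoot.root p)
      have h0 : (p.map (algebraMap k (RayRing G s))).eval₂ i.toRingHom x = 0 := by
        rw [eval₂_map]
        have h1 : i.toRingHom.comp (algebraMap k (RayRing G s)) = algebraMap k R := i.comp_algebraMap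
        rw [h1, ← aeval_def, aeval_algebraMap_apply, AdjoinRoot.aeval_eq, AdjoinRoot.mk_self,
          map_zero]
      have h2 := congrArg (eval₂ i.toRingHom x) hv
      rw [eval₂_mul, h0, zero_mul, eval₂_sub, eval₂_C, sub_eq_zero] at h2
      rw [h2, hu]
      rfl)
  refine ⟨N₁, H, C, hN, fun M hM b => h M hM b _ fun P hP => ?_⟩
  obtain ⟨h1, h2⟩ := (@Finset.mem_filter _ _ (fun _ => Classical.propDecidable _) _ _).1 hP
  obtain ⟨h3, h4, h5⟩ := (mem_irrDvd (Nat.mul_pos (by omega) hM)).1 h1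
  exact ⟨h3, h4, h5, h2⟩

/-- The Riemann hypothesis for characters of the ray class group. -/
theorem norm_rayCharSum_le {G : k[X]} (hG : G.Monic) (s : ℕ) (χ : MulChar (RayRing G s) ℂ)
    (hχ : ∃ b ∈ rayGroup G s, χ b ≠ 1) (n : ℕ) (hn : 1 ≤ n) :
    ‖∑ P ∈ irrDvd k n, (P.natDegree : ℂ) * χ (rayClass G s P) ^ (n / P.natDegree)‖ ≤
      (G.natDegree + s : ℕ) * √(Fintype.card k : ℝ) ^ n := by
  classical
  have := hG.finite_adjoinRoot
  have := (monic_X_pow (R := k) (s + 1)).finite_adjoinRoot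
  have : Finite (AdjoinRoot G) := Module.finite_of_finite k
  have : Finite (AdjoinRoot (X ^ (s + 1) : k[X])) := Module.finite_of_finite k
  obtain ⟨N₁, H, C, hN, h⟩ := exists_subgroup_classSum_le hG s
  refine norm_charSum_le (rayClass G s) (rayGroup G s) mem_rayGroup_of_monic (G.natDegree + s)
    (fun S hS => (sum_natDegree_le_of_not_isUnit hG S hS).trans (Nat.le_add_right _ _)) N₁ C hN H h
    (fun n hn => ⟨Fintype.card k ^ (n - G.natDegree - s), fun b hb => ?_⟩) χ hχ n hn
  rw [← card_filter_rayClass_eq hG hn.le hb, ← Set.ncard_coe_finset]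
  congr 1
  ext f
  simp

end RayClass

lemma AddChar.sum_norm_sum_sq {V : Type*} [AddCommGroup V] [Fintype V] (F : V → ℂ) :
    ∑ ψ : AddChar V ℂ, ‖∑ x, F x * ψ x‖ ^ 2 = Fintype.card V * ∑ x, ‖F x‖ ^ 2 := by
  classical
  have h : ((∑ ψ : AddChar V ℂ, ‖∑ x, F x * ψ x‖ ^ 2 : ℝ) : ℂ) =
      ((Fintype.card V * ∑ x, ‖F x‖ ^ 2 : ℝ) : ℂ) := by
    push_cast
    have h1 : ∀ ψ : AddChar V ℂ, ((‖∑ x, F x * ψ x‖ : ℂ)) ^ 2 =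
        ∑ x, ∑ y, F x * starRingEnd ℂ (F y) * ψ (x - y) := by
      intro ψ
      rw [← Complex.mul_conj', map_sum, Finset.sum_mul_sum]
      refine Finset.sum_congr rfl fun x _ => Finset.sum_congr rfl fun y _ => ?_
      rw [map_mul, ← AddChar.map_neg_eq_conj, sub_eq_add_neg, AddChar.map_add_eq_mul]
      ring
    simp_rw [h1]
    rw [Finset.sum_comm, Finset.mul_sum]
    refine Finset.sum_congr rfl fun x _ => ?_
    rw [Finset.sum_comm]
    simp_rw [← Finset.mul_sum, AddChar.sum_apply_eq_ite, sub_eq_zero]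
    rw [Finset.sum_eq_single x (fun y _ hy => by rw [if_neg hy.symm, mul_zero]) (by simp),
      if_pos rfl,
      Complex.mul_conj']
    simp [mul_comm]
  exact_mod_cast h

section Equidistribution

variable {k : Type} [Field k] [Fintype k]

lemma finite_rayRing {G : k[X]} (hG : G.Monic) (s : ℕ) : Finite (RayRing G s) := by
  have := hG.finite_adjoinRoot
  have := (monic_X_pow (R := k) (s + 1)).finite_adjoinRoot
  have : Finite (AdjoinRoot G) := Module.finite_of_finite k
  have : Finite (AdjoinRoot (X ^ (s + 1) : k[X])) := Module.finite_of_finite k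
  infer_instance

lemma classSum_eq_zero {G : k[X]} {s n : ℕ} (hn : 1 ≤ n) {b : (RayRing G s)ˣ}
    (hb : b ∉ rayGroup G s) : classSum (rayClass G s) n b = 0 := by
  refine Finset.sum_eq_zero fun P hP => ?_
  obtain ⟨hP1, hP2⟩ := (@Finset.mem_filter _ _ (fun _ => Classical.propDecidable _) _ _).1 hP
  exact absurd (mem_rayGroup_of_monic (P ^ (n / P.natDegree)) (((mem_irrDvd hn).1 hP1).1.pow _) b
    (by rw [map_pow, hP2])) hb

lemma sum_classSum_le {A : Type*} [CommRing A] [Finite A] (cls : k[X] →* A) (n : ℕ) (hn : 1 ≤ n)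
    [Fintype Aˣ] : ∑ b : Aˣ, classSum cls n b ≤ Fintype.card k ^ n := by
  classical
  have h1 := sum_irrDvd_eq_sum_classSum cls n (fun _ => 1)
  simp only [mul_one, one_mul] at h1
  rw [← Nat.cast_sum, ← Nat.cast_sum, Nat.cast_inj] at h1
  rw [← h1, ← sum_irrDvd_natDegree n hn]
  exact Finset.sum_le_sum_of_subset (Finset.filter_subset _ _)

open Classical in
/-- The deviation of the class sums from uniform distribution on the ray class group. -/
noncomputable def classDev (G : k[X]) (s n : ℕ) (b : (RayRing G s)ˣ) : ℝ :=
  classSum (rayClass G s) n b -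
    if b ∈ rayGroup G s then (Fintype.card k : ℝ) ^ n / Nat.card (rayGroup G s) else 0

lemma norm_sum_classDev_mul_le {G : k[X]} (hG : G.Monic) (s n : ℕ) (hn : 1 ≤ n)
    [Fintype (RayRing G s)ˣ] (ψ : (RayRing G s)ˣ →* ℂ) :
    ‖∑ b, (classDev G s n b : ℂ) * ψ b‖ ≤ (G.natDegree + s : ℕ) * √(Fintype.card k : ℝ) ^ n := by
  classical
  have := finite_rayRing hG s
  have hq1 : 1 ≤ √(Fintype.card k : ℝ) := by
    rw [Real.one_le_sqrt]; exact_mod_cast Fintype.card_pos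
  have hcard : (Nat.card (rayGroup G s) : ℂ) ≠ 0 := by
    have : 0 < Nat.card (rayGroup G s) := Nat.card_pos
    exact_mod_cast this.ne'
  have hsum : ∑ b, (classDev G s n b : ℂ) * ψ b =
      ∑ b, ψ b * classSum (rayClass G s) n b - (Fintype.card k : ℂ) ^ n / Nat.card (rayGroup G s) *
        ∑ b with b ∈ rayGroup G s, ψ b := by
    rw [Finset.mul_sum, Finset.sum_filter, ← Finset.sum_sub_distrib]
    refine Finset.sum_congr rfl fun b _ => ?_
    rw [classDev]
    split_ifs
    · push_cast; ring
    · push_cast; ring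
  rw [hsum]
  rcases sum_subgroup_char_eq ψ (rayGroup G s) with ⟨h1, h2⟩ | ⟨⟨b, hb, h1⟩, h2⟩
  · rw [h2, div_mul_cancel₀ _ hcard]
    have h3 : ∑ b, ψ b * (classSum (rayClass G s) n b : ℂ) =
        ((∑ b, classSum (rayClass G s) n b : ℕ) : ℂ) := by
      rw [Nat.cast_sum]
      refine Finset.sum_congr rfl fun b _ => ?_
      by_cases hb : b ∈ rayGroup G s
      · rw [h1 b hb, one_mul]
      · rw [classSum_eq_zero hn hb]; simp
    have h4 := sum_classSum_le (rayClass G s) n hn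
    have h5 := card_pow_le_sum_classSum (rayClass G s) n hn G.natDegree
      (sum_natDegree_le_of_not_isUnit hG)
    rw [h3, ← norm_neg, neg_sub, ← Nat.cast_pow, ← Nat.cast_sub h4, Complex.norm_natCast]
    have h6 : ((G.natDegree + s : ℕ) : ℝ) ≤ (G.natDegree + s : ℕ) * √(Fintype.card k : ℝ) ^ n :=
      le_mul_of_one_le_right (Nat.cast_nonneg _) (one_le_pow₀ hq1)
    refine le_trans ?_ h6
    exact_mod_cast (by omega : _ ≤ _)
  · rw [h2, mul_zero, sub_zero]
    have h3 := charSum_eq_sum_classSum (rayClass G s) n (MulChar.ofUnitHom ψ.toHomUnits)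
    simp only [MulChar.ofUnitHom_coe, MonoidHom.coe_toHomUnits] at h3
    rw [← h3]
    exact norm_rayCharSum_le hG s _ ⟨b, hb, by rwa [MulChar.ofUnitHom_coe]⟩ n hn

lemma sum_classDev_sq_le {G : k[X]} (hG : G.Monic) (s n : ℕ) (hn : 1 ≤ n)
    [Fintype (RayRing G s)ˣ] :
    ∑ b, classDev G s n b ^ 2 ≤ ((G.natDegree + s : ℕ) * √(Fintype.card k : ℝ) ^ n) ^ 2 := by
  have h1 := AddChar.sum_norm_sum_sq (V := Additive (RayRing G s)ˣ)
    (fun b => (classDev G s n b.toMul : ℂ))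
  have h2 : ∀ ψ : AddChar (Additive (RayRing G s)ˣ) ℂ,
      ‖∑ x, (classDev G s n x.toMul : ℂ) * ψ x‖ ^ 2 ≤
        ((G.natDegree + s : ℕ) * √(Fintype.card k : ℝ) ^ n) ^ 2 := by
    intro ψ
    refine pow_le_pow_left₀ (norm_nonneg _) ?_ 2
    refine le_trans (le_of_eq (congrArg _ ?_)) (norm_sum_classDev_mul_le hG s n hn
      ⟨⟨fun b => ψ (Additive.ofMul b), by simp⟩, fun x y => by simp [AddChar.map_add_eq_mul]⟩)
    exact Fintype.sum_equiv Additive.toMul _ _ fun b => rfl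
  have h3 := Finset.sum_le_card_nsmul Finset.univ _ _ fun ψ _ => h2 ψ
  rw [h1, Finset.card_univ, AddChar.card_eq, nsmul_eq_mul] at h3
  have h4 := le_of_mul_le_mul_left h3 (by exact_mod_cast Fintype.card_pos)
  refine le_trans (le_of_eq ?_) h4
  refine Fintype.sum_equiv Additive.ofMul _ _ fun b => ?_
  simp [sq_abs]

lemma card_rayGroup {G : k[X]} (hG : G.Monic) (s n : ℕ) (hn : G.natDegree + s ≤ n)
    [DecidablePred fun f : k[X] => IsCoprime f G] :
    Nat.card (rayGroup G s) * Fintype.card k ^ (n - G.natDegree - s) =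
      ((monicDeg k n).filter fun f => IsCoprime f G).card := by
  classical
  have := finite_rayRing hG s
  have := Fintype.ofFinite (RayRing G s)
  rw [Nat.card_eq_fintype_card, Fintype.card_subtype]
  symm
  have hmaps : ∀ f ∈ (monicDeg k n).filter fun f => IsCoprime f G,
      rayClass G s f ∈ ((Finset.univ.filter (· ∈ rayGroup G s)).image Units.val) := by
    intro f hf
    obtain ⟨h1, h2⟩ := Finset.mem_filter.1 hf
    obtain ⟨h3, -⟩ := mem_monicDeg.1 h1
    obtain ⟨u, hu⟩ := (isUnit_rayClass_iff (s := s) h3).2 h2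
    refine Finset.mem_image.2 ⟨u, Finset.mem_filter.2 ⟨Finset.mem_univ _, ?_⟩, hu⟩
    exact mem_rayGroup_of_monic f h3 u hu.symm
  rw [Finset.card_eq_sum_card_fiberwise hmaps,
    Finset.sum_image (by simp [Units.val_injective.injOn])]
  rw [← smul_eq_mul, ← Finset.sum_const]
  refine Finset.sum_congr rfl fun b hb => ?_
  rw [← card_filter_rayClass_eq hG hn (Finset.mem_filter.1 hb).2, Finset.filter_filter]
  congr 1
  refine Finset.filter_congr fun f hf => ⟨fun h => h.2, fun h => ⟨?_, h⟩⟩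
  rw [← isUnit_rayClass_iff (s := s) (mem_monicDeg.1 hf).1, h]
  exact b.isUnit

lemma card_rayGroup_le {G : k[X]} (hG : G.Monic) (s : ℕ) :
    Nat.card (rayGroup G s) ≤ Fintype.card k ^ (G.natDegree + s) := by
  classical
  have h := card_rayGroup hG s _ le_rfl
  rw [Nat.add_sub_cancel_left, Nat.sub_self, pow_zero, mul_one] at h
  rw [h, ← card_monicDeg]
  exact Finset.card_filter_le _ _

lemma sum_abs_classDev_le {G : k[X]} (hG : G.Monic) (s n : ℕ) (hn : 1 ≤ n)
    [Fintype (RayRing G s)ˣ] :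
    ∑ b, |classDev G s n b| ≤
      (G.natDegree + s : ℕ) * √(Fintype.card k : ℝ) ^ (G.natDegree + s + n) := by
  classical
  have hsupp : ∑ b, |classDev G s n b| = ∑ b with b ∈ rayGroup G s, |classDev G s n b| := by
    rw [Finset.sum_filter]
    refine Finset.sum_congr rfl fun b _ => ?_
    split_ifs with hb
    · rfl
    · simp [classDev, classSum_eq_zero hn hb, hb]
  rw [hsupp]
  refine abs_le_of_sq_le_sq' ?_ (by positivity) |>.2
  refine sq_sum_le_card_mul_sum_sq.trans ?_
  have h1 : ((Finset.univ.filter (· ∈ rayGroup G s)).card : ℝ) ≤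
      (√(Fintype.card k : ℝ) ^ (G.natDegree + s)) ^ 2 := by
    rw [← pow_mul, mul_comm _ 2, pow_mul, Real.sq_sqrt (Nat.cast_nonneg _)]
    have := card_rayGroup_le hG s
    rw [Nat.card_eq_fintype_card, Fintype.card_subtype] at this
    exact_mod_cast this
  have h2 : ∑ b with b ∈ rayGroup G s, |classDev G s n b| ^ 2 ≤
      ((G.natDegree + s : ℕ) * √(Fintype.card k : ℝ) ^ n) ^ 2 := by
    refine le_trans ?_ (sum_classDev_sq_le hG s n hn)
    simp only [sq_abs]
    exact Finset.sum_le_sum_of_subset_of_nonneg (Finset.subset_univ _) fun _ _ _ => sq_nonneg _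
  refine (mul_le_mul h1 h2 (by positivity) (by positivity)).trans (le_of_eq ?_)
  ring

end Equidistribution

section Translation

variable {k : Type} [Field k] [Fintype k]

lemma sum_polyLT_add_mul {p h : k[X]} (hp : p.Monic) (hpi : Irreducible p) (hph : ¬ p ∣ h)
    {τ : k[X] → ℂ} (hτ : ∀ x y, p ∣ x - y → τ x = τ y) (x : k[X]) :
    ∑ z ∈ polyLT k p.natDegree, τ (x + h * z) = ∑ r ∈ polyLT k p.natDegree, τ r := by
  have hmod : ∀ y : k[X], y %ₘ p ∈ polyLT k p.natDegree := fun y => by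
    rw [mem_polyLT, ← degree_eq_natDegree hp.ne_zero]
    exact degree_modByMonic_lt y hp
  have hsub : ∀ y : k[X], p ∣ y - y %ₘ p := fun y => by
    rw [modByMonic_eq_sub_mul_div y p]
    exact ⟨y /ₘ p, by ring⟩
  have hinj : Set.InjOn (fun z => (x + h * z) %ₘ p) (polyLT k p.natDegree) := by
    intro z₁ h₁ z₂ h₂ he
    rw [Finset.mem_coe, mem_polyLT] at h₁ h₂
    have h3 : p ∣ h * (z₁ - z₂) := by
      have h4 := dvd_sub (hsub (x + h * z₁)) (hsub (x + h * z₂))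
      simp only at he
      rw [he] at h4
      convert h4 using 1
      ring
    have h5 := (hpi.prime.dvd_or_dvd h3).resolve_left hph
    refine sub_eq_zero.1 (eq_zero_of_dvd_of_degree_lt h5 ?_)
    rw [degree_eq_natDegree hp.ne_zero]
    exact (degree_sub_le _ _).trans_lt (max_lt h₁ h₂)
  refine Finset.sum_nbij (fun z => (x + h * z) %ₘ p) (fun z _ => hmod _) hinj ?_
    (fun z _ => hτ _ _ (hsub _))
  exact Finset.surjOn_of_injOn_of_card_le _ (fun z _ => hmod _) hinj le_rfl

/-- A function periodic modulo `p` averages out against a function invariant under translation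
by the multiples `h * z` with `z` running over all residues modulo `p`. -/
lemma sum_mul_of_translate (S : Finset k[X]) {p h : k[X]} (hp : p.Monic) (hpi : Irreducible p)
    (hph : ¬ p ∣ h) (hS : ∀ x ∈ S, ∀ z : k[X], z.degree < p.natDegree → x + h * z ∈ S)
    {F τ : k[X] → ℂ} (hF : ∀ x ∈ S, ∀ z : k[X], z.degree < p.natDegree → F (x + h * z) = F x)
    (hτ : ∀ x y, p ∣ x - y → τ x = τ y) :
    (Fintype.card k : ℂ) ^ p.natDegree * ∑ x ∈ S, F x * τ x =
      (∑ r ∈ polyLT k p.natDegree, τ r) * ∑ x ∈ S, F x := by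
  have h1 : ∀ z ∈ polyLT k p.natDegree, ∑ x ∈ S, F x * τ x = ∑ x ∈ S, F x * τ (x + h * z) := by
    intro z hz
    rw [mem_polyLT] at hz
    have hz' : (-z).degree < p.natDegree := by rwa [degree_neg]
    symm
    refine Finset.sum_bij (fun x _ => x + h * z) (fun x hx => hS x hx z hz)
      (fun x _ y _ he => add_right_cancel he) (fun x hx => ⟨x + h * -z, hS x hx _ hz', by ring⟩)
      (fun x hx => by rw [hF x hx z hz])
  have h2 := Finset.sum_congr (rfl : polyLT k p.natDegree = _) h1
  rw [Finset.sum_const, card_polyLT, nsmul_eq_mul, Finset.sum_comm] at h2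
  push_cast at h2
  rw [h2, Finset.mul_sum]
  refine Finset.sum_congr rfl fun x _ => ?_
  rw [← Finset.mul_sum, sum_polyLT_add_mul hp hpi hph hτ, mul_comm]

open Classical in
/-- The indicator function of the polynomials prime to `p`, normalized to have mean `1`. -/
noncomputable def coprimeWt (p f : k[X]) : ℝ :=
  if p ∣ f then 0
  else (Fintype.card k : ℝ) ^ p.natDegree / ((Fintype.card k : ℝ) ^ p.natDegree - 1)

lemma two_le_card_pow {p : k[X]} (hpi : Irreducible p) :
    (2 : ℝ) ≤ (Fintype.card k : ℝ) ^ p.natDegree := by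
  have h1 : 2 ≤ Fintype.card k := Fintype.one_lt_card
  have h2 : 2 ≤ Fintype.card k ^ p.natDegree :=
    h1.trans (Nat.le_self_pow hpi.natDegree_pos.ne' _)
  exact_mod_cast h2

lemma coprimeWt_of_dvd {p f : k[X]} (h : p ∣ f) : coprimeWt p f = 0 := if_pos h

lemma coprimeWt_of_not_dvd {p f : k[X]} (h : ¬ p ∣ f) : coprimeWt p f =
    (Fintype.card k : ℝ) ^ p.natDegree / ((Fintype.card k : ℝ) ^ p.natDegree - 1) := if_neg h

lemma coprimeWt_nonneg {p : k[X]} (hpi : Irreducible p) (f : k[X]) : 0 ≤ coprimeWt p f := by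
  have := two_le_card_pow hpi
  rw [coprimeWt]
  split_ifs
  · exact le_rfl
  · exact div_nonneg (by linarith) (by linarith)

lemma coprimeWt_le_two {p : k[X]} (hpi : Irreducible p) (f : k[X]) : coprimeWt p f ≤ 2 := by
  have := two_le_card_pow hpi
  rw [coprimeWt]
  split_ifs
  · exact zero_le_two
  · rw [div_le_iff₀ (by linarith)]; linarith

lemma coprimeWt_congr {p x y : k[X]} (h : p ∣ x - y) : coprimeWt p x = coprimeWt p y := by
  have hiff := dvd_iff_dvd_of_dvd_sub h
  by_cases hx : p ∣ x
  · rw [coprimeWt_of_dvd hx, coprimeWt_of_dvd (hiff.1 hx)]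
  · rw [coprimeWt_of_not_dvd hx, coprimeWt_of_not_dvd fun hy => hx (hiff.2 hy)]

lemma sum_polyLT_coprimeWt {p : k[X]} (hp : p.Monic) (hpi : Irreducible p) :
    ∑ r ∈ polyLT k p.natDegree, coprimeWt p r = (Fintype.card k : ℝ) ^ p.natDegree := by
  classical
  have h2 := two_le_card_pow hpi
  set c := (Fintype.card k : ℝ) ^ p.natDegree / ((Fintype.card k : ℝ) ^ p.natDegree - 1) with hc
  have h : ∀ r ∈ polyLT k p.natDegree, coprimeWt p r = c - if r = 0 then c else 0 := by
    intro r hr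
    rw [mem_polyLT, ← degree_eq_natDegree hp.ne_zero] at hr
    by_cases h0 : r = 0
    · rw [coprimeWt_of_dvd (h0 ▸ dvd_zero p), if_pos h0, sub_self]
    · rw [coprimeWt_of_not_dvd fun hd => h0 (eq_zero_of_dvd_of_degree_lt hd hr), if_neg h0,
        sub_zero]
  rw [Finset.sum_congr rfl h, Finset.sum_sub_distrib, Finset.sum_ite_eq', if_pos, Finset.sum_const,
    card_polyLT, nsmul_eq_mul, hc]
  · push_cast
    field_simp [(by linarith : (Fintype.card k : ℝ) ^ p.natDegree - 1 ≠ 0)]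
  · rw [mem_polyLT, degree_zero]
    exact WithBot.bot_lt_coe _

omit [Fintype k] in
lemma not_dvd_prod_of_notMem {T : Finset k[X]} (hT : ∀ P ∈ T, P.Monic ∧ Irreducible P) {p : k[X]}
    (hp : p.Monic) (hpi : Irreducible p) (hpT : p ∉ T) : ¬ p ∣ ∏ P ∈ T, P := by
  rw [hpi.prime.dvd_finsetProd_iff]
  rintro ⟨P, hP, hd⟩
  have := eq_of_monic_of_associated hp (hT P hP).1 (hpi.associated_of_dvd (hT P hP).2 hd)
  exact hpT (this ▸ hP)

lemma sum_monicDeg_prod_coprimeWt (T : Finset k[X]) (hT : ∀ P ∈ T, P.Monic ∧ Irreducible P)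
    (n : ℕ) (hn : ∑ P ∈ T, P.natDegree ≤ n) :
    ∑ f ∈ monicDeg k n, ∏ p ∈ T, coprimeWt p f = (Fintype.card k : ℝ) ^ n := by
  classical
  induction T using Finset.induction_on with
  | empty => simp [card_monicDeg]
  | insert p T hpT ih =>
    rw [Finset.sum_insert hpT] at hn
    have hT' : ∀ P ∈ T, P.Monic ∧ Irreducible P := fun P hP => hT P (Finset.mem_insert_of_mem hP)
    obtain ⟨hp, hpi⟩ := hT p (Finset.mem_insert_self _ _)
    have hdeg : (∏ P ∈ T, P).natDegree = ∑ P ∈ T, P.natDegree :=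
      natDegree_prod_of_monic _ _ fun P hP => (hT' P hP).1
    have hne : (∏ P ∈ T, P) ≠ 0 := (monic_prod_of_monic _ _ fun P hP => (hT' P hP).1).ne_zero
    have key := sum_mul_of_translate (monicDeg k n) (h := ∏ P ∈ T, P) hp hpi
      (not_dvd_prod_of_notMem hT' hp hpi hpT) (fun x hx z hz => by
        obtain ⟨h1, h2⟩ := mem_monicDeg.1 hx
        have hd : ((∏ P ∈ T, P) * z).degree < x.degree := by
          rw [degree_eq_natDegree h1.ne_zero, h2, degree_mul_lt_iff hne, hdeg]
          exact hz.trans_le (Nat.cast_le.2 (by omega))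
        exact mem_monicDeg.2 ⟨h1.add_of_left hd, by rw [natDegree_add_eq_left_of_degree_lt hd, h2]⟩)
      (F := fun f => ((∏ p ∈ T, coprimeWt p f : ℝ) : ℂ)) (τ := fun f => (coprimeWt p f : ℂ))
      (fun x hx z hz => by
        refine congrArg _ (Finset.prod_congr rfl fun P hP => coprimeWt_congr ?_)
        rw [add_sub_cancel_left]
        exact (Finset.dvd_prod_of_mem _ hP).mul_right z)
      (fun x y hxy => congrArg _ (coprimeWt_congr hxy))
    rw [← Complex.ofReal_sum, ← Complex.ofReal_sum, ih hT' (by omega), sum_polyLT_coprimeWt hp hpi]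
      at key
    have hq : (Fintype.card k : ℝ) ^ p.natDegree ≠ 0 := by
      have := two_le_card_pow hpi
      linarith
    refine mul_left_cancel₀ hq ?_
    simp only [Finset.prod_insert hpT, mul_comm (coprimeWt p _)]
    exact_mod_cast key

end Translation

section PrimeSums

variable {k : Type} [Field k] [Fintype k]

lemma prod_coprimeWt_eq {G : k[X]} (hG : G.Monic) {T : Finset k[X]}
    (hT : ∀ P, P ∈ T ↔ P.Monic ∧ Irreducible P ∧ P ∣ G) (f : k[X])
    [Decidable (IsCoprime f G)] :
    ∏ p ∈ T, coprimeWt p f = if IsCoprime f G then ∏ p ∈ T,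
      ((Fintype.card k : ℝ) ^ p.natDegree / ((Fintype.card k : ℝ) ^ p.natDegree - 1)) else 0 := by
  classical
  split_ifs with h
  · refine Finset.prod_congr rfl fun p hp => coprimeWt_of_not_dvd fun hd => ?_
    obtain ⟨-, h2, h3⟩ := (hT p).1 hp
    exact h2.not_isUnit (h.isUnit_of_dvd' hd h3)
  · obtain ⟨p, hp, h1, h2⟩ : ∃ p, Irreducible p ∧ p ∣ f ∧ p ∣ G := by
      by_contra! hc
      refine h (isCoprime_of_irreducible_dvd (fun hz => hG.ne_zero hz.2) fun p hp h1 h2 =>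
        hc p hp h1 h2)
    refine Finset.prod_eq_zero (i := normalize p) ((hT _).2 ⟨monic_normalize hp.ne_zero,
      (associated_normalize p).irreducible hp, normalize_dvd_iff.2 h2⟩)
      (coprimeWt_of_dvd (normalize_dvd_iff.2 h1))

omit [Fintype k] in
lemma sum_natDegree_le_of_dvd {G : k[X]} (hG : G.Monic) (T : Finset k[X])
    (hT : ∀ P ∈ T, P.Monic ∧ Irreducible P ∧ P ∣ G) : ∑ P ∈ T, P.natDegree ≤ G.natDegree :=
  sum_natDegree_le_of_not_isUnit hG (s := 0) T fun P hP =>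
    ⟨(hT P hP).1, (hT P hP).2.1, fun hu => (hT P hP).2.1.not_isUnit
      (((isUnit_rayClass_iff (hT P hP).1).1 hu).isUnit_of_dvd' dvd_rfl (hT P hP).2.2)⟩

lemma card_pow_div_card_rayGroup {G : k[X]} (hG : G.Monic) {T : Finset k[X]}
    (hT : ∀ P, P ∈ T ↔ P.Monic ∧ Irreducible P ∧ P ∣ G) (s n : ℕ) (hn : G.natDegree + s ≤ n) :
    (Fintype.card k : ℝ) ^ n / Nat.card (rayGroup G s) = (∏ p ∈ T,
      ((Fintype.card k : ℝ) ^ p.natDegree / ((Fintype.card k : ℝ) ^ p.natDegree - 1))) *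
        (Fintype.card k : ℝ) ^ (n - G.natDegree - s) := by
  classical
  have := finite_rayRing hG s
  have h0 : (Nat.card (rayGroup G s) : ℝ) ≠ 0 := by
    have : 0 < Nat.card (rayGroup G s) := Nat.card_pos
    exact_mod_cast this.ne'
  have h1 := card_rayGroup hG s n hn
  have h2 := sum_monicDeg_prod_coprimeWt T (fun P hP => ⟨((hT P).1 hP).1, ((hT P).1 hP).2.1⟩) n
    ((sum_natDegree_le_of_dvd hG T fun P hP => (hT P).1 hP).trans (by omega))
  simp only [prod_coprimeWt_eq hG hT] at h2
  rw [← Finset.sum_filter, Finset.sum_const, ← h1, nsmul_eq_mul] at h2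
  rw [div_eq_iff h0, ← h2]
  push_cast
  ring

lemma card_pow_half_le {n j : ℕ} (h : 2 * j ≤ n) :
    (Fintype.card k : ℝ) ^ j ≤ √(Fintype.card k : ℝ) ^ n := by
  have hq1 : 1 ≤ √(Fintype.card k : ℝ) := by
    rw [Real.one_le_sqrt]; exact_mod_cast Fintype.card_pos
  calc (Fintype.card k : ℝ) ^ j = √(Fintype.card k : ℝ) ^ (2 * j) := by
        rw [pow_mul, Real.sq_sqrt (Nat.cast_nonneg _)]
    _ ≤ _ := pow_le_pow_right₀ hq1 h

open Classical in
lemma sum_irrDvd_natDegree_ne_le (n : ℕ) (hn : 1 ≤ n) :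
    ((∑ P ∈ irrDvd k n with P.natDegree ≠ n, P.natDegree : ℕ) : ℝ) ≤
      n * √(Fintype.card k : ℝ) ^ n := by
  have h1 : ∀ P ∈ (irrDvd k n).filter (fun P => P.natDegree ≠ n),
      P.natDegree ∈ Finset.Icc 1 (n / 2) := by
    intro P hP
    obtain ⟨hP, hne⟩ := Finset.mem_filter.1 hP
    obtain ⟨h1, h2, h3⟩ := (mem_irrDvd hn).1 hP
    obtain ⟨c, hc⟩ := h3
    refine Finset.mem_Icc.2 ⟨h2.natDegree_pos, ?_⟩
    have h5 : 2 ≤ c := by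
      by_contra h
      interval_cases c
      · omega
      · exact hne (by omega)
    rw [Nat.le_div_iff_mul_le two_pos, hc]
    exact Nat.mul_le_mul_left _ h5
  have h2 : ∑ P ∈ irrDvd k n with P.natDegree ≠ n, P.natDegree ≤
      ∑ j ∈ Finset.Icc 1 (n / 2), Fintype.card k ^ j := by
    rw [← Finset.sum_fiberwise_of_maps_to h1]
    refine Finset.sum_le_sum fun j hj => ?_
    have hj1 := (Finset.mem_Icc.1 hj).1
    rw [← sum_irrDvd_natDegree j hj1]
    refine Finset.sum_le_sum_of_subset fun P hP => ?_
    obtain ⟨hP, rfl⟩ := Finset.mem_filter.1 hP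
    obtain ⟨h1, h2, -⟩ := (mem_irrDvd hn).1 (Finset.mem_filter.1 (Finset.mem_filter.1 hP).1).1
    exact (mem_irrDvd hj1).2 ⟨h1, h2, dvd_rfl⟩
  have h3 : ((∑ j ∈ Finset.Icc 1 (n / 2), Fintype.card k ^ j : ℕ) : ℝ) ≤
      (n / 2 : ℕ) * √(Fintype.card k : ℝ) ^ n := by
    push_cast
    refine (Finset.sum_le_card_nsmul _ _ (√(Fintype.card k : ℝ) ^ n) fun j hj => ?_).trans ?_
    · exact card_pow_half_le (by have := (Finset.mem_Icc.1 hj).2; omega)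
    · rw [nsmul_eq_mul, Nat.card_Icc, Nat.add_sub_cancel]
  refine (Nat.cast_le.2 h2).trans (h3.trans ?_)
  exact mul_le_mul_of_nonneg_right (Nat.cast_le.2 (Nat.div_le_self _ _)) (by positivity)

open Classical in
lemma norm_sum_prime_sub_le {G : k[X]} (hG : G.Monic) {T : Finset k[X]}
    (hT : ∀ P, P ∈ T ↔ P.Monic ∧ Irreducible P ∧ P ∣ G) {s n : ℕ} (hn1 : 1 ≤ n)
    (hn : G.natDegree + s ≤ n) (Φ : k[X] → ℂ) (hΦ : ∀ f, ‖Φ f‖ ≤ 1)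
    (hinv : ∀ f ∈ monicDeg k n, ∀ g ∈ monicDeg k n, G ∣ f - g → (f - g).degree < (n - s : ℕ) →
      Φ f = Φ g) :
    ‖∑ f ∈ monicDeg k n, ((if Irreducible f then (n : ℂ) else 0) - (∏ p ∈ T, coprimeWt p f : ℝ)) *
      Φ f‖ ≤ (2 * (G.natDegree + s) + n) * √(Fintype.card k : ℝ) ^ (G.natDegree + s + n) := by
  have := finite_rayRing hG s
  have := Fintype.ofFinite (RayRing G s)
  set q : ℝ := ((Fintype.card k : ℕ) : ℝ) with hq
  have hq1 : 1 ≤ √q := by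
    rw [Real.one_le_sqrt, hq]; exact_mod_cast Fintype.card_pos
  set E := √q ^ (G.natDegree + s + n) with hE
  have hEn : √q ^ n ≤ E := pow_le_pow_right₀ hq1 (by omega)
  have hE1 : 1 ≤ E := one_le_pow₀ hq1
  obtain ⟨φ, hφ1, hφ⟩ : ∃ φ : RayRing G s → ℂ, (∀ a, ‖φ a‖ ≤ 1) ∧
      ∀ f ∈ monicDeg k n, φ (rayClass G s f) = Φ f := by
    refine ⟨fun a => if h : ∃ f ∈ monicDeg k n, rayClass G s f = a then Φ h.choose else 0,
      fun a => ?_, fun f hf => ?_⟩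
    · dsimp only
      split_ifs
      · exact hΦ _
      · simp
    · have h : ∃ g ∈ monicDeg k n, rayClass G s g = rayClass G s f := ⟨f, hf, rfl⟩
      dsimp only
      rw [dif_pos h]
      obtain ⟨h1, h2⟩ := h.choose_spec
      have hd := (mem_monicDeg.1 h1).2
      obtain ⟨h3, h4⟩ := (rayClass_eq_iff G s (hd.trans (mem_monicDeg.1 hf).2.symm)).1 h2
      rw [hd] at h4
      exact hinv _ h1 _ hf h3 h4
  set c : ℝ := ∏ p ∈ T,
    ((Fintype.card k : ℝ) ^ p.natDegree / ((Fintype.card k : ℝ) ^ p.natDegree - 1)) with hc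
  -- the main term
  have hmain : ∑ f ∈ monicDeg k n, ((∏ p ∈ T, coprimeWt p f : ℝ) : ℂ) * Φ f =
      ((q ^ n / Nat.card (rayGroup G s) : ℝ) : ℂ) * ∑ b with b ∈ rayGroup G s, φ b := by
    rw [card_pow_div_card_rayGroup hG hT s n hn, ← hc]
    have h1 : ∀ f ∈ monicDeg k n, ((∏ p ∈ T, coprimeWt p f : ℝ) : ℂ) * Φ f =
        c * ∑ b with b ∈ rayGroup G s, if rayClass G s f = b then φ b else 0 := by
      intro f hf
      rw [prod_coprimeWt_eq hG hT]
      by_cases h : IsCoprime f G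
      · obtain ⟨u, hu⟩ := (isUnit_rayClass_iff (s := s) (mem_monicDeg.1 hf).1).2 h
        rw [if_pos h, ← hφ f hf, ← hu]
        simp only [Units.val_inj]
        rw [Finset.sum_ite_eq, if_pos]
        simpa using mem_rayGroup_of_monic f (mem_monicDeg.1 hf).1 u hu.symm
      · rw [if_neg h, Finset.sum_eq_zero]
        · simp
        · intro b _
          refine if_neg fun hb => h ?_
          rw [← isUnit_rayClass_iff (s := s) (mem_monicDeg.1 hf).1, hb]
          exact b.isUnit
    rw [Finset.sum_congr rfl h1, ← Finset.mul_sum, Finset.sum_comm]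
    push_cast
    rw [mul_assoc]
    congr 1
    rw [Finset.mul_sum]
    refine Finset.sum_congr rfl fun b hb => ?_
    rw [← Finset.sum_filter, Finset.sum_const,
      card_filter_rayClass_eq hG hn (Finset.mem_filter.1 hb).2, nsmul_eq_mul]
    push_cast
    rfl
  -- the deviation
  have hdev : ‖∑ b : (RayRing G s)ˣ, φ b * classSum (rayClass G s) n b -
      ((q ^ n / Nat.card (rayGroup G s) : ℝ) : ℂ) * ∑ b with b ∈ rayGroup G s, φ b‖ ≤
      (G.natDegree + s : ℕ) * E := by
    refine le_trans ?_ (sum_abs_classDev_le hG s n hn1)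
    have h1 : ∑ b : (RayRing G s)ˣ, φ b * classSum (rayClass G s) n b -
      ((q ^ n / Nat.card (rayGroup G s) : ℝ) : ℂ) * ∑ b with b ∈ rayGroup G s, φ b =
        ∑ b : (RayRing G s)ˣ, φ b * classDev G s n b := by
      rw [Finset.mul_sum, Finset.sum_filter, ← Finset.sum_sub_distrib]
      refine Finset.sum_congr rfl fun b _ => ?_
      rw [classDev, ← hq]
      split_ifs
      · push_cast; ring
      · push_cast; ring
    rw [h1]
    refine (norm_sum_le _ _).trans (Finset.sum_le_sum fun b _ => ?_)
    rw [norm_mul, Complex.norm_real, Real.norm_eq_abs]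
    exact mul_le_of_le_one_left (abs_nonneg _) (hφ1 _)
  -- prime powers
  have hpow : ‖∑ b : (RayRing G s)ˣ, φ b * classSum (rayClass G s) n b -
      ∑ f ∈ monicDeg k n with Irreducible f ∧ IsCoprime f G, (n : ℂ) * Φ f‖ ≤ n * √q ^ n := by
    refine le_trans ?_ (sum_irrDvd_natDegree_ne_le n hn1)
    rw [← sum_irrDvd_eq_sum_classSum, ← Finset.sum_filter_add_sum_filter_not _
      (fun P : k[X] => P.natDegree = n)]
    have h1 : ∑ P ∈ (irrDvd k n).filter (fun P => IsUnit (rayClass G s P ^ (n / P.natDegree))) with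
        P.natDegree = n, (P.natDegree : ℂ) * φ (rayClass G s P ^ (n / P.natDegree)) =
        ∑ f ∈ monicDeg k n with Irreducible f ∧ IsCoprime f G, (n : ℂ) * Φ f := by
      refine Finset.sum_congr ?_ ?_
      · ext P
        simp only [Finset.mem_filter, mem_irrDvd hn1, mem_monicDeg]
        constructor
        · rintro ⟨⟨⟨h1, h2, -⟩, h3⟩, rfl⟩
          rw [Nat.div_self hn1, pow_one, isUnit_rayClass_iff h1] at h3
          exact ⟨⟨h1, rfl⟩, h2, h3⟩
        · rintro ⟨⟨h1, rfl⟩, h2, h3⟩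
          rw [Nat.div_self hn1, pow_one, isUnit_rayClass_iff h1]
          exact ⟨⟨⟨h1, h2, dvd_rfl⟩, h3⟩, rfl⟩
      · intro P hP
        obtain ⟨h1, -⟩ := Finset.mem_filter.1 hP
        rw [← hφ P h1, (mem_monicDeg.1 h1).2, Nat.div_self hn1, pow_one]
    have h2 : ∀ a b u : ℂ, a = u → a + b - u = b := fun a b u h => by rw [h, add_sub_cancel_left]
    rw [h2]
    swap
    · rw [← h1]
      refine Finset.sum_congr ?_ fun _ _ => rfl
      ext
      simp only [Finset.mem_filter]
    refine (norm_sum_le _ _).trans ?_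
    rw [Nat.cast_sum]
    refine (Finset.sum_le_sum (g := fun P => (P.natDegree : ℝ)) fun P _ => ?_).trans
      (Finset.sum_le_sum_of_subset_of_nonneg ?_ fun _ _ _ => Nat.cast_nonneg _)
    · rw [norm_mul, Complex.norm_natCast]
      exact mul_le_of_le_one_right (Nat.cast_nonneg _) (hφ1 _)
    · intro P hP
      simp only [Finset.mem_filter] at hP
      exact Finset.mem_filter.2 ⟨hP.1.1, hP.2⟩
  -- primes dividing `G`
  have hdiv : ‖∑ f ∈ monicDeg k n with Irreducible f ∧ ¬ IsCoprime f G, (n : ℂ) * Φ f‖ ≤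
      G.natDegree := by
    have h1 := sum_natDegree_le_of_dvd hG
      ((monicDeg k n).filter fun f => Irreducible f ∧ ¬ IsCoprime f G) (fun P hP => by
        obtain ⟨h1, h2, h3⟩ := Finset.mem_filter.1 hP
        exact ⟨(mem_monicDeg.1 h1).1, h2, (h2.isCoprime_or_dvd G).resolve_left h3⟩)
    refine le_trans ((norm_sum_le _ _).trans ?_) (Nat.cast_le.2 h1)
    rw [Nat.cast_sum]
    refine Finset.sum_le_sum fun P hP => ?_
    rw [(mem_monicDeg.1 (Finset.mem_filter.1 hP).1).2, norm_mul, Complex.norm_natCast]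
    exact mul_le_of_le_one_right (Nat.cast_nonneg _) (hΦ _)
  have hsplit : ∑ f ∈ monicDeg k n, (if Irreducible f then (n : ℂ) else 0) * Φ f =
      ∑ f ∈ monicDeg k n with Irreducible f ∧ IsCoprime f G, (n : ℂ) * Φ f +
      ∑ f ∈ monicDeg k n with Irreducible f ∧ ¬ IsCoprime f G, (n : ℂ) * Φ f := by
    rw [Finset.sum_filter, Finset.sum_filter, ← Finset.sum_add_distrib]
    refine Finset.sum_congr rfl fun f _ => ?_
    by_cases h1 : Irreducible f <;> by_cases h2 : IsCoprime f G <;> simp [h1, h2]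
  simp only [sub_mul, Finset.sum_sub_distrib]
  rw [hsplit, hmain]
  set a := ∑ b : (RayRing G s)ˣ, φ b * classSum (rayClass G s) n b
  set m := ((q ^ n / Nat.card (rayGroup G s) : ℝ) : ℂ) * ∑ b with b ∈ rayGroup G s, φ b
  set u := ∑ f ∈ monicDeg k n with Irreducible f ∧ IsCoprime f G, (n : ℂ) * Φ f
  set v := ∑ f ∈ monicDeg k n with Irreducible f ∧ ¬ IsCoprime f G, (n : ℂ) * Φ f
  have h1 : ‖u + v - m‖ ≤ ‖a - m‖ + ‖a - u‖ + ‖v‖ := by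
    have : u + v - m = (a - m) - (a - u) + v := by ring
    rw [this]
    exact (norm_add_le _ _).trans (by gcongr; exact norm_sub_le _ _)
  refine h1.trans ((add_le_add (add_le_add hdev hpow) hdiv).trans ?_)
  have h2 : (n : ℝ) * √q ^ n ≤ n * E := mul_le_mul_of_nonneg_left hEn (Nat.cast_nonneg _)
  have h3 : (G.natDegree : ℝ) ≤ (G.natDegree + s) * E := by
    have : (0 : ℝ) ≤ s := Nat.cast_nonneg _
    have : (0 : ℝ) ≤ G.natDegree := Nat.cast_nonneg _
    nlinarith
  push_cast
  linarith

end PrimeSums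

section AllDegrees

variable {k : Type} [Field k] [Fintype k]

open Classical in
lemma sum_polyLT_succ (n : ℕ) (F : k[X] → ℂ) : ∑ x ∈ polyLT k (n + 1), F x =
    ∑ x ∈ polyLT k n, F x + ∑ c : kˣ, ∑ f ∈ monicDeg k n, F (C (c : k) * f) := by
  rw [← Finset.sum_filter_add_sum_filter_not (polyLT k (n + 1)) (fun x => x.degree < n)]
  congr 1
  · refine Finset.sum_congr ?_ fun _ _ => rfl
    ext x
    simp only [Finset.mem_filter, mem_polyLT]
    exact ⟨fun h => h.2, fun h => ⟨h.trans (by exact_mod_cast Nat.lt_succ_self n), h⟩⟩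
  · rw [← Finset.sum_product']
    symm
    have hdeg : ∀ (c : kˣ) (f : k[X]), f ∈ monicDeg k n → (C (c : k) * f).degree = n := by
      intro c f hf
      obtain ⟨h1, h2⟩ := mem_monicDeg.1 hf
      rw [degree_mul, degree_C c.ne_zero, zero_add, degree_eq_natDegree h1.ne_zero, h2]
    refine Finset.sum_bij (fun a _ => C (a.1 : k) * a.2) ?_ ?_ ?_ fun _ _ => rfl
    · rintro ⟨c, f⟩ h
      have hf := (Finset.mem_product.1 h).2
      rw [Finset.mem_filter, mem_polyLT, hdeg c f hf]
      exact ⟨by exact_mod_cast Nat.lt_succ_self n, lt_irrefl _⟩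
    · rintro ⟨c, f⟩ h ⟨c', f'⟩ h' heq
      have hf := (mem_monicDeg.1 (Finset.mem_product.1 h).2).1
      have hf' := (mem_monicDeg.1 (Finset.mem_product.1 h').2).1
      dsimp only at heq hf hf'
      have hc : c = c' := by
        have := congrArg leadingCoeff heq
        rw [leadingCoeff_mul, leadingCoeff_mul, leadingCoeff_C, leadingCoeff_C,
          hf.leadingCoeff, hf'.leadingCoeff, mul_one, mul_one] at this
        exact Units.ext this
      subst hc
      rw [mul_left_cancel₀ (C_ne_zero.2 c.ne_zero) heq]
    · intro x hx
      rw [Finset.mem_filter, mem_polyLT, not_lt] at hx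
      have hx0 : x ≠ 0 := by
        rintro rfl
        simp at hx
      have hxn : x.natDegree = n := by
        have h1 := hx.1
        have h2 := hx.2
        rw [degree_eq_natDegree hx0] at h1 h2
        have h1 : x.natDegree < n + 1 := by exact_mod_cast h1
        have h2 : n ≤ x.natDegree := by exact_mod_cast h2
        omega
      have hl := leadingCoeff_ne_zero.2 hx0
      refine ⟨(Units.mk0 x.leadingCoeff hl, C x.leadingCoeff⁻¹ * x), ?_, ?_⟩
      · refine Finset.mem_product.2 ⟨Finset.mem_univ _, mem_monicDeg.2 ⟨?_, ?_⟩⟩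
        · rw [Monic, leadingCoeff_mul, leadingCoeff_C, inv_mul_cancel₀ hl]
        · rw [natDegree_C_mul (inv_ne_zero hl), hxn]
      · dsimp only [Units.val_mk0]
        rw [← mul_assoc, ← C_mul, mul_inv_cancel₀ hl, C_1, one_mul]

open Classical in
/-- The weight giving an irreducible polynomial its degree. -/
noncomputable def primeWt (x : k[X]) : ℝ := if Irreducible x then (x.natDegree : ℝ) else 0

omit [Fintype k] in
lemma primeWt_nonneg (x : k[X]) : 0 ≤ primeWt x := by
  rw [primeWt]; split_ifs
  · positivity
  · exact le_rfl

omit [Fintype k] in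
lemma primeWt_of_not_irreducible {x : k[X]} (hx : ¬ Irreducible x) : primeWt x = 0 := if_neg hx

omit [Fintype k] in
lemma isUnit_C_unit (c : kˣ) : IsUnit (C (c : k)) := isUnit_C.2 c.isUnit

omit [Fintype k] in
lemma primeWt_C_mul (c : kˣ) (x : k[X]) : primeWt (C (c : k) * x) = primeWt x := by
  have h : Irreducible (C (c : k) * x) ↔ Irreducible x :=
    irreducible_isUnit_mul (isUnit_C_unit c)
  rw [primeWt, primeWt, natDegree_C_mul c.ne_zero]
  by_cases hx : Irreducible x
  · rw [if_pos hx, if_pos (h.2 hx)]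
  · rw [if_neg hx, if_neg (mt h.1 hx)]

lemma coprimeWt_C_mul (p : k[X]) (c : kˣ) (x : k[X]) :
    coprimeWt p (C (c : k) * x) = coprimeWt p x := by
  have h : p ∣ C (c : k) * x ↔ p ∣ x := (isUnit_C_unit c).dvd_mul_left
  by_cases hx : p ∣ x
  · rw [coprimeWt_of_dvd hx, coprimeWt_of_dvd (h.2 hx)]
  · rw [coprimeWt_of_not_dvd hx, coprimeWt_of_not_dvd fun hy => hx (h.1 hy)]

lemma abs_prod_coprimeWt_le {T : Finset k[X]} (hT : ∀ P ∈ T, Irreducible P) (x : k[X]) :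
    |∏ p ∈ T, coprimeWt p x| ≤ 2 ^ T.card := by
  rw [abs_of_nonneg (Finset.prod_nonneg fun p hp => coprimeWt_nonneg (hT p hp) x)]
  rw [← Finset.prod_const]
  exact Finset.prod_le_prod (fun p hp => coprimeWt_nonneg (hT p hp) x)
    fun p hp => coprimeWt_le_two (hT p hp) x

lemma sum_primeWt_monicDeg_le {n : ℕ} (hn : 1 ≤ n) :
    ∑ f ∈ monicDeg k n, primeWt f ≤ (Fintype.card k : ℝ) ^ n := by
  classical
  have h := sum_irrDvd_natDegree (k := k) n hn
  have h1 : ((∑ P ∈ irrDvd k n, P.natDegree : ℕ) : ℝ) = (Fintype.card k : ℝ) ^ n := by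
    rw [h]; push_cast; rfl
  rw [← h1, Nat.cast_sum]
  have h2 : ∑ f ∈ monicDeg k n, primeWt f =
      ∑ f ∈ monicDeg k n with Irreducible f, (f.natDegree : ℝ) := by
    rw [Finset.sum_filter]
    exact Finset.sum_congr rfl fun f _ => by rw [primeWt]
  rw [h2]
  refine Finset.sum_le_sum_of_subset_of_nonneg (fun f hf => ?_) fun _ _ _ => Nat.cast_nonneg _
  obtain ⟨h3, h4⟩ := Finset.mem_filter.1 hf
  obtain ⟨h5, h6⟩ := mem_monicDeg.1 h3
  exact (mem_irrDvd hn).2 ⟨h5, h4, h6 ▸ dvd_rfl⟩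

lemma norm_sum_monicDeg_primeWt_sub_le {G : k[X]} (hG : G.Monic) {T : Finset k[X]}
    (hT : ∀ P, P ∈ T ↔ P.Monic ∧ Irreducible P ∧ P ∣ G) {s n : ℕ}
    (Φ : k[X] → ℂ) (hΦ : ∀ f, ‖Φ f‖ ≤ 1)
    (hinv : ∀ f ∈ monicDeg k n, ∀ g ∈ monicDeg k n, G ∣ f - g → (f - g).degree < (n - s : ℕ) →
      Φ f = Φ g) :
    ‖∑ f ∈ monicDeg k n, ((primeWt f - ∏ p ∈ T, coprimeWt p f : ℝ) : ℂ) * Φ f‖ ≤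
      (2 * (G.natDegree + s) + n + 1 + 2 ^ T.card) *
        √(Fintype.card k : ℝ) ^ (G.natDegree + s + n) := by
  classical
  have hE : (0 : ℝ) ≤ √(Fintype.card k : ℝ) ^ (G.natDegree + s + n) := by positivity
  by_cases hcase : 1 ≤ n ∧ G.natDegree + s ≤ n
  · have h := norm_sum_prime_sub_le hG hT hcase.1 hcase.2 Φ hΦ hinv
    have h1 : ∑ f ∈ monicDeg k n, ((primeWt f - ∏ p ∈ T, coprimeWt p f : ℝ) : ℂ) * Φ f =
        ∑ f ∈ monicDeg k n, ((if Irreducible f then (n : ℂ) else 0) -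
          (∏ p ∈ T, coprimeWt p f : ℝ)) * Φ f := by
      refine Finset.sum_congr rfl fun f hf => ?_
      rw [primeWt, (mem_monicDeg.1 hf).2]
      split_ifs <;> push_cast <;> rfl
    rw [h1]
    refine le_trans (le_of_eq_of_le ?_ h) (mul_le_mul_of_nonneg_right ?_ hE)
    · congr 1
    · have : (0 : ℝ) ≤ 2 ^ T.card := by positivity
      linarith
  · have hθ : ∑ f ∈ monicDeg k n, primeWt f ≤ (Fintype.card k : ℝ) ^ n := by
      rcases Nat.eq_zero_or_pos n with rfl | hn
      · rw [Finset.sum_eq_zero fun f hf => ?_]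
        · positivity
        · rw [primeWt, (mem_monicDeg.1 hf).2]
          simp
      · exact sum_primeWt_monicDeg_le hn
    have hq : (Fintype.card k : ℝ) ^ n ≤ √(Fintype.card k : ℝ) ^ (G.natDegree + s + n) := by
      refine card_pow_half_le ?_
      omega
    calc ‖∑ f ∈ monicDeg k n, ((primeWt f - ∏ p ∈ T, coprimeWt p f : ℝ) : ℂ) * Φ f‖
        ≤ ∑ f ∈ monicDeg k n, (primeWt f + 2 ^ T.card) := by
          refine (norm_sum_le _ _).trans (Finset.sum_le_sum fun f _ => ?_)
          rw [norm_mul, Complex.norm_real, Real.norm_eq_abs]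
          refine (mul_le_of_le_one_right (abs_nonneg _) (hΦ f)).trans ((abs_sub _ _).trans ?_)
          rw [abs_of_nonneg (primeWt_nonneg f)]
          gcongr
          exact abs_prod_coprimeWt_le (fun P hP => ((hT P).1 hP).2.1) f
      _ ≤ (1 + 2 ^ T.card) * (Fintype.card k : ℝ) ^ n := by
          rw [Finset.sum_add_distrib, Finset.sum_const, card_monicDeg, nsmul_eq_mul]
          push_cast
          linarith
      _ ≤ _ := by
          refine mul_le_mul ?_ hq (by positivity) (by positivity)
          have : (0 : ℝ) ≤ 2 * (G.natDegree + s) + n := by positivity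
          linarith

lemma norm_sum_primeWt_sub_le {G : k[X]} (hG : G.Monic) {T : Finset k[X]}
    (hT : ∀ P, P ∈ T ↔ P.Monic ∧ Irreducible P ∧ P ∣ G) {s N : ℕ}
    (Φ : k[X] → ℂ) (hΦ : ∀ f, ‖Φ f‖ ≤ 1)
    (hinv : ∀ f ∈ polyLT k (N + 1), ∀ g ∈ polyLT k (N + 1), G ∣ f - g →
      (f - g).degree < (N + 1 - s : ℕ) → Φ f = Φ g) :
    ‖∑ f ∈ polyLT k (N + 1), ((primeWt f - ∏ p ∈ T, coprimeWt p f : ℝ) : ℂ) * Φ f‖ ≤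
      Fintype.card k * (N + 1) * (2 * (G.natDegree + s) + N + 1 + 2 ^ T.card) *
        √(Fintype.card k : ℝ) ^ (G.natDegree + s + N) := by
  classical
  set F : k[X] → ℂ := fun f => ((primeWt f - ∏ p ∈ T, coprimeWt p f : ℝ) : ℂ) * Φ f with hF
  set q : ℝ := ((Fintype.card k : ℕ) : ℝ) with hq
  have hq1 : 1 ≤ q := by rw [hq]; exact_mod_cast Fintype.card_pos (α := k)
  have hsq1 : 1 ≤ √q := Real.one_le_sqrt.2 hq1
  set B := (2 * (G.natDegree + s) + N + 1 + 2 ^ T.card) * √q ^ (G.natDegree + s + N) with hB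
  have hB0 : 0 ≤ B := by positivity
  have hunits : (Fintype.card kˣ : ℝ) = q - 1 := by
    rw [Fintype.card_units, Nat.cast_sub Fintype.card_pos, Nat.cast_one]
  have key : ∀ n, n ≤ N + 1 → ‖∑ f ∈ polyLT k n, F f‖ ≤ B + n * ((q - 1) * B) := by
    intro n
    induction n with
    | zero =>
      intro _
      have h0 : polyLT k 0 = {0} := by
        ext x
        rw [mem_polyLT, Finset.mem_singleton, Nat.cast_zero, ← not_le, zero_le_degree_iff, not_not]
      rw [h0, Finset.sum_singleton, hF]
      dsimp only
      rw [primeWt_of_not_irreducible not_irreducible_zero, zero_sub, norm_mul, Complex.norm_real,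
        norm_neg, Real.norm_eq_abs]
      have h1 := abs_prod_coprimeWt_le (T := T) (fun P hP => ((hT P).1 hP).2.1) 0
      have h2 : (2 : ℝ) ^ T.card ≤ B := by
        have h3 : (1 : ℝ) ≤ √q ^ (G.natDegree + s + N) := one_le_pow₀ hsq1
        have h4 : (0 : ℝ) ≤ 2 * (G.natDegree + s) + N + 1 := by positivity
        have h5 : (0 : ℝ) ≤ 2 ^ T.card := by positivity
        nlinarith
      have h3 := mul_le_of_le_one_right (abs_nonneg (∏ p ∈ T, coprimeWt p (0 : k[X]))) (hΦ 0)
      push_cast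
      linarith
    | succ n ih =>
      intro hn
      have h1 : ∀ c : kˣ, ‖∑ f ∈ monicDeg k n, F (C (c : k) * f)‖ ≤ B := by
        intro c
        have hmem : ∀ f ∈ monicDeg k n, C (c : k) * f ∈ polyLT k (N + 1) := by
          intro f hf
          obtain ⟨h1, h2⟩ := mem_monicDeg.1 hf
          rw [mem_polyLT, degree_mul, degree_C c.ne_zero, zero_add,
            degree_eq_natDegree h1.ne_zero, h2]
          exact_mod_cast hn
        have h2 := norm_sum_monicDeg_primeWt_sub_le hG hT (s := s) (n := n)
          (fun f => Φ (C (c : k) * f)) (fun f => hΦ _) (fun f hf g hg hfg hd => by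
            refine hinv _ (hmem f hf) _ (hmem g hg) ?_ ?_
            · rw [← mul_sub]; exact hfg.mul_left _
            · rw [← mul_sub, degree_mul, degree_C c.ne_zero, zero_add]
              exact hd.trans_le (by exact_mod_cast (by omega)))
        have h3 : ∀ f, F (C (c : k) * f) =
            ((primeWt f - ∏ p ∈ T, coprimeWt p f : ℝ) : ℂ) * Φ (C (c : k) * f) := by
          intro f
          simp only [hF, primeWt_C_mul, coprimeWt_C_mul]
        simp only [h3]
        refine h2.trans ?_
        have hnN : (n : ℝ) ≤ N := by exact_mod_cast (by omega : n ≤ N)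
        refine mul_le_mul (by linarith) (pow_le_pow_right₀ hsq1 (by omega)) (by positivity)
          (by positivity)
      rw [sum_polyLT_succ]
      refine (norm_add_le _ _).trans ?_
      have h2 := ih (by omega)
      have h3 : ‖∑ c : kˣ, ∑ f ∈ monicDeg k n, F (C (c : k) * f)‖ ≤ (q - 1) * B := by
        rw [← hunits, ← nsmul_eq_mul]
        exact (norm_sum_le _ _).trans (Finset.sum_le_card_nsmul _ _ _ fun c _ => h1 c)
      push_cast
      linarith
  refine (key (N + 1) le_rfl).trans ?_
  have : B + (N + 1 : ℕ) * ((q - 1) * B) ≤ q * (N + 1) * B := by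
    push_cast
    have : (0 : ℝ) ≤ N * B := by positivity
    nlinarith
  refine this.trans (le_of_eq ?_)
  rw [hB]; ring

end AllDegrees

section LocalWeights

variable {k : Type} [Field k] [Fintype k]

omit [Fintype k] in
open Classical in
/-- The indicator function of the residue class of `a` modulo `p`. -/
noncomputable def residueInd (p a x : k[X]) : ℝ := if p ∣ x - a then 1 else 0

omit [Fintype k] in
lemma residueInd_congr {p a x y : k[X]} (h : p ∣ x - y) : residueInd p a x = residueInd p a y := by
  have hiff : p ∣ x - a ↔ p ∣ y - a := dvd_iff_dvd_of_dvd_sub (by rwa [sub_sub_sub_cancel_right])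
  by_cases hx : p ∣ x - a
  · rw [residueInd, residueInd, if_pos hx, if_pos (hiff.1 hx)]
  · rw [residueInd, residueInd, if_neg hx, if_neg (mt hiff.2 hx)]

omit [Fintype k] in
lemma residueInd_nonneg (p a x : k[X]) : 0 ≤ residueInd p a x := by
  rw [residueInd]; split_ifs <;> norm_num

omit [Fintype k] in
lemma residueInd_le_one (p a x : k[X]) : residueInd p a x ≤ 1 := by
  rw [residueInd]; split_ifs <;> norm_num

lemma sum_polyLT_residueInd {p : k[X]} (hp : p.Monic) (a : k[X]) :
    ∑ r ∈ polyLT k p.natDegree, residueInd p a r = 1 := by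
  have hmod : a %ₘ p ∈ polyLT k p.natDegree := by
    rw [mem_polyLT, ← degree_eq_natDegree hp.ne_zero]
    exact degree_modByMonic_lt a hp
  have hd : p ∣ a %ₘ p - a := by
    rw [modByMonic_eq_sub_mul_div a p]
    exact ⟨-(a /ₘ p), by ring⟩
  rw [Finset.sum_eq_single_of_mem _ hmod, residueInd, if_pos hd]
  intro r hr hne
  refine if_neg fun h => hne (sub_eq_zero.1 ?_)
  have h1 : p ∣ r - a %ₘ p := by simpa using dvd_sub h hd
  refine eq_zero_of_dvd_of_degree_lt h1 ?_
  rw [mem_polyLT, ← degree_eq_natDegree hp.ne_zero] at hr hmod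
  exact (degree_sub_le _ _).trans_lt (max_lt hr hmod)

variable (k) in
omit [Fintype k] in
open Classical in
/-- The factor accounting for `1 = -1` in characteristic two. -/
noncomputable def signFactor : ℝ := if (2 : k) = 0 then 1 / 2 else 1

omit [Fintype k] in
lemma signFactor_nonneg : 0 ≤ signFactor k := by
  rw [signFactor]; split_ifs <;> norm_num

omit [Fintype k] in
lemma signFactor_le_one : signFactor k ≤ 1 := by
  rw [signFactor]; split_ifs <;> norm_num

omit [Fintype k] in
/-- A positive definite function modulo `p`, of mean `0`, with value `-1` at `-1`. -/
noncomputable def posWt (p x : k[X]) : ℝ :=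
  signFactor k * (2 * residueInd p 0 x - residueInd p 1 x - residueInd p (-1) x)

/-- The normalized indicator function of `p ∤ 1 + x`, minus its mean. -/
noncomputable def unitWt (p x : k[X]) : ℝ := coprimeWt p (1 + x) - 1

omit [Fintype k] in
lemma posWt_congr {p x y : k[X]} (h : p ∣ x - y) : posWt p x = posWt p y := by
  rw [posWt, posWt, residueInd_congr (a := 0) h, residueInd_congr (a := 1) h,
    residueInd_congr (a := -1) h]

lemma unitWt_congr {p x y : k[X]} (h : p ∣ x - y) : unitWt p x = unitWt p y := by
  rw [unitWt, unitWt, coprimeWt_congr (x := 1 + x) (y := 1 + y) (by rwa [add_sub_add_left_eq_sub])]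

lemma unitWt_eq {p : k[X]} (hpi : Irreducible p) (x : k[X]) :
    unitWt p x = (1 - (Fintype.card k : ℝ) ^ p.natDegree * residueInd p (-1) x) /
      ((Fintype.card k : ℝ) ^ p.natDegree - 1) := by
  have h2 := two_le_card_pow hpi
  have h0 : (Fintype.card k : ℝ) ^ p.natDegree - 1 ≠ 0 := by linarith
  rw [unitWt, residueInd]
  have h : p ∣ 1 + x ↔ p ∣ x - -1 := by rw [sub_neg_eq_add, add_comm]
  by_cases hx : p ∣ 1 + x
  · rw [coprimeWt_of_dvd hx, if_pos (h.1 hx), eq_div_iff h0]; ring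
  · rw [coprimeWt_of_not_dvd hx, if_neg (mt h.2 hx), eq_div_iff h0, sub_mul, div_mul_cancel₀ _ h0]
    ring

lemma abs_unitWt_le {p : k[X]} (hpi : Irreducible p) (x : k[X]) : |unitWt p x| ≤ 1 := by
  rw [unitWt, abs_le]
  constructor <;> linarith [coprimeWt_nonneg hpi (1 + x), coprimeWt_le_two hpi (1 + x)]

omit [Fintype k] in
lemma abs_posWt_le (p x : k[X]) : |posWt p x| ≤
    2 * residueInd p 0 x + residueInd p 1 x + residueInd p (-1) x := by
  have h0 := residueInd_nonneg p 0 x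
  have h1 := residueInd_nonneg p 1 x
  have h2 := residueInd_nonneg p (-1) x
  rw [posWt, abs_mul, abs_of_nonneg signFactor_nonneg]
  refine (mul_le_of_le_one_left (abs_nonneg _) signFactor_le_one).trans ?_
  rw [abs_le]
  constructor <;> linarith

omit [Fintype k] in
lemma posWt_eq_neg_one {p x : k[X]} (hpi : Irreducible p) (h : p ∣ 1 + x) : posWt p x = -1 := by
  have h3 : p ∣ x - -1 := by rwa [sub_neg_eq_add, add_comm]
  have h1 : ¬ p ∣ x - 0 := fun hx => hpi.not_isUnit (isUnit_of_dvd_one (by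
    rw [sub_zero] at hx; simpa using dvd_sub h hx))
  rw [posWt, signFactor, residueInd, residueInd, residueInd, if_neg h1, if_pos h3]
  by_cases h2 : (2 : k) = 0
  · have h4 : p ∣ x - 1 := by
      have : x - 1 = 1 + x - C (2 : k) := by rw [map_ofNat]; ring
      rw [this, h2, C_0, sub_zero]; exact h
    rw [if_pos h2, if_pos h4]; norm_num
  · have h4 : ¬ p ∣ x - 1 := fun hx => by
      have h5 : p ∣ C (2 : k) := by
        have : C (2 : k) = (1 + x) - (x - 1) := by rw [map_ofNat]; ring
        rw [this]; exact dvd_sub h hx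
      exact hpi.not_isUnit (isUnit_of_dvd_unit h5 (isUnit_C.2 (Ne.isUnit h2)))
    rw [if_neg h2, if_neg h4]; norm_num

lemma coprimeWt_mul_posWt_sub {p : k[X]} (hpi : Irreducible p) (x : k[X]) :
    coprimeWt p (1 + x) * ((posWt p x - unitWt p x) *
      (((Fintype.card k : ℝ) ^ p.natDegree - 1) / (Fintype.card k : ℝ) ^ p.natDegree)) =
        posWt p x - unitWt p x := by
  have h2 := two_le_card_pow hpi
  have h0 : (Fintype.card k : ℝ) ^ p.natDegree - 1 ≠ 0 := by linarith
  have h1 : (Fintype.card k : ℝ) ^ p.natDegree ≠ 0 := by linarith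
  by_cases hx : p ∣ 1 + x
  · rw [posWt_eq_neg_one hpi hx, unitWt, coprimeWt_of_dvd hx]; ring
  · rw [coprimeWt_of_not_dvd hx]; field_simp

lemma sum_polyLT_posWt {p : k[X]} (hp : p.Monic) : ∑ r ∈ polyLT k p.natDegree, posWt p r = 0 := by
  simp only [posWt]
  rw [← Finset.mul_sum, Finset.sum_sub_distrib, Finset.sum_sub_distrib, ← Finset.mul_sum,
    sum_polyLT_residueInd hp, sum_polyLT_residueInd hp, sum_polyLT_residueInd hp]
  norm_num

lemma sum_polyLT_unitWt {p : k[X]} (hp : p.Monic) (hpi : Irreducible p) :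
    ∑ r ∈ polyLT k p.natDegree, unitWt p r = 0 := by
  simp only [unitWt_eq hpi]
  rw [← Finset.sum_div, Finset.sum_sub_distrib, ← Finset.mul_sum, sum_polyLT_residueInd hp,
    Finset.sum_const, card_polyLT]
  simp

lemma sum_polyLT_abs_unitWt_le {p : k[X]} (hp : p.Monic) (hpi : Irreducible p) :
    ∑ r ∈ polyLT k p.natDegree, |unitWt p r| ≤ 4 := by
  have h2 := two_le_card_pow hpi
  set n := (Fintype.card k : ℝ) ^ p.natDegree with hn
  have h1 : ∀ r, |unitWt p r| ≤ (1 + n * residueInd p (-1) r) / (n - 1) := by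
    intro r
    have := residueInd_nonneg p (-1) r
    rw [unitWt_eq hpi, ← hn, abs_div, abs_of_pos (by linarith : 0 < n - 1)]
    refine div_le_div_of_nonneg_right ?_ (by linarith)
    have : 0 ≤ n * residueInd p (-1) r := mul_nonneg (by linarith) this
    rw [abs_le]; constructor <;> linarith
  refine (Finset.sum_le_sum fun r _ => h1 r).trans ?_
  rw [← Finset.sum_div, Finset.sum_add_distrib, ← Finset.mul_sum, sum_polyLT_residueInd hp,
    Finset.sum_const, card_polyLT, div_le_iff₀ (by linarith), nsmul_eq_mul]
  push_cast
  rw [← hn]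
  linarith

lemma sum_polyLT_abs_posWt_sub_le {p : k[X]} (hp : p.Monic) (hpi : Irreducible p) :
    ∑ r ∈ polyLT k p.natDegree, |posWt p r - unitWt p r| ≤ 8 := by
  have h1 : ∀ r, |posWt p r - unitWt p r| ≤
      2 * residueInd p 0 r + residueInd p 1 r + residueInd p (-1) r + |unitWt p r| :=
    fun r => (abs_sub _ _).trans (add_le_add (abs_posWt_le p r) le_rfl)
  refine (Finset.sum_le_sum fun r _ => h1 r).trans ?_
  rw [Finset.sum_add_distrib, Finset.sum_add_distrib, Finset.sum_add_distrib, ← Finset.mul_sum,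
    sum_polyLT_residueInd hp, sum_polyLT_residueInd hp, sum_polyLT_residueInd hp]
  linarith [sum_polyLT_abs_unitWt_le hp hpi]

lemma abs_posWt_sub_mul_le {p : k[X]} (hpi : Irreducible p) (x : k[X]) :
    |(posWt p x - unitWt p x) *
      (((Fintype.card k : ℝ) ^ p.natDegree - 1) / (Fintype.card k : ℝ) ^ p.natDegree)| ≤ 5 := by
  have h2 := two_le_card_pow hpi
  rw [abs_mul]
  have h3 :
      |((Fintype.card k : ℝ) ^ p.natDegree - 1) / (Fintype.card k : ℝ) ^ p.natDegree| ≤ 1 := by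
    rw [abs_of_nonneg (div_nonneg (by linarith) (by linarith)), div_le_one (by linarith)]
    linarith
  refine (mul_le_of_le_one_right (abs_nonneg _) h3).trans ((abs_sub _ _).trans ?_)
  linarith [abs_posWt_le p x, abs_unitWt_le hpi x, residueInd_le_one p 0 x,
    residueInd_le_one p 1 x, residueInd_le_one p (-1) x]

/-- The Chinese remainder theorem in the form of independence modulo distinct primes. -/
lemma sum_polyLT_prod (T : Finset k[X]) (hT : ∀ P ∈ T, P.Monic ∧ Irreducible P)
    (τ : k[X] → k[X] → ℝ) (hτ : ∀ P ∈ T, ∀ x y, P ∣ x - y → τ P x = τ P y)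
    (n : ℕ) (hn : ∑ P ∈ T, P.natDegree ≤ n) :
    (Fintype.card k : ℝ) ^ (∑ P ∈ T, P.natDegree) * ∑ x ∈ polyLT k n, ∏ p ∈ T, τ p x =
      (∏ p ∈ T, ∑ r ∈ polyLT k p.natDegree, τ p r) * (Fintype.card k : ℝ) ^ n := by
  classical
  induction T using Finset.induction_on with
  | empty => simp [card_polyLT]
  | insert p T hpT ih =>
    rw [Finset.sum_insert hpT] at hn
    have hT' : ∀ P ∈ T, P.Monic ∧ Irreducible P := fun P hP => hT P (Finset.mem_insert_of_mem hP)
    have hτ' := fun P hP => hτ P (Finset.mem_insert_of_mem hP)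
    obtain ⟨hp, hpi⟩ := hT p (Finset.mem_insert_self _ _)
    have hdeg : (∏ P ∈ T, P).natDegree = ∑ P ∈ T, P.natDegree :=
      natDegree_prod_of_monic _ _ fun P hP => (hT' P hP).1
    have hne : (∏ P ∈ T, P) ≠ 0 := (monic_prod_of_monic _ _ fun P hP => (hT' P hP).1).ne_zero
    have key := sum_mul_of_translate (polyLT k n) (h := ∏ P ∈ T, P) hp hpi
      (not_dvd_prod_of_notMem hT' hp hpi hpT) (fun x hx z hz => by
        rw [mem_polyLT] at hx ⊢
        have hd : ((∏ P ∈ T, P) * z).degree < n := by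
          rw [degree_mul_lt_iff hne, hdeg]
          exact hz.trans_le (Nat.cast_le.2 (by omega))
        exact (degree_add_le _ _).trans_lt (max_lt hx hd))
      (F := fun f => ((∏ p ∈ T, τ p f : ℝ) : ℂ)) (τ := fun f => (τ p f : ℂ))
      (fun x hx z hz => by
        refine congrArg _ (Finset.prod_congr rfl fun P hP => hτ' P hP _ _ ?_)
        rw [add_sub_cancel_left]
        exact (Finset.dvd_prod_of_mem _ hP).mul_right z)
      (fun x y hxy => congrArg _ (hτ p (Finset.mem_insert_self _ _) _ _ hxy))
    rw [← Complex.ofReal_sum, ← Complex.ofReal_sum] at key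
    have key' : (Fintype.card k : ℝ) ^ p.natDegree * ∑ x ∈ polyLT k n, (∏ P ∈ T, τ P x) * τ p x =
        (∑ r ∈ polyLT k p.natDegree, τ p r) * ∑ x ∈ polyLT k n, ∏ P ∈ T, τ P x := by
      exact_mod_cast key
    simp only [Finset.prod_insert hpT, Finset.sum_insert hpT, mul_comm (τ p _), pow_add]
    rw [mul_comm (_ ^ p.natDegree), mul_assoc, key', mul_left_comm, ih hT' hτ' (by omega)]
    ring

lemma sum_polyLT_prod_abs_le (T : Finset k[X]) (hT : ∀ P ∈ T, P.Monic ∧ Irreducible P)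
    (τ : k[X] → k[X] → ℝ) (hτ : ∀ P ∈ T, ∀ x y, P ∣ x - y → τ P x = τ P y) {c : ℝ}
    (hc : ∀ P ∈ T, ∑ r ∈ polyLT k P.natDegree, |τ P r| ≤ c)
    (n : ℕ) (hn : ∑ P ∈ T, P.natDegree ≤ n) :
    ∑ x ∈ polyLT k n, |∏ p ∈ T, τ p x| ≤
      c ^ T.card * (Fintype.card k : ℝ) ^ (n - ∑ P ∈ T, P.natDegree) := by
  have h1 := sum_polyLT_prod T hT (fun p x => |τ p x|) (fun P hP x y h => by
    rw [hτ P hP x y h]) n hn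
  have hq : (0 : ℝ) < (Fintype.card k : ℝ) ^ (∑ P ∈ T, P.natDegree) :=
    pow_pos (by exact_mod_cast Fintype.card_pos) _
  refine le_of_mul_le_mul_left ?_ hq
  simp only [Finset.abs_prod]
  rw [h1, mul_left_comm, ← pow_add, Nat.add_sub_cancel' hn, ← Finset.prod_const]
  exact mul_le_mul_of_nonneg_right (Finset.prod_le_prod
    (fun p _ => Finset.sum_nonneg fun _ _ => abs_nonneg _) hc) (by positivity)

end LocalWeights

section Positivity

variable {k : Type} [Field k] [Fintype k]

omit [Fintype k] in
/-- The cone of functions spanned by the additive characters. -/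
inductive PosChar : (k[X] → ℂ) → Prop
  | zero : PosChar 0
  | char (c : ℝ) (hc : 0 ≤ c) (χ : AddChar k[X] ℂ) : PosChar fun x => c * χ x
  | add (F G : k[X] → ℂ) : PosChar F → PosChar G → PosChar (F + G)

omit [Fintype k] in
lemma PosChar.mul {F G : k[X] → ℂ} (hF : PosChar F) (hG : PosChar G) : PosChar (F * G) := by
  induction hF with
  | zero => rw [zero_mul]; exact .zero
  | add F₁ F₂ _ _ h1 h2 => rw [add_mul]; exact .add _ _ h1 h2
  | char c hc χ =>
    induction hG with
    | zero => rw [mul_zero]; exact .zero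
    | add F₁ F₂ _ _ h1 h2 => rw [mul_add]; exact .add _ _ h1 h2
    | char d hd ψ =>
      convert PosChar.char (c * d) (mul_nonneg hc hd) (χ * ψ) using 1
      funext x
      rw [Pi.mul_apply, AddChar.mul_apply]
      push_cast
      ring

omit [Fintype k] in
lemma PosChar.addChar (χ : AddChar k[X] ℂ) : PosChar (χ : k[X] → ℂ) := by
  convert PosChar.char 1 zero_le_one χ using 1
  funext x
  simp

omit [Fintype k] in
lemma PosChar.sum {ι : Type*} (s : Finset ι) (F : ι → k[X] → ℂ) (h : ∀ i ∈ s, PosChar (F i)) :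
    PosChar (∑ i ∈ s, F i) :=
  Finset.sum_induction _ _ PosChar.add .zero h

omit [Fintype k] in
lemma PosChar.prod {ι : Type*} (s : Finset ι) (F : ι → k[X] → ℂ) (h : ∀ i ∈ s, PosChar (F i)) :
    PosChar (∏ i ∈ s, F i) :=
  Finset.prod_induction _ _ (fun _ _ => PosChar.mul) (PosChar.addChar 1) h

lemma sum_polyLT_eq_zero {n : ℕ} {F : k[X] → ℂ} {z : k[X]} (hz : z.degree < n) {c : ℂ} (hc : c ≠ 1)
    (hF : ∀ x, F (x + z) = c * F x) : ∑ x ∈ polyLT k n, F x = 0 := by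
  have h : ∑ x ∈ polyLT k n, F x = c * ∑ x ∈ polyLT k n, F x := by
    rw [Finset.mul_sum]
    symm
    have hadd : ∀ x ∈ polyLT k n, ∀ z : k[X], z.degree < n → x + z ∈ polyLT k n := by
      intro x hx z hz
      rw [mem_polyLT] at hx ⊢
      exact (degree_add_le _ _).trans_lt (max_lt hx hz)
    exact Finset.sum_bij (fun x _ => x + z) (fun x hx => hadd x hx z hz)
      (fun x _ y _ he => add_right_cancel he)
      (fun x hx => ⟨x + -z, hadd x hx _ (by rwa [degree_neg]), by ring⟩)
      (fun x _ => (hF x).symm)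
  have h2 : (1 - c) * ∑ x ∈ polyLT k n, F x = 0 := by rw [sub_mul, one_mul, ← h, sub_self]
  exact (mul_eq_zero.1 h2).resolve_left (sub_ne_zero.2 hc.symm)

lemma PosChar.sum_polyLT_re_nonneg {F : k[X] → ℂ} (hF : PosChar F) (n : ℕ) :
    0 ≤ (∑ x ∈ polyLT k n, F x).re := by
  induction hF with
  | zero => simp
  | add F₁ F₂ _ _ h1 h2 =>
    simp only [Pi.add_apply, Finset.sum_add_distrib, Complex.add_re]
    exact add_nonneg h1 h2
  | char c hc χ =>
    rw [← Finset.mul_sum, Complex.re_ofReal_mul]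
    refine mul_nonneg hc ?_
    by_cases h : ∀ x ∈ polyLT k n, χ x = 1
    · rw [Finset.sum_congr rfl h]
      simp
    · push Not at h
      obtain ⟨z, hz, hz1⟩ := h
      rw [sum_polyLT_eq_zero (mem_polyLT.1 hz) hz1 fun x => by
        rw [AddChar.map_add_eq_mul, mul_comm]]
      simp

lemma posChar_posWt {p : k[X]} (hp : p.Monic) : PosChar fun x => (posWt p x : ℂ) := by
  classical
  have := hp.finite_adjoinRoot
  have : Finite (AdjoinRoot p) := Module.finite_of_finite k
  have := Fintype.ofFinite (AdjoinRoot p)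
  set n : ℝ := ((Fintype.card (AdjoinRoot p) : ℕ) : ℝ) with hn
  have hn0 : n ≠ 0 := by
    rw [hn]; exact_mod_cast Fintype.card_ne_zero
  have hind : ∀ a x : k[X], (residueInd p a x : ℂ) =
      ∑ χ : AddChar (AdjoinRoot p) ℂ, (n⁻¹ : ℝ) * χ (AdjoinRoot.mk p (x - a)) := by
    intro a x
    rw [← Finset.mul_sum, AddChar.sum_apply_eq_ite, residueInd]
    have h : AdjoinRoot.mk p (x - a) = 0 ↔ p ∣ x - a := AdjoinRoot.mk_eq_zero
    by_cases hx : p ∣ x - a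
    · rw [if_pos hx, if_pos (h.2 hx)]
      have : ((n : ℝ) : ℂ) ≠ 0 := by exact_mod_cast hn0
      rw [← Complex.ofReal_natCast, ← hn, Complex.ofReal_inv, inv_mul_cancel₀ this,
        Complex.ofReal_one]
    · rw [if_neg hx, if_neg (mt h.1 hx)]; simp
  let w : AddChar (AdjoinRoot p) ℂ → ℝ := fun χ =>
    signFactor k * n⁻¹ * (2 - 2 * (χ (AdjoinRoot.mk p 1)).re)
  have key : (fun x => (posWt p x : ℂ)) = ∑ χ : AddChar (AdjoinRoot p) ℂ, fun x : k[X] =>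
      (w χ : ℂ) * (χ.compAddMonoidHom (AdjoinRoot.mk p).toAddMonoidHom) x := by
    funext x
    rw [posWt, Finset.sum_apply]
    push_cast
    rw [hind, hind, hind, Finset.mul_sum, ← Finset.sum_sub_distrib, ← Finset.sum_sub_distrib,
      Finset.mul_sum]
    refine Finset.sum_congr rfl fun χ _ => ?_
    have h1 : χ (AdjoinRoot.mk p (x - 1)) =
        χ (AdjoinRoot.mk p x) * (starRingEnd ℂ) (χ (AdjoinRoot.mk p 1)) := by
      rw [sub_eq_add_neg, map_add, map_neg, AddChar.map_add_eq_mul, AddChar.map_neg_eq_conj]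
    have h2 : χ (AdjoinRoot.mk p (x - -1)) =
        χ (AdjoinRoot.mk p x) * χ (AdjoinRoot.mk p 1) := by
      rw [sub_neg_eq_add, map_add, AddChar.map_add_eq_mul]
    have h3 : ((2 * (χ (AdjoinRoot.mk p 1)).re : ℝ) : ℂ) =
        χ (AdjoinRoot.mk p 1) + (starRingEnd ℂ) (χ (AdjoinRoot.mk p 1)) := by
      rw [Complex.add_conj]
    have h4 : (χ ∘ (AdjoinRoot.mk p).toAddMonoidHom) x = χ (AdjoinRoot.mk p x) := rfl
    have h5 : (w χ : ℂ) = signFactor k * (n⁻¹ : ℝ) * (2 - (χ (AdjoinRoot.mk p 1) +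
        (starRingEnd ℂ) (χ (AdjoinRoot.mk p 1)))) := by
      rw [← h3]; push_cast [w]; ring
    rw [h1, h2, h4, h5, sub_zero]
    push_cast
    ring
  rw [key]
  refine PosChar.sum _ _ fun χ _ => PosChar.char _ ?_ _
  have h1 : (χ (AdjoinRoot.mk p 1)).re ≤ 1 :=
    (Complex.re_le_norm _).trans (AddChar.norm_apply χ _).le
  refine mul_nonneg (mul_nonneg signFactor_nonneg (inv_nonneg.2 (Nat.cast_nonneg _))) ?_
  linarith

lemma sum_polyLT_prod_posWt_re_nonneg {T : Finset k[X]} (hT : ∀ P ∈ T, P.Monic)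
    (χ : AddChar k[X] ℂ) (n : ℕ) :
    0 ≤ (∑ x ∈ polyLT k n, ((∏ p ∈ T, posWt p x : ℝ) : ℂ) * χ x).re := by
  have h : PosChar ((∏ p ∈ T, fun x => (posWt p x : ℂ)) * (χ : k[X] → ℂ)) :=
    (PosChar.prod _ _ fun p hp => posChar_posWt (hT p hp)).mul (PosChar.addChar χ)
  convert h.sum_polyLT_re_nonneg n using 4 with x
  rw [Pi.mul_apply, Finset.prod_apply]
  push_cast
  rfl

variable (k) in
lemma norm_addChar_apply (χ : AddChar k[X] ℂ) (x : k[X]) : ‖χ x‖ = 1 := by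
  refine Complex.norm_eq_one_of_pow_eq_one (n := Fintype.card k) ?_ Fintype.card_ne_zero
  rw [← AddChar.map_nsmul_eq_pow]
  have : Fintype.card k • x = 0 := by
    rw [nsmul_eq_mul, ← C_eq_natCast, FiniteField.cast_card_eq_zero, C_0, zero_mul]
  rw [this, AddChar.map_zero_eq_one]

end Positivity

section MainTerm

variable {k : Type} [Field k] [Fintype k]

/-- The weight such that `coprimeWt p (1 + x) * twistWt p x = posWt p x - unitWt p x`. -/
noncomputable def twistWt (p x : k[X]) : ℝ := (posWt p x - unitWt p x) *
  (((Fintype.card k : ℝ) ^ p.natDegree - 1) / (Fintype.card k : ℝ) ^ p.natDegree)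

lemma twistWt_congr {p x y : k[X]} (h : p ∣ x - y) : twistWt p x = twistWt p y := by
  rw [twistWt, twistWt, posWt_congr h, unitWt_congr h]

omit [Fintype k] in
/-- `χ` is trivial on the multiples of `g` of degree less than `m`. -/
def TrivialOn (χ : AddChar k[X] ℂ) (g : k[X]) (m : ℕ) : Prop :=
  ∀ h : k[X], (g * h).degree < m → χ (g * h) = 1

lemma sum_polyLT_one_add (n : ℕ) (F : k[X] → ℂ) :
    ∑ x ∈ polyLT k (n + 1), F (1 + x) = ∑ x ∈ polyLT k (n + 1), F x := by
  have h1 : (1 : k[X]).degree < (n + 1 : ℕ) := by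
    rw [degree_one]; exact_mod_cast Nat.succ_pos n
  refine Finset.sum_nbij' (fun x => 1 + x) (fun x => x - 1) ?_ ?_ ?_ ?_ fun _ _ => rfl
  · intro x hx
    rw [mem_polyLT] at hx ⊢
    exact (degree_add_le _ _).trans_lt (max_lt h1 hx)
  · intro x hx
    rw [mem_polyLT] at hx ⊢
    exact (degree_sub_le _ _).trans_lt (max_lt hx h1)
  · intro x _; ring
  · intro x _; ring

open Classical in
lemma norm_sum_twist_sub_le {g : k[X]} (hg : g.Monic) {S D : Finset k[X]}
    (hS : ∀ P, P ∈ S ↔ P.Monic ∧ Irreducible P ∧ P ∣ g)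
    (hD : ∀ P ∈ D, P.Monic ∧ Irreducible P) {s N K : ℕ}
    (hK : g.natDegree + ∑ P ∈ D, P.natDegree + s ≤ K) {χ : AddChar k[X] ℂ}
    (hχ : TrivialOn χ g (N + 1 - s)) :
    ‖∑ x ∈ polyLT k (N + 1), ((primeWt (1 + x) * ∏ p ∈ D, twistWt p x -
      (∏ p ∈ S \ D, (1 + unitWt p x)) * ∏ p ∈ D, (posWt p x - unitWt p x) : ℝ) : ℂ) * χ x‖ ≤
      5 ^ D.card * (Fintype.card k * (N + 1) * (2 * K + N + 1 + 2 ^ (S ∪ D).card) *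
        √(Fintype.card k : ℝ) ^ (K + N)) := by
  have hDm : (∏ P ∈ D, P).Monic := monic_prod_of_monic _ _ fun P hP => (hD P hP).1
  have hG : (g * ∏ P ∈ D, P).Monic := hg.mul hDm
  have hdeg : (g * ∏ P ∈ D, P).natDegree = g.natDegree + ∑ P ∈ D, P.natDegree := by
    rw [hg.natDegree_mul hDm, natDegree_prod_of_monic _ _ fun P hP => (hD P hP).1]
  have hT : ∀ P, P ∈ S ∪ D ↔ P.Monic ∧ Irreducible P ∧ P ∣ g * ∏ P ∈ D, P := by
    intro P
    rw [Finset.mem_union, hS]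
    constructor
    · rintro (⟨h1, h2, h3⟩ | h)
      · exact ⟨h1, h2, h3.mul_right _⟩
      · exact ⟨(hD P h).1, (hD P h).2, (Finset.dvd_prod_of_mem _ h).mul_left _⟩
    · rintro ⟨h1, h2, h3⟩
      rcases h2.prime.dvd_or_dvd h3 with h | h
      · exact .inl ⟨h1, h2, h⟩
      · refine .inr ?_
        by_contra hP
        exact not_dvd_prod_of_notMem hD h1 h2 hP h
  have h5 : (0 : ℝ) < 5 ^ D.card := by positivity
  have habs : ∀ x, |∏ p ∈ D, twistWt p x| ≤ 5 ^ D.card := by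
    intro x
    rw [Finset.abs_prod, ← Finset.prod_const]
    exact Finset.prod_le_prod (fun _ _ => abs_nonneg _)
      fun p hp => abs_posWt_sub_mul_le (hD p hp).2 x
  have key := norm_sum_primeWt_sub_le hG hT (s := s) (N := N)
    (fun y => (((5 : ℝ) ^ D.card)⁻¹ * ∏ p ∈ D, twistWt p (y - 1) : ℝ) * χ (y - 1))
    (fun y => by
      rw [norm_mul, norm_addChar_apply, mul_one, Complex.norm_real, Real.norm_eq_abs, abs_mul,
        abs_of_pos (inv_pos.2 h5), inv_mul_le_iff₀ h5, mul_one]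
      exact habs _)
    (fun x hx y hy hxy hd => by
      have h1 : χ (x - 1) = χ (y - 1) := by
        obtain ⟨h, hh⟩ := (Dvd.intro _ rfl).trans hxy
        have h2 : x - 1 = (y - 1) + g * h := by rw [← hh]; ring
        rw [h2, AddChar.map_add_eq_mul, hχ h (by rwa [← hh]), mul_one]
      have h2 : ∏ p ∈ D, twistWt p (x - 1) = ∏ p ∈ D, twistWt p (y - 1) := by
        refine Finset.prod_congr rfl fun p hp => twistWt_congr ?_
        rw [sub_sub_sub_cancel_right]
        exact ((Finset.dvd_prod_of_mem _ hp).mul_left _).trans hxy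
      rw [h1, h2])
  rw [← sum_polyLT_one_add] at key
  have hsum : ∑ x ∈ polyLT k (N + 1), ((primeWt (1 + x) * ∏ p ∈ D, twistWt p x -
      (∏ p ∈ S \ D, (1 + unitWt p x)) * ∏ p ∈ D, (posWt p x - unitWt p x) : ℝ) : ℂ) * χ x =
      ((5 : ℝ) ^ D.card : ℝ) * ∑ x ∈ polyLT k (N + 1),
        ((primeWt (1 + x) - ∏ p ∈ S ∪ D, coprimeWt p (1 + x) : ℝ) : ℂ) *
        ((((5 : ℝ) ^ D.card)⁻¹ * ∏ p ∈ D, twistWt p (1 + x - 1) : ℝ) * χ (1 + x - 1)) := by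
    rw [Finset.mul_sum]
    refine Finset.sum_congr rfl fun x _ => ?_
    have h1 : ∏ p ∈ S ∪ D, coprimeWt p (1 + x) = (∏ p ∈ S \ D, (1 + unitWt p x)) *
        ∏ p ∈ D, coprimeWt p (1 + x) := by
      rw [← Finset.sdiff_union_self_eq_union, Finset.prod_union Finset.sdiff_disjoint]
      simp only [unitWt, add_sub_cancel]
    have h2 : (∏ p ∈ D, coprimeWt p (1 + x)) * ∏ p ∈ D, twistWt p x =
        ∏ p ∈ D, (posWt p x - unitWt p x) := by
      rw [← Finset.prod_mul_distrib]
      exact Finset.prod_congr rfl fun p hp => coprimeWt_mul_posWt_sub (hD p hp).2 x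
    rw [h1, ← h2, add_sub_cancel_left, ← mul_assoc, ← mul_assoc, ← Complex.ofReal_mul,
      ← mul_assoc, ← Complex.ofReal_mul]
    congr 2
    field_simp
  rw [hsum, norm_mul, Complex.norm_real, Real.norm_eq_abs, abs_of_pos h5]
  refine mul_le_mul_of_nonneg_left (key.trans ?_) h5.le
  have hq1 : 1 ≤ √(Fintype.card k : ℝ) := by
    rw [Real.one_le_sqrt]; exact_mod_cast Fintype.card_pos
  have hK' : (((g * ∏ P ∈ D, P).natDegree + s : ℕ) : ℝ) ≤ K := by
    exact_mod_cast (by omega)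
  push_cast at hK'
  gcongr
  omega

/-- The contribution to the main term of a pair of sets of primes. -/
noncomputable def localSum (χ : AddChar k[X] ℂ) (n : ℕ) (B D : Finset k[X]) : ℂ :=
  ∑ x ∈ polyLT k n, (((∏ p ∈ B, unitWt p x) * ∏ p ∈ D, (posWt p x - unitWt p x) : ℝ) : ℂ) * χ x

open Classical in
lemma sum_prod_one_add_unitWt (χ : AddChar k[X] ℂ) (n : ℕ) (S D : Finset k[X]) :
    ∑ x ∈ polyLT k n, (((∏ p ∈ S \ D, (1 + unitWt p x)) *
      ∏ p ∈ D, (posWt p x - unitWt p x) : ℝ) : ℂ) * χ x =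
      ∑ B ∈ (S \ D).powerset, localSum χ n B D := by
  simp only [localSum]
  rw [Finset.sum_comm]
  refine Finset.sum_congr rfl fun x _ => ?_
  rw [← Finset.sum_mul, Finset.prod_one_add, ← Complex.ofReal_sum, ← Finset.sum_mul]

open Classical in
lemma localSum_eq_zero_of_not_trivialOn {χ : AddChar k[X] ℂ} {n : ℕ} {B D : Finset k[X]}
    (h : ¬ TrivialOn χ (∏ P ∈ B ∪ D, P) n) : localSum χ n B D = 0 := by
  rw [TrivialOn] at h
  push Not at h
  obtain ⟨z, hz, hz1⟩ := h
  refine sum_polyLT_eq_zero hz hz1 fun x => ?_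
  have hd : ∀ p ∈ B ∪ D, p ∣ x + (∏ P ∈ B ∪ D, P) * z - x := by
    intro p hp
    rw [add_sub_cancel_left]
    exact (Finset.dvd_prod_of_mem _ hp).mul_right z
  have h1 : ∏ p ∈ B, unitWt p (x + (∏ P ∈ B ∪ D, P) * z) = ∏ p ∈ B, unitWt p x :=
    Finset.prod_congr rfl fun p hp => unitWt_congr (hd p (Finset.mem_union_left _ hp))
  have h2 : ∏ p ∈ D, (posWt p (x + (∏ P ∈ B ∪ D, P) * z) - unitWt p (x + (∏ P ∈ B ∪ D, P) * z)) =
      ∏ p ∈ D, (posWt p x - unitWt p x) :=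
    Finset.prod_congr rfl fun p hp => by
      rw [posWt_congr (hd p (Finset.mem_union_right _ hp)),
        unitWt_congr (hd p (Finset.mem_union_right _ hp))]
  rw [h1, h2, AddChar.map_add_eq_mul]
  ring

open Classical in
/-- If `χ` is trivial on the multiples of the product over `E`, only primes in `E` contribute. -/
lemma localSum_eq_zero_of_not_subset {χ : AddChar k[X] ℂ} {n : ℕ} {B D E : Finset k[X]}
    (hE : ∀ P ∈ E, P.Monic ∧ Irreducible P) (hD : ∀ P ∈ D, P.Monic ∧ Irreducible P)
    (hχ : TrivialOn χ (∏ P ∈ E, P) n) (hB : B ⊆ E) (hDE : ¬ D ⊆ E)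
    (hn : ∑ P ∈ E, P.natDegree + ∑ P ∈ D, P.natDegree ≤ n) : localSum χ n B D = 0 := by
  obtain ⟨p, hpD, hpE⟩ := Finset.not_subset.1 hDE
  obtain ⟨hp, hpi⟩ := hD p hpD
  set T := E ∪ D.erase p with hTdef
  have hT : ∀ P ∈ T, P.Monic ∧ Irreducible P := fun P hP =>
    (Finset.mem_union.1 hP).elim (hE P) fun h => hD P (Finset.mem_of_mem_erase h)
  have hpT : p ∉ T := fun h =>
    (Finset.mem_union.1 h).elim hpE (Finset.notMem_erase p D)
  have hTdeg : (∏ P ∈ T, P).natDegree + p.natDegree ≤ n := by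
    rw [natDegree_prod_of_monic _ _ fun P hP => (hT P hP).1]
    have h1 : ∑ P ∈ T, P.natDegree ≤ ∑ P ∈ E, P.natDegree + ∑ P ∈ D.erase p, P.natDegree := by
      rw [hTdef, ← Finset.sum_union_inter]; exact Nat.le_add_right _ _
    have h2 := Finset.sum_erase_add D natDegree hpD
    omega
  have hT0 : (∏ P ∈ T, P) ≠ 0 := (monic_prod_of_monic _ _ fun P hP => (hT P hP).1).ne_zero
  have hlt : ∀ z : k[X], z.degree < p.natDegree → ((∏ P ∈ T, P) * z).degree < n := by
    intro z hz
    rw [degree_mul_lt_iff hT0]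
    exact hz.trans_le (Nat.cast_le.2 (by omega))
  have hdE : (∏ P ∈ E, P) ∣ ∏ P ∈ T, P := Finset.prod_dvd_prod_of_subset _ _ _
    Finset.subset_union_left
  have hχT : ∀ z : k[X], z.degree < p.natDegree → χ ((∏ P ∈ T, P) * z) = 1 := by
    intro z hz
    obtain ⟨c, hc⟩ := hdE
    have := hlt z hz
    rw [hc, mul_assoc] at this ⊢
    exact hχ _ this
  have key := sum_mul_of_translate (polyLT k n) (h := ∏ P ∈ T, P) hp hpi
    (not_dvd_prod_of_notMem hT hp hpi hpT) (fun x hx z hz => by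
      rw [mem_polyLT] at hx ⊢
      exact (degree_add_le _ _).trans_lt (max_lt hx (hlt z hz)))
    (F := fun x => (((∏ p ∈ B, unitWt p x) *
      ∏ p ∈ D.erase p, (posWt p x - unitWt p x) : ℝ) : ℂ) * χ x)
    (τ := fun x => ((posWt p x - unitWt p x : ℝ) : ℂ))
    (fun x hx z hz => by
      have hd : ∀ p ∈ T, p ∣ x + (∏ P ∈ T, P) * z - x := by
        intro p hp
        rw [add_sub_cancel_left]
        exact (Finset.dvd_prod_of_mem _ hp).mul_right z
      rw [AddChar.map_add_eq_mul, hχT z hz, mul_one,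
        Finset.prod_congr rfl fun P hP => unitWt_congr (hd P (Finset.mem_union_left _ (hB hP))),
        Finset.prod_congr (s₂ := D.erase p) rfl fun P hP => by
          rw [posWt_congr (hd P (Finset.mem_union_right _ hP)),
            unitWt_congr (hd P (Finset.mem_union_right _ hP))]])
    (fun x y hxy => by rw [posWt_congr hxy, unitWt_congr hxy])
  rw [← Complex.ofReal_sum, Finset.sum_sub_distrib, sum_polyLT_posWt hp, sum_polyLT_unitWt hp hpi,
    sub_zero, Complex.ofReal_zero, zero_mul] at key
  have hq : (Fintype.card k : ℂ) ^ p.natDegree ≠ 0 := pow_ne_zero _ (by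
    exact_mod_cast Fintype.card_ne_zero)
  rw [← (mul_eq_zero.1 key).resolve_left hq, localSum]
  refine Finset.sum_congr rfl fun x _ => ?_
  rw [← Finset.prod_erase_mul D _ hpD]
  push_cast
  ring

lemma norm_localSum_le {χ : AddChar k[X] ℂ} {n : ℕ} {B D : Finset k[X]} (hBD : Disjoint B D)
    (hB : ∀ P ∈ B, P.Monic ∧ Irreducible P) (hD : ∀ P ∈ D, P.Monic ∧ Irreducible P)
    (hn : ∑ P ∈ B, P.natDegree + ∑ P ∈ D, P.natDegree ≤ n) :
    ‖localSum χ n B D‖ ≤ 8 ^ (B.card + D.card) *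
      (Fintype.card k : ℝ) ^ (n - (∑ P ∈ B, P.natDegree + ∑ P ∈ D, P.natDegree)) := by
  classical
  set τ : k[X] → k[X] → ℝ := fun p x => if p ∈ B then unitWt p x else posWt p x - unitWt p x
    with hτ
  have hT : ∀ P ∈ B ∪ D, P.Monic ∧ Irreducible P := fun P hP =>
    (Finset.mem_union.1 hP).elim (hB P) (hD P)
  have key := sum_polyLT_prod_abs_le (B ∪ D) hT τ (fun P _ x y h => by
      simp only [hτ, unitWt_congr h, posWt_congr h]) (c := 8) (fun P hP => by
      obtain ⟨h1, h2⟩ := hT P hP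
      by_cases h : P ∈ B
      · simp only [hτ, if_pos h]
        linarith [sum_polyLT_abs_unitWt_le h1 h2]
      · simp only [hτ, if_neg h]
        exact sum_polyLT_abs_posWt_sub_le h1 h2) n (by rwa [Finset.sum_union hBD])
  rw [Finset.card_union_of_disjoint hBD, Finset.sum_union hBD] at key
  refine le_trans ((norm_sum_le _ _).trans (Finset.sum_le_sum fun x _ => ?_)) key
  rw [norm_mul, norm_addChar_apply, mul_one, Complex.norm_real, Real.norm_eq_abs,
    Finset.prod_union hBD]
  refine le_of_eq (congrArg _ ?_)
  congr 1
  · exact Finset.prod_congr rfl fun p hp => by simp only [hτ, if_pos hp]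
  · exact Finset.prod_congr rfl fun p hp => by
      simp only [hτ, if_neg (Finset.disjoint_right.1 hBD hp)]

end MainTerm

section SieveWeights

variable {k : Type} [Field k] [Fintype k]

variable (k) in
open Classical in
/-- The sets of primes of total degree at most `Q`. -/
noncomputable def primeSets (Q : ℕ) : Finset (Finset k[X]) :=
  ((polyLT k (Q + 1)).filter fun P => P.Monic ∧ Irreducible P).powerset.filter
    fun D => ∑ P ∈ D, P.natDegree ≤ Q

lemma mem_primeSets {Q : ℕ} {D : Finset k[X]} : D ∈ primeSets k Q ↔
    (∀ P ∈ D, P.Monic ∧ Irreducible P) ∧ ∑ P ∈ D, P.natDegree ≤ Q := by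
  classical
  rw [primeSets, Finset.mem_filter, Finset.mem_powerset]
  refine and_congr_left fun hD => ⟨fun h P hP => (Finset.mem_filter.1 (h hP)).2, fun h P hP => ?_⟩
  refine Finset.mem_filter.2 ⟨?_, h P hP⟩
  have h1 : P.natDegree ≤ ∑ P ∈ D, P.natDegree :=
    Finset.single_le_sum (f := natDegree) (fun _ _ => Nat.zero_le _) hP
  rw [mem_polyLT, degree_eq_natDegree (h P hP).1.ne_zero]
  exact_mod_cast Nat.lt_succ_of_le (h1.trans hD)

omit [Fintype k] in
lemma prod_injOn_primes {D D' : Finset k[X]} (hD : ∀ P ∈ D, P.Monic ∧ Irreducible P)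
    (hD' : ∀ P ∈ D', P.Monic ∧ Irreducible P) (h : ∏ P ∈ D, P = ∏ P ∈ D', P) : D ⊆ D' := by
  intro P hP
  by_contra hn
  refine not_dvd_prod_of_notMem hD' (hD P hP).1 (hD P hP).2 hn ?_
  rw [← h]
  exact Finset.dvd_prod_of_mem _ hP

lemma card_primeSets_le (Q : ℕ) : (primeSets k Q).card ≤ Fintype.card k ^ (Q + 1) := by
  rw [← card_polyLT k (Q + 1)]
  refine Finset.card_le_card_of_injOn (fun D => ∏ P ∈ D, P) (fun D hD => ?_)
    fun D hD D' hD' h => ?_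
  · obtain ⟨h1, h2⟩ := mem_primeSets.1 hD
    have hm : (∏ P ∈ D, P).Monic := monic_prod_of_monic _ _ fun P hP => (h1 P hP).1
    have h3 : (∏ P ∈ D, P).natDegree ≤ Q := by
      rwa [natDegree_prod_of_monic _ _ fun P hP => (h1 P hP).1]
    change _ ∈ polyLT k (Q + 1)
    rw [mem_polyLT, degree_eq_natDegree hm.ne_zero]
    exact_mod_cast Nat.lt_succ_of_le h3
  · have h1 := (mem_primeSets.1 hD).1
    have h2 := (mem_primeSets.1 hD').1
    exact (prod_injOn_primes h1 h2 h).antisymm (prod_injOn_primes h2 h1 h.symm)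

/-- The function used to detect shifted primes. -/
noncomputable def sieveKernel (Q : ℕ) (x : k[X]) : ℝ :=
  primeWt (1 + x) * ∑ D ∈ primeSets k Q, ∏ p ∈ D, twistWt p x

lemma exists_finset_primeFactors {g : k[X]} (hg : g ≠ 0) :
    ∃ S : Finset k[X], ∀ P, P ∈ S ↔ P.Monic ∧ Irreducible P ∧ P ∣ g := by
  classical
  refine ⟨(polyLT k (g.natDegree + 1)).filter fun P => P.Monic ∧ Irreducible P ∧ P ∣ g,
    fun P => ⟨fun h => (Finset.mem_filter.1 h).2, fun h => Finset.mem_filter.2 ⟨?_, h⟩⟩⟩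
  rw [mem_polyLT, degree_eq_natDegree h.1.ne_zero]
  exact_mod_cast Nat.lt_succ_of_le (natDegree_le_of_dvd h.2.2 hg)

open Classical in
/-- The main term. -/
noncomputable def mainTerm (χ : AddChar k[X] ℂ) (n Q : ℕ) (S : Finset k[X]) : ℂ :=
  ∑ D ∈ primeSets k Q, ∑ B ∈ (S \ D).powerset, localSum χ n B D

lemma norm_sum_sieveKernel_sub_le {g : k[X]} (hg : g.Monic) {S : Finset k[X]}
    (hS : ∀ P, P ∈ S ↔ P.Monic ∧ Irreducible P ∧ P ∣ g) {s N Q K : ℕ}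
    (hK : g.natDegree + Q + s ≤ K) {χ : AddChar k[X] ℂ}
    (hχ : TrivialOn χ g (N + 1 - s)) {W : ℝ}
    (hW : ∀ T : Finset k[X], (∀ P ∈ T, P.Monic ∧ Irreducible P) → ∑ P ∈ T, P.natDegree ≤ K →
      16 ^ T.card ≤ W) :
    ‖∑ x ∈ polyLT k (N + 1), (sieveKernel Q x : ℂ) * χ x - mainTerm χ (N + 1) Q S‖ ≤
      (Fintype.card k : ℝ) ^ (Q + 1) * (W * (Fintype.card k * (N + 1) * (2 * K + N + 2)) *
        √(Fintype.card k : ℝ) ^ (K + N)) := by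
  classical
  have h1 : ∑ x ∈ polyLT k (N + 1), (sieveKernel Q x : ℂ) * χ x - mainTerm χ (N + 1) Q S =
      ∑ D ∈ primeSets k Q, ∑ x ∈ polyLT k (N + 1), ((primeWt (1 + x) * ∏ p ∈ D, twistWt p x -
      (∏ p ∈ S \ D, (1 + unitWt p x)) * ∏ p ∈ D, (posWt p x - unitWt p x) : ℝ) : ℂ) * χ x := by
    have h2 : mainTerm χ (N + 1) Q S = ∑ D ∈ primeSets k Q, ∑ x ∈ polyLT k (N + 1),
        (((∏ p ∈ S \ D, (1 + unitWt p x)) *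
          ∏ p ∈ D, (posWt p x - unitWt p x) : ℝ) : ℂ) * χ x := by
      rw [mainTerm]
      refine Finset.sum_congr rfl fun D _ => ?_
      rw [← sum_prod_one_add_unitWt]
    rw [h2, Finset.sum_comm, Finset.sum_comm (s := primeSets k Q), ← Finset.sum_sub_distrib]
    refine Finset.sum_congr rfl fun x _ => ?_
    rw [sieveKernel, Finset.mul_sum, Complex.ofReal_sum, Finset.sum_mul, ← Finset.sum_sub_distrib]
    refine Finset.sum_congr rfl fun D _ => ?_
    push_cast
    ring
  rw [h1]
  refine (norm_sum_le _ _).trans ?_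
  have hW0 : 0 ≤ W := le_trans (by norm_num) (hW ∅ (by simp) (by simp))
  refine (Finset.sum_le_card_nsmul _ _ (W * (Fintype.card k * (N + 1) * (2 * K + N + 2)) *
        √(Fintype.card k : ℝ) ^ (K + N)) fun D hD => ?_).trans ?_
  · obtain ⟨hD1, hD2⟩ := mem_primeSets.1 hD
    refine (norm_sum_twist_sub_le hg hS hD1 (K := K) (by omega) hχ).trans ?_
    have hSD := hW (S ∪ D) (fun P hP => (Finset.mem_union.1 hP).elim
      (fun h => ⟨((hS P).1 h).1, ((hS P).1 h).2.1⟩) (hD1 P)) (by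
        have h3 := sum_natDegree_le_of_dvd hg S fun P hP => (hS P).1 hP
        have h4 : ∑ P ∈ S ∪ D, P.natDegree ≤ ∑ P ∈ S, P.natDegree + ∑ P ∈ D, P.natDegree := by
          rw [← Finset.sum_union_inter]; exact Nat.le_add_right _ _
        omega)
    have h5 : (5 : ℝ) ^ D.card * (2 * K + N + 1 + 2 ^ (S ∪ D).card) ≤ W * (2 * K + N + 2) := by
      have h6 : (5 : ℝ) ^ D.card ≤ 8 ^ (S ∪ D).card :=
        (pow_le_pow_left₀ (by norm_num) (by norm_num) _).trans
          (pow_le_pow_right₀ (by norm_num) (Finset.card_le_card Finset.subset_union_right))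
      have h7 : (1 : ℝ) ≤ 2 ^ (S ∪ D).card := one_le_pow₀ (by norm_num)
      have h8 : (2 * K + N + 1 + 2 ^ (S ∪ D).card : ℝ) ≤ 2 ^ (S ∪ D).card * (2 * K + N + 2) := by
        have : (0 : ℝ) ≤ 2 * K + N := by positivity
        nlinarith
      calc (5 : ℝ) ^ D.card * (2 * K + N + 1 + 2 ^ (S ∪ D).card)
          ≤ 8 ^ (S ∪ D).card * (2 ^ (S ∪ D).card * (2 * K + N + 2)) := by gcongr
        _ = 16 ^ (S ∪ D).card * (2 * K + N + 2) := by
          rw [← mul_assoc, ← mul_pow]; norm_num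
        _ ≤ _ := by gcongr
    calc _ = ((5 : ℝ) ^ D.card * (2 * K + N + 1 + 2 ^ (S ∪ D).card)) * (Fintype.card k * (N + 1)) *
          √(Fintype.card k : ℝ) ^ (K + N) := by ring
      _ ≤ W * (2 * K + N + 2) * (Fintype.card k * (N + 1)) *
          √(Fintype.card k : ℝ) ^ (K + N) := by gcongr
      _ = _ := by ring
  · rw [nsmul_eq_mul]
    refine mul_le_mul_of_nonneg_right ?_ (by positivity)
    exact_mod_cast card_primeSets_le Q

/-- The main term when no small product of primes is in resonance with `χ`. -/
lemma norm_mainTerm_le {S : Finset k[X]} (hS : ∀ P ∈ S, P.Monic ∧ Irreducible P) {N Q K : ℕ}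
    (hQ : 2 * Q ≤ N) (hK : ∑ P ∈ S, P.natDegree + Q ≤ K) (hKN : K ≤ N + 1) {χ : AddChar k[X] ℂ}
    (hχ : ∀ E : Finset k[X], (∀ P ∈ E, P.Monic ∧ Irreducible P) → ∑ P ∈ E, P.natDegree ≤ 2 * Q →
      ¬ TrivialOn χ (∏ P ∈ E, P) (N + 1)) {W : ℝ}
    (hW : ∀ T : Finset k[X], (∀ P ∈ T, P.Monic ∧ Irreducible P) → ∑ P ∈ T, P.natDegree ≤ K →
      16 ^ T.card ≤ W) :
    ‖mainTerm χ (N + 1) Q S‖ ≤ W * (Fintype.card k : ℝ) ^ (N + 1 - Q) := by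
  classical
  have hq1 : (1 : ℝ) ≤ Fintype.card k := by exact_mod_cast Fintype.card_pos
  have hW0 : 0 ≤ W := le_trans (by norm_num) (hW ∅ (by simp) (by simp))
  have h1 : ∀ D ∈ primeSets k Q, ‖∑ B ∈ (S \ D).powerset, localSum χ (N + 1) B D‖ ≤
      W * (Fintype.card k : ℝ) ^ (N - 2 * Q) := by
    intro D hD
    obtain ⟨hD1, hD2⟩ := mem_primeSets.1 hD
    have hSD := hW (S ∪ D) (fun P hP => (Finset.mem_union.1 hP).elim (hS P) (hD1 P)) (by
        have h4 : ∑ P ∈ S ∪ D, P.natDegree ≤ ∑ P ∈ S, P.natDegree + ∑ P ∈ D, P.natDegree := by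
          rw [← Finset.sum_union_inter]; exact Nat.le_add_right _ _
        omega)
    have hcard : (S \ D).card + D.card = (S ∪ D).card := by
      rw [← Finset.sdiff_union_self_eq_union, Finset.card_union_of_disjoint Finset.sdiff_disjoint]
    have h2 : ∀ B ∈ (S \ D).powerset, ‖localSum χ (N + 1) B D‖ ≤
        8 ^ (S ∪ D).card * (Fintype.card k : ℝ) ^ (N - 2 * Q) := by
      intro B hB
      rw [Finset.mem_powerset] at hB
      have hBS : B ⊆ S := hB.trans Finset.sdiff_subset
      have hdisj : Disjoint B D := Finset.sdiff_disjoint.mono_left hB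
      have hB1 := fun P hP => hS P (hBS hP)
      by_cases hE : 2 * Q < ∑ P ∈ B ∪ D, P.natDegree
      · rw [Finset.sum_union hdisj] at hE
        have hBs : ∑ P ∈ B, P.natDegree ≤ ∑ P ∈ S, P.natDegree :=
          Finset.sum_le_sum_of_subset hBS
        refine (norm_localSum_le hdisj hB1 hD1 (by omega)).trans ?_
        have := Finset.card_le_card hB
        refine mul_le_mul (pow_le_pow_right₀ (by norm_num) (by omega))
          (pow_le_pow_right₀ hq1 (by omega)) (by positivity) (by positivity)
      · rw [localSum_eq_zero_of_not_trivialOn (hχ (B ∪ D) (fun P hP =>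
          (Finset.mem_union.1 hP).elim (hB1 P) (hD1 P)) (not_lt.1 hE)), norm_zero]
        positivity
    refine (norm_sum_le _ _).trans ((Finset.sum_le_card_nsmul _ _ _ h2).trans ?_)
    rw [Finset.card_powerset, nsmul_eq_mul, ← mul_assoc]
    refine mul_le_mul_of_nonneg_right (le_trans ?_ hSD) (by positivity)
    have h3 : (16 : ℝ) ^ (S ∪ D).card = 2 ^ (S ∪ D).card * 8 ^ (S ∪ D).card := by
      rw [← mul_pow]; norm_num
    rw [h3]
    push_cast
    exact mul_le_mul_of_nonneg_right (pow_le_pow_right₀ (by norm_num) (by omega)) (by positivity)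
  rw [mainTerm]
  refine (norm_sum_le _ _).trans ((Finset.sum_le_card_nsmul _ _ _ h1).trans ?_)
  rw [nsmul_eq_mul]
  have h2 : ((primeSets k Q).card : ℝ) ≤ (Fintype.card k : ℝ) ^ (Q + 1) := by
    exact_mod_cast card_primeSets_le Q
  calc ((primeSets k Q).card : ℝ) * (W * (Fintype.card k : ℝ) ^ (N - 2 * Q))
      ≤ (Fintype.card k : ℝ) ^ (Q + 1) * (W * (Fintype.card k : ℝ) ^ (N - 2 * Q)) := by gcongr
    _ = W * (Fintype.card k : ℝ) ^ (Q + 1 + (N - 2 * Q)) := by rw [pow_add]; ring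
    _ = _ := by congr 2; omega

open Classical in
/-- The main term when `χ` resonates with a minimal set of primes `E`. -/
lemma mainTerm_eq_of_trivialOn {E : Finset k[X]} (hE : ∀ P ∈ E, P.Monic ∧ Irreducible P)
    {n Q : ℕ} {χ : AddChar k[X] ℂ} (hχ : TrivialOn χ (∏ P ∈ E, P) n)
    (hmin : ∀ F, F ⊂ E → ¬ TrivialOn χ (∏ P ∈ F, P) n) (hn : ∑ P ∈ E, P.natDegree + Q ≤ n) :
    mainTerm χ n Q E = ∑ D ∈ primeSets k Q with D ⊆ E, localSum χ n (E \ D) D := by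
  rw [mainTerm, Finset.sum_filter]
  refine Finset.sum_congr rfl fun D hD => ?_
  obtain ⟨hD1, hD2⟩ := mem_primeSets.1 hD
  split_ifs with hDE
  · refine Finset.sum_eq_single_of_mem _ (Finset.mem_powerset_self _) fun B hB hne => ?_
    rw [Finset.mem_powerset] at hB
    refine localSum_eq_zero_of_not_trivialOn (hmin _ ⟨Finset.union_subset
      (hB.trans Finset.sdiff_subset) hDE, fun h => hne (hB.antisymm fun x hx => ?_)⟩)
    obtain ⟨h1, h2⟩ := Finset.mem_sdiff.1 hx
    exact (Finset.mem_union.1 (h h1)).resolve_right h2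
  · refine Finset.sum_eq_zero fun B hB => ?_
    rw [Finset.mem_powerset] at hB
    exact localSum_eq_zero_of_not_subset hE hD1 hχ (hB.trans Finset.sdiff_subset) hDE (by omega)

lemma neg_le_re_mainTerm {E : Finset k[X]} (hE : ∀ P ∈ E, P.Monic ∧ Irreducible P)
    {N Q K : ℕ} {χ : AddChar k[X] ℂ} (hχ : TrivialOn χ (∏ P ∈ E, P) (N + 1))
    (hmin : ∀ F, F ⊂ E → ¬ TrivialOn χ (∏ P ∈ F, P) (N + 1))
    (hK : ∑ P ∈ E, P.natDegree + Q ≤ K) (hKN : K ≤ N + 1) {W : ℝ}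
    (hW : ∀ T : Finset k[X], (∀ P ∈ T, P.Monic ∧ Irreducible P) → ∑ P ∈ T, P.natDegree ≤ K →
      16 ^ T.card ≤ W) :
    - (W * (Fintype.card k : ℝ) ^ (N + 1 - Q)) ≤ (mainTerm χ (N + 1) Q E).re := by
  classical
  have hq1 : (1 : ℝ) ≤ Fintype.card k := by exact_mod_cast Fintype.card_pos
  have hW0 : 0 ≤ W := le_trans (by norm_num) (hW ∅ (by simp) (by simp))
  rw [mainTerm_eq_of_trivialOn hE hχ hmin (by omega)]
  rcases le_or_gt (∑ P ∈ E, P.natDegree) Q with hEQ | hEQ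
  · have h1 : (primeSets k Q).filter (fun D => D ⊆ E) = E.powerset := by
      ext D
      rw [Finset.mem_filter, mem_primeSets, Finset.mem_powerset]
      exact ⟨fun h => h.2, fun h => ⟨⟨fun P hP => hE P (h hP),
        (Finset.sum_le_sum_of_subset h).trans hEQ⟩, h⟩⟩
    have h2 : ∑ D ∈ primeSets k Q with D ⊆ E, localSum χ (N + 1) (E \ D) D =
        ∑ x ∈ polyLT k (N + 1), ((∏ p ∈ E, posWt p x : ℝ) : ℂ) * χ x := by
      rw [h1]
      simp only [localSum]
      rw [Finset.sum_comm]
      refine Finset.sum_congr rfl fun x _ => ?_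
      rw [← Finset.sum_mul, ← Complex.ofReal_sum]
      congr 2
      rw [Finset.prod_congr rfl fun p _ => (sub_add_cancel (posWt p x) (unitWt p x)).symm,
        Finset.prod_add]
      exact Finset.sum_congr rfl fun D _ => mul_comm _ _
    rw [h2]
    refine le_trans ?_ (sum_polyLT_prod_posWt_re_nonneg (fun P hP => (hE P hP).1) χ (N + 1))
    rw [neg_nonpos]
    positivity
  · have h1 : ‖∑ D ∈ primeSets k Q with D ⊆ E, localSum χ (N + 1) (E \ D) D‖ ≤
        W * (Fintype.card k : ℝ) ^ (N + 1 - Q) := by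
      have h2 : ∀ D ∈ (primeSets k Q).filter (fun D => D ⊆ E),
          ‖localSum χ (N + 1) (E \ D) D‖ ≤
            8 ^ E.card * (Fintype.card k : ℝ) ^ (N + 1 - Q) := by
        intro D hD
        obtain ⟨hD1, hDE⟩ := Finset.mem_filter.1 hD
        have h3 : ∑ P ∈ E \ D, P.natDegree + ∑ P ∈ D, P.natDegree = ∑ P ∈ E, P.natDegree :=
          Finset.sum_sdiff hDE
        have h4 : (E \ D).card + D.card = E.card := Finset.card_sdiff_add_card_eq_card hDE
        refine (norm_localSum_le Finset.sdiff_disjoint (fun P hP => hE P (Finset.sdiff_subset hP))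
          (mem_primeSets.1 hD1).1 (by omega)).trans ?_
        rw [h3, h4]
        exact mul_le_mul_of_nonneg_left (pow_le_pow_right₀ hq1 (by omega)) (by positivity)
      refine (norm_sum_le _ _).trans ((Finset.sum_le_card_nsmul _ _ _ h2).trans ?_)
      have h3 : ((primeSets k Q).filter (fun D => D ⊆ E)).card ≤ 2 ^ E.card := by
        rw [← Finset.card_powerset]
        exact Finset.card_le_card fun D hD => Finset.mem_powerset.2 (Finset.mem_filter.1 hD).2
      have h4 : (((primeSets k Q).filter (fun D => D ⊆ E)).card : ℝ) ≤ 2 ^ E.card := by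
        exact_mod_cast h3
      rw [nsmul_eq_mul, ← mul_assoc]
      refine mul_le_mul_of_nonneg_right ?_ (by positivity)
      calc _ ≤ (2 : ℝ) ^ E.card * 8 ^ E.card := by gcongr
        _ = 16 ^ E.card := by rw [← mul_pow]; norm_num
        _ ≤ W := hW E hE (by omega)
    exact (abs_le.1 ((Complex.abs_re_le_norm _).trans h1)).1

end SieveWeights

section FourierLowerBound

variable {k : Type} [Field k] [Fintype k]

lemma exists_monic_trivialOn (χ : AddChar k[X] ℂ) {n d : ℕ} (hd : n < 2 * d + 1) (hdn : d ≤ n) :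
    ∃ g : k[X], g.Monic ∧ g.natDegree ≤ d ∧ TrivialOn χ g (n - (d - g.natDegree)) := by
  classical
  have hfin : Finite (degreeLT k (n - d)) :=
    Finite.of_equiv _ (degreeLTEquiv k (n - d)).toEquiv.symm
  have : Fintype (degreeLT k (n - d)) := Fintype.ofFinite _
  let φ : k[X] → AddChar (degreeLT k (n - d)) ℂ := fun g => χ.compAddMonoidHom
    ((AddMonoidHom.mulLeft g).comp (degreeLT k (n - d)).subtype.toAddMonoidHom)
  have hφ : ∀ g h, φ g h = χ (g * (h : k[X])) := fun g h => rfl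
  have hcard : (Finset.univ : Finset (AddChar (degreeLT k (n - d)) ℂ)).card <
      (polyLT k (d + 1)).card := by
    rw [Finset.card_univ, AddChar.card_eq, card_polyLT, Fintype.card_congr
      (degreeLTEquiv k (n - d)).toEquiv, Fintype.card_fun, Fintype.card_fin]
    exact Nat.pow_lt_pow_right Fintype.one_lt_card (by omega)
  obtain ⟨g₁, h₁, g₂, h₂, hne, heq⟩ := Finset.exists_ne_map_eq_of_card_lt_of_maps_to hcard
    (f := φ) fun g _ => Finset.mem_univ _
  rw [mem_polyLT] at h₁ h₂
  have hg : g₁ - g₂ ≠ 0 := sub_ne_zero.2 hne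
  have hdeg : (g₁ - g₂).natDegree < d + 1 :=
    (natDegree_lt_iff_degree_lt hg).2 ((degree_sub_le _ _).trans_lt (max_lt h₁ h₂))
  have hc : (g₁ - g₂).leadingCoeff⁻¹ ≠ 0 := inv_ne_zero (leadingCoeff_ne_zero.2 hg)
  have hdeg' : ((g₁ - g₂) * C (g₁ - g₂).leadingCoeff⁻¹).natDegree = (g₁ - g₂).natDegree :=
    natDegree_mul_C hc
  refine ⟨(g₁ - g₂) * C (g₁ - g₂).leadingCoeff⁻¹, monic_mul_leadingCoeff_inv hg,
    by omega, fun h hh => ?_⟩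
  rw [degree_mul_lt_iff (monic_mul_leadingCoeff_inv hg).ne_zero, hdeg'] at hh
  have hh' : (C (g₁ - g₂).leadingCoeff⁻¹ * h).degree < (n - d : ℕ) := by
    rw [degree_C_mul hc]
    convert hh using 2
    omega
  have h3 := DFunLike.congr_fun heq ⟨_, mem_degreeLT.2 hh'⟩
  rw [hφ, hφ] at h3
  rw [mul_assoc, sub_mul, AddChar.map_sub_eq_div, h3, div_self]
  exact norm_ne_zero_iff.1 (by rw [norm_addChar_apply]; exact one_ne_zero)

/-- The error term in the Fourier lower bound. -/
noncomputable def fourierError (q : ℝ) (N Q K : ℕ) (W : ℝ) : ℝ :=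
  W * q ^ (N + 1 - Q) + q ^ (Q + 1) * (W * (q * (N + 1) * (2 * K + N + 2)) * √q ^ (K + N))

omit [Fintype k] in
lemma mem_iff_dvd_prod {E : Finset k[X]} (hE : ∀ P ∈ E, P.Monic ∧ Irreducible P) (P : k[X]) :
    P ∈ E ↔ P.Monic ∧ Irreducible P ∧ P ∣ ∏ P ∈ E, P := by
  refine ⟨fun h => ⟨(hE P h).1, (hE P h).2, Finset.dvd_prod_of_mem _ h⟩, fun h => ?_⟩
  by_contra hn
  exact not_dvd_prod_of_notMem hE h.1 h.2.1 hn h.2.2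

lemma neg_le_re_sum_sieveKernel {N Q : ℕ} (hQ : 6 * Q ≤ N) {W : ℝ}
    (hW : ∀ T : Finset k[X], (∀ P ∈ T, P.Monic ∧ Irreducible P) →
      ∑ P ∈ T, P.natDegree ≤ N / 2 + 1 + Q → 16 ^ T.card ≤ W) (χ : AddChar k[X] ℂ) :
    -fourierError (Fintype.card k) N Q (N / 2 + 1 + Q) W ≤
      (∑ x ∈ polyLT k (N + 1), (sieveKernel Q x : ℂ) * χ x).re := by
  classical
  have key : ∀ z w : ℂ, ∀ a b : ℝ, ‖z - w‖ ≤ b → -a ≤ w.re → -(a + b) ≤ z.re := by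
    intro z w a b h1 h2
    have h3 := (Complex.abs_re_le_norm (z - w)).trans h1
    rw [Complex.sub_re, abs_le] at h3
    linarith [h3.1]
  by_cases hχ : ∃ E : Finset k[X], ((∀ P ∈ E, P.Monic ∧ Irreducible P) ∧
      ∑ P ∈ E, P.natDegree ≤ 2 * Q) ∧ TrivialOn χ (∏ P ∈ E, P) (N + 1)
  · obtain ⟨E, hE, hmin⟩ := WellFounded.has_min (r := fun s t : Finset k[X] => s ⊂ t)
      Finset.isWellFounded_ssubset.wf {E : Finset k[X] | ((∀ P ∈ E, P.Monic ∧ Irreducible P) ∧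
      ∑ P ∈ E, P.natDegree ≤ 2 * Q) ∧ TrivialOn χ (∏ P ∈ E, P) (N + 1)} hχ
    obtain ⟨⟨hE1, hE2⟩, hE3⟩ := hE
    have hmin' : ∀ F, F ⊂ E → ¬ TrivialOn χ (∏ P ∈ F, P) (N + 1) := fun F hF hF' =>
      hmin F ⟨⟨fun P hP => hE1 P (hF.1 hP), (Finset.sum_le_sum_of_subset hF.1).trans hE2⟩, hF'⟩ hF
    have hdeg : (∏ P ∈ E, P).natDegree = ∑ P ∈ E, P.natDegree :=
      natDegree_prod_of_monic _ _ fun P hP => (hE1 P hP).1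
    exact key _ _ _ _ (norm_sum_sieveKernel_sub_le
      (monic_prod_of_monic _ _ fun P hP => (hE1 P hP).1) (mem_iff_dvd_prod hE1) (s := 0)
      (by omega) hE3 hW) (neg_le_re_mainTerm hE1 hE3 hmin' (by omega) (by omega) hW)
  · push Not at hχ
    obtain ⟨g, hg1, hg2, hg3⟩ := exists_monic_trivialOn χ (n := N + 1) (d := N / 2 + 1)
      (by omega) (by omega)
    obtain ⟨S, hS⟩ := exists_finset_primeFactors hg1.ne_zero
    have hS' := sum_natDegree_le_of_dvd hg1 S fun P hP => (hS P).1 hP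
    refine key _ _ _ _ (norm_sum_sieveKernel_sub_le hg1 hS (by omega) hg3 hW) ?_
    have h1 := norm_mainTerm_le (fun P hP => ⟨((hS P).1 hP).1, ((hS P).1 hP).2.1⟩) (N := N)
      (K := N / 2 + 1 + Q) (by omega) (by omega) (by omega)
      (fun E hE hE' => hχ E ⟨hE, hE'⟩) hW
    exact (abs_le.1 ((Complex.abs_re_le_norm _).trans h1)).1

lemma le_sum_sieveKernel {N Q : ℕ} (hQ : 6 * Q ≤ N) {W : ℝ}
    (hW : ∀ T : Finset k[X], (∀ P ∈ T, P.Monic ∧ Irreducible P) →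
      ∑ P ∈ T, P.natDegree ≤ N / 2 + 1 + Q → 16 ^ T.card ≤ W) :
    (Fintype.card k : ℝ) ^ (N + 1) - fourierError (Fintype.card k) N Q (N / 2 + 1 + Q) W ≤
      ∑ x ∈ polyLT k (N + 1), sieveKernel Q x := by
  classical
  have hW0 : 0 ≤ W := zero_le_one.trans (by simpa using hW ∅ (by simp) (by simp))
  have h1 := norm_sum_sieveKernel_sub_le (k := k) (g := 1) (S := ∅) monic_one (fun P => ⟨by simp,
    fun h => (h.2.1.not_isUnit (isUnit_of_dvd_one h.2.2)).elim⟩) (s := 0) (N := N) (Q := Q)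
    (K := N / 2 + 1 + Q) (by rw [natDegree_one]; omega) (χ := 1) (fun h _ => rfl) hW
  have h2 : mainTerm (1 : AddChar k[X] ℂ) (N + 1) Q ∅ = (Fintype.card k : ℂ) ^ (N + 1) := by
    rw [mainTerm_eq_of_trivialOn (by simp) (fun h _ => rfl)
      (fun F hF => (Finset.not_ssubset_empty F hF).elim) (by simp; omega)]
    have h3 : (primeSets k Q).filter (fun D => D ⊆ ∅) = {∅} := by
      ext D
      rw [Finset.mem_filter, mem_primeSets, Finset.subset_empty, Finset.mem_singleton]
      exact ⟨fun h => h.2, fun h => ⟨by simp [h], h⟩⟩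
    rw [h3, Finset.sum_singleton, localSum]
    simp [card_polyLT]
  rw [h2] at h1
  have h3 := (Complex.abs_re_le_norm _).trans h1
  have h4 : (∑ x ∈ polyLT k (N + 1), (sieveKernel Q x : ℂ) * (1 : AddChar k[X] ℂ) x -
      (Fintype.card k : ℂ) ^ (N + 1)) = ((∑ x ∈ polyLT k (N + 1), sieveKernel Q x -
      (Fintype.card k : ℝ) ^ (N + 1) : ℝ) : ℂ) := by
    push_cast
    simp
  rw [h4, Complex.ofReal_re, abs_le] at h3
  have h5 : 0 ≤ W * (Fintype.card k : ℝ) ^ (N + 1 - Q) := by positivity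
  rw [fourierError]
  linarith [h3.1]

end FourierLowerBound

section DivisorBound

variable (k : Type) [Field k] [Fintype k]

lemma exists_pow_card_le {c η : ℝ} (hc : 1 ≤ c) (hη : 0 < η) :
    ∃ M : ℝ, 1 ≤ M ∧ ∀ T : Finset k[X],
      c ^ T.card ≤ M * (Fintype.card k : ℝ) ^ (η * (∑ P ∈ T, P.natDegree : ℕ)) := by
  classical
  have hq1 : (1 : ℝ) < Fintype.card k := by exact_mod_cast Fintype.one_lt_card
  have hq0 : (0 : ℝ) < Fintype.card k := by linarith
  set q : ℝ := ((Fintype.card k : ℕ) : ℝ) with hq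
  have hqη : 1 < q ^ η := Real.one_lt_rpow hq1 hη
  obtain ⟨d, hd⟩ := pow_unbounded_of_one_lt c hqη
  refine ⟨c ^ (polyLT k d).card, one_le_pow₀ hc, fun T => ?_⟩
  have h1 : q ^ (η * (∑ P ∈ T, P.natDegree : ℕ)) = ∏ P ∈ T, (q ^ η) ^ P.natDegree := by
    rw [Real.rpow_mul hq0.le, Real.rpow_natCast, Finset.prod_pow_eq_pow_sum]
  rw [h1, ← Finset.prod_filter_mul_prod_filter_not T (fun P => P ∈ polyLT k d),
    ← Finset.card_filter_add_card_filter_not (s := T) (fun P => P ∈ polyLT k d), pow_add]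
  have h2 : c ^ (T.filter (fun P => P ∈ polyLT k d)).card ≤ c ^ (polyLT k d).card :=
    pow_le_pow_right₀ hc (Finset.card_le_card fun P hP => (Finset.mem_filter.1 hP).2)
  have h3 : c ^ (T.filter (fun P => P ∉ polyLT k d)).card ≤
      ∏ P ∈ T with P ∉ polyLT k d, (q ^ η) ^ P.natDegree := by
    rw [← Finset.prod_const]
    refine Finset.prod_le_prod (fun _ _ => by linarith) fun P hP => hd.le.trans ?_
    have h4 := (Finset.mem_filter.1 hP).2
    rw [mem_polyLT, not_lt] at h4
    exact pow_le_pow_right₀ hqη.le (WithBot.coe_le_coe.1 (h4.trans degree_le_natDegree))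
  have h4 : 1 ≤ ∏ P ∈ T with P ∈ polyLT k d, (q ^ η) ^ P.natDegree :=
    by
    rw [Finset.prod_pow_eq_pow_sum]
    exact one_le_pow₀ hqη.le
  have h5 : 0 ≤ c ^ (T.filter (fun P => P ∉ polyLT k d)).card := by positivity
  calc _ ≤ c ^ (polyLT k d).card * ∏ P ∈ T with P ∉ polyLT k d, (q ^ η) ^ P.natDegree :=
        mul_le_mul h2 h3 h5 (by positivity)
    _ ≤ _ := by
        refine mul_le_mul_of_nonneg_left ?_ (by positivity)
        exact le_mul_of_one_le_left (h5.trans h3) h4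

end DivisorBound

section PositiveDefinite

lemma sum_sum_mul_norm_sq {V : Type*} [AddCommGroup V] [Fintype V] (f : V → ℝ) (A : Finset V) :
    ∑ ψ : AddChar V ℂ, (∑ x, (f x : ℂ) * ψ x).re * ‖∑ a ∈ A, ψ a‖ ^ 2 =
      Fintype.card V * ∑ a ∈ A, ∑ b ∈ A, f (a - b) := by
  classical
  have h1 : ∀ ψ : AddChar V ℂ, (∑ x, (f x : ℂ) * ψ x).re * ‖∑ a ∈ A, ψ a‖ ^ 2 =
      (∑ a ∈ A, ∑ b ∈ A, ∑ x, (f x : ℂ) * ψ (x + b - a)).re := by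
    intro ψ
    rw [← Complex.re_mul_ofReal, Complex.ofReal_pow, ← Complex.conj_mul', map_sum,
      Finset.sum_mul_sum, Finset.mul_sum]
    congr 1
    refine Finset.sum_congr rfl fun a _ => ?_
    rw [Finset.mul_sum]
    refine Finset.sum_congr rfl fun b _ => ?_
    rw [Finset.sum_mul]
    refine Finset.sum_congr rfl fun x _ => ?_
    rw [sub_eq_add_neg, AddChar.map_add_eq_mul, AddChar.map_add_eq_mul, AddChar.map_neg_eq_conj]
    ring
  rw [Finset.sum_congr rfl fun ψ _ => h1 ψ, ← Complex.re_sum]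
  have h2 : ∑ ψ : AddChar V ℂ, ∑ a ∈ A, ∑ b ∈ A, ∑ x, (f x : ℂ) * ψ (x + b - a) =
      ∑ a ∈ A, ∑ b ∈ A, (Fintype.card V * f (a - b) : ℂ) := by
    rw [Finset.sum_comm]
    refine Finset.sum_congr rfl fun a _ => ?_
    rw [Finset.sum_comm]
    refine Finset.sum_congr rfl fun b _ => ?_
    rw [Finset.sum_comm]
    simp_rw [← Finset.mul_sum, AddChar.sum_apply_eq_ite]
    rw [Finset.sum_eq_single_of_mem (a - b) (Finset.mem_univ _), if_pos (by abel), mul_comm]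
    intro x _ hx
    rw [if_neg, mul_zero]
    intro h
    exact hx (by rw [← sub_eq_zero, ← h]; abel)
  rw [h2, Finset.mul_sum, Complex.re_sum]
  refine Finset.sum_congr rfl fun a _ => ?_
  rw [Finset.mul_sum, Complex.re_sum]
  refine Finset.sum_congr rfl fun b _ => ?_
  rw [← Complex.ofReal_natCast, ← Complex.ofReal_mul, Complex.ofReal_re]

lemma sum_norm_sum_sq_eq_card_mul {V : Type*} [AddCommGroup V] [Fintype V] (A : Finset V) :
    ∑ ψ : AddChar V ℂ, ‖∑ a ∈ A, ψ a‖ ^ 2 = Fintype.card V * A.card := by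
  classical
  have h := AddChar.sum_norm_sum_sq (fun x : V => if x ∈ A then (1 : ℂ) else 0)
  simpa [apply_ite, Finset.sum_ite_mem] using h

lemma card_le_of_fourier_bound {V : Type*} [AddCommGroup V] [Fintype V] (f : V → ℝ) (A : Finset V)
    (hA : ∀ a ∈ A, ∀ b ∈ A, f (a - b) = 0) {δ : ℝ} (hδ : 0 ≤ δ)
    (hψ : ∀ ψ : AddChar V ℂ, -δ ≤ (∑ x, (f x : ℂ) * ψ x).re)
    (h1 : (Fintype.card V : ℝ) - δ ≤ ∑ x, f x) : (A.card : ℝ) ≤ δ := by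
  rcases A.eq_empty_or_nonempty with rfl | hne
  · simpa using hδ
  have hApos : (0 : ℝ) < A.card := by exact_mod_cast hne.card_pos
  have hVpos : (0 : ℝ) < Fintype.card V := by exact_mod_cast Fintype.card_pos
  have h2 := sum_sum_mul_norm_sq f A
  rw [Finset.sum_eq_zero fun a ha => Finset.sum_eq_zero fun b hb => hA a ha b hb, mul_zero] at h2
  have h3 : ((∑ x, (f x : ℂ) * (1 : AddChar V ℂ) x).re + δ) * ‖∑ a ∈ A, (1 : AddChar V ℂ) a‖ ^ 2 ≤
      ∑ ψ : AddChar V ℂ, ((∑ x, (f x : ℂ) * ψ x).re + δ) * ‖∑ a ∈ A, ψ a‖ ^ 2 :=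
    Finset.single_le_sum (f := fun ψ : AddChar V ℂ =>
      ((∑ x, (f x : ℂ) * ψ x).re + δ) * ‖∑ a ∈ A, ψ a‖ ^ 2)
      (fun ψ _ => mul_nonneg (by linarith [hψ ψ]) (by positivity)) (Finset.mem_univ _)
  simp_rw [add_mul _ δ, Finset.sum_add_distrib, ← Finset.mul_sum] at h3
  rw [h2, sum_norm_sum_sq_eq_card_mul, ← add_mul] at h3
  have h4 : (∑ x, (f x : ℂ) * (1 : AddChar V ℂ) x).re = ∑ x, f x := by simp
  have h5 : ‖∑ a ∈ A, (1 : AddChar V ℂ) a‖ = A.card := by simp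
  rw [h4, h5, zero_add] at h3
  have h6 : (Fintype.card V : ℝ) * A.card ^ 2 ≤ (∑ x, f x + δ) * A.card ^ 2 :=
    mul_le_mul_of_nonneg_right (by linarith) (by positivity)
  have h7 : (Fintype.card V * A.card : ℝ) * A.card ≤ (Fintype.card V * A.card : ℝ) * δ := by
    nlinarith
  exact le_of_mul_le_mul_left h7 (by positivity)

end PositiveDefinite

section Conclusion

lemma exists_sq_le_mul_rpow {q η : ℝ} (hq : 1 < q) (hη : 0 < η) :
    ∃ B : ℝ, 0 < B ∧ ∀ x : ℝ, 0 ≤ x → x ^ 2 ≤ B * q ^ (η * x) := by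
  have hlog : 0 < η * Real.log q := mul_pos hη (Real.log_pos hq)
  refine ⟨2 / (η * Real.log q) ^ 2, by positivity, fun x hx => ?_⟩
  have h1 := Real.quadratic_le_exp_of_nonneg (mul_nonneg hlog.le hx)
  have h2 : q ^ (η * x) = Real.exp (η * Real.log q * x) := by
    rw [Real.rpow_def_of_pos (by linarith)]; congr 1; ring
  rw [h2, div_mul_eq_mul_div, le_div_iff₀ (by positivity)]
  nlinarith [mul_nonneg hlog.le hx]

lemma fourierError_le {q ε B M : ℝ} (hq : 1 < q) (hM : 1 ≤ M) (N : ℕ)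
    (hB : ((N : ℝ) + 1) ^ 2 ≤ B * q ^ (ε / 2 * ((N : ℝ) + 1))) (hε : 0 < ε) :
    fourierError q N (N / 12) (N / 2 + 1 + N / 12) (M * q ^ (ε / 2 * ((N : ℝ) + 1))) ≤
      (M * (q + 4 * q ^ 3 * B)) * q ^ (((N : ℝ) + 1) * (11 / 12 + ε)) := by
  have hq0 : 0 < q := by linarith
  have hdiv : (N : ℝ) ≤ 12 * (N / 12 : ℕ) + 11 := by
    have : N ≤ 12 * (N / 12) + 11 := by omega
    exact_mod_cast this
  have hdiv' : 12 * ((N / 12 : ℕ) : ℝ) ≤ N := by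
    have : 12 * (N / 12) ≤ N := by omega
    exact_mod_cast this
  have hdiv2 : 2 * ((N / 2 : ℕ) : ℝ) ≤ N := by
    have : 2 * (N / 2) ≤ N := by omega
    exact_mod_cast this
  have hN0 : (0 : ℝ) ≤ N := Nat.cast_nonneg N
  set n : ℝ := (N : ℝ) + 1 with hn
  have h1 : q ^ (N + 1 - N / 12) ≤ q * q ^ (11 / 12 * n) := by
    rw [← Real.rpow_natCast, ← Real.rpow_one_add' hq0.le (by positivity),
      Nat.cast_sub (by omega)]
    refine Real.rpow_le_rpow_of_exponent_le hq.le ?_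
    push_cast
    linarith
  have h2 : q ^ (N / 12 + 1) * √q ^ (N / 2 + 1 + N / 12 + N) ≤ q ^ 2 * q ^ (11 / 12 * n) := by
    rw [Real.sqrt_eq_rpow, ← Real.rpow_natCast, ← Real.rpow_natCast, ← Real.rpow_mul hq0.le,
      ← Real.rpow_add hq0, ← Real.rpow_natCast, ← Real.rpow_add hq0]
    refine Real.rpow_le_rpow_of_exponent_le hq.le ?_
    push_cast
    linarith
  have h3 : n * (2 * (N / 2 + 1 + N / 12 : ℕ) + N + 2) ≤ 4 * (B * q ^ (ε / 2 * n)) := by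
    push_cast
    nlinarith
  have h4 : q ^ (n * (11 / 12 + ε)) =
      q ^ (ε / 2 * n) * q ^ (ε / 2 * n) * q ^ (11 / 12 * n) := by
    rw [← Real.rpow_add hq0, ← Real.rpow_add hq0]; congr 1; ring
  have h5 : 1 ≤ q ^ (ε / 2 * n) := Real.one_le_rpow hq.le (by positivity)
  rw [fourierError, h4]
  set y := q ^ (ε / 2 * n)
  set z := q ^ (11 / 12 * n) with hz
  have hz0 : 0 < z := by positivity
  have hMy : 0 ≤ M * y := by positivity
  calc _ = M * y * q ^ (N + 1 - N / 12) + M * y * q * ((n * (2 * (N / 2 + 1 + N / 12 : ℕ) + N + 2)) *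
          (q ^ (N / 12 + 1) * √q ^ (N / 2 + 1 + N / 12 + N))) := by ring
    _ ≤ M * y * (y * (q * z)) + M * y * q * (4 * (B * y) * (q ^ 2 * z)) := by
        have h6 : q ^ (N + 1 - N / 12) ≤ y * (q * z) :=
          h1.trans (le_mul_of_one_le_left (by positivity) h5)
        gcongr
        exact (by positivity : 0 ≤ n * (2 * (N / 2 + 1 + N / 12 : ℕ) + N + 2)).trans h3
    _ = _ := by ring

variable {k : Type} [Field k] [Fintype k]

omit [Fintype k] in
lemma exists_addChar_extend {n : ℕ} (ψ : AddChar (degreeLT k n) ℂ) :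
    ∃ χ : AddChar k[X] ℂ, ∀ x : degreeLT k n, χ x = ψ x := by
  have hmem : ∀ f : k[X], f %ₘ X ^ n ∈ degreeLT k n := fun f => by
    rw [mem_degreeLT, ← degree_X_pow (R := k) n]
    exact degree_modByMonic_lt f (monic_X_pow n)
  refine ⟨ψ.compAddMonoidHom ((modByMonicHom (X ^ n)).codRestrict (degreeLT k n)
    hmem).toAddMonoidHom, fun x => ?_⟩
  change ψ ⟨(x : k[X]) %ₘ X ^ n, _⟩ = ψ x
  congr 1
  refine Subtype.ext ((modByMonic_eq_self_iff (monic_X_pow n)).2 ?_)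
  rw [degree_X_pow]
  exact mem_degreeLT.1 x.2

lemma card_le_fourierError {N Q : ℕ} (hQ : 6 * Q ≤ N) {W : ℝ}
    (hW : ∀ T : Finset k[X], (∀ P ∈ T, P.Monic ∧ Irreducible P) →
      ∑ P ∈ T, P.natDegree ≤ N / 2 + 1 + Q → 16 ^ T.card ≤ W) {A : Finset k[X]}
    (hA : ∀ f ∈ A, f.degree ≤ (N : ℕ))
    (hAP : ∀ a ∈ A, ∀ b ∈ A, ∀ P : k[X], Irreducible P → a - b ≠ P - 1) :
    (A.card : ℝ) ≤ fourierError (Fintype.card k) N Q (N / 2 + 1 + Q) W := by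
  classical
  have hW0 : 0 ≤ W := zero_le_one.trans (by simpa using hW ∅ (by simp) (by simp))
  have : Finite (degreeLT k (N + 1)) :=
    Finite.of_equiv _ (degreeLTEquiv k (N + 1)).toEquiv.symm
  have : Fintype (degreeLT k (N + 1)) := Fintype.ofFinite _
  have hmem : ∀ x : k[X], x ∈ polyLT k (N + 1) ↔ x ∈ degreeLT k (N + 1) := fun x => by
    rw [mem_polyLT, mem_degreeLT]
  have hAmem : ∀ f ∈ A, f ∈ degreeLT k (N + 1) := fun f hf => mem_degreeLT.2
    ((hA f hf).trans_lt (by exact_mod_cast Nat.lt_succ_self N))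
  have hcard : (A.subtype (· ∈ degreeLT k (N + 1))).card = A.card := by
    rw [Finset.card_subtype, Finset.filter_true_of_mem hAmem]
  rw [← hcard]
  refine card_le_of_fourier_bound (fun x : degreeLT k (N + 1) => sieveKernel Q (x : k[X])) _
    (fun a ha b hb => ?_) (by rw [fourierError]; positivity) (fun ψ => ?_) ?_
  · rw [sieveKernel, primeWt_of_not_irreducible, zero_mul]
    intro hirr
    refine hAP a (Finset.mem_subtype.1 ha) b (Finset.mem_subtype.1 hb) _ hirr ?_
    push_cast
    ring
  · obtain ⟨χ, hχ⟩ := exists_addChar_extend ψ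
    have h := neg_le_re_sum_sieveKernel hQ hW χ
    rw [Finset.sum_subtype _ hmem] at h
    simpa only [hχ] using h
  · have h := le_sum_sieveKernel hQ hW
    rw [Finset.sum_subtype _ hmem] at h
    rwa [Fintype.card_congr (degreeLTEquiv k (N + 1)).toEquiv, Fintype.card_fun, Fintype.card_fin,
      Nat.cast_pow]

end Conclusion

/-- If `A ⊆ {f ∈ 𝔽_q[t] : deg f ≤ N}` contains no two elements differing by `P - 1` with
`P` irreducible, then `|A| ≤ C(q,ε) · q^((N+1)(11/12 + ε))`. -/
theorem sarkozy_shifted_irreducibles_upper_bound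
    (p : ℕ) [Fact p.Prime] (Fq : Type) [Field Fq] [Fintype Fq] [Algebra (ZMod p) Fq]
    (ε : ℝ) (hε : 0 < ε) :
    ∃ C : ℝ, 0 < C ∧ ∀ (N : ℕ) (A : Finset (Polynomial Fq)),
      (∀ f ∈ A, f.degree ≤ (N : ℕ)) →
      (∀ a ∈ A, ∀ b ∈ A, ∀ P : Polynomial Fq, Irreducible P → a - b ≠ P - 1) →
      (A.card : ℝ) ≤ C * (Fintype.card Fq : ℝ) ^ (((N : ℝ) + 1) * (11 / 12 + ε)) := by
  have hq1 : (1 : ℝ) < Fintype.card Fq := by exact_mod_cast Fintype.one_lt_card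
  obtain ⟨M, hM1, hM⟩ := exists_pow_card_le Fq (c := 16) (by norm_num) (half_pos hε)
  obtain ⟨B, hB0, hB⟩ := exists_sq_le_mul_rpow hq1 (half_pos hε)
  refine ⟨M * (Fintype.card Fq + 4 * Fintype.card Fq ^ 3 * B), by positivity,
    fun N A hA hAP => (card_le_fourierError (Q := N / 12) (by omega) (fun T _ hT => ?_)
      hA hAP).trans (fourierError_le hq1 hM1 N (hB _ (by positivity)) hε)⟩
  refine (hM T).trans ?_
  gcongr
  · exact hq1.le
  · have h : ∑ P ∈ T, P.natDegree ≤ N + 1 := hT.trans (by omega)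
    exact_mod_cast h
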